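/- arXiv:1905.00385 — 7 statements merged into one kernel-verified Lean document; each statement's English description precedes it below -/
import Mathlib

section
/- Let M be a compact metric space and T : M → M a continuous map. Assume S ⊆ M is a compact set with empty interior such that T(S) ⊆ S and T(M \ S) ⊆ M \ S. If S repels for T, then there exists a compact set K ⊆ M \ S with T(K) ⊆ K such that for every x ∈ M \ S there is m = m(x) > 0 with Tᵏx ∈ K for all k ≥ m. -/
open Set Filter Metric Topology

/-- Let `M` be a compact metric space and `T : M → M` continuous.
Assume `S ⊆ M` is a nonempty compact set with empty interior such that `T(S) ⊆ S`
and `T(M \ S) ⊆ M \ S`.  If `S` repels for `T` (there is `ε > 0` such that every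
`x ∈ M \ S` has a time `k₀ > 0` after which the orbit stays at distance `≥ ε`
from `S`), then there exists a compact set `K ⊆ M \ S` with `T(K) ⊆ K` such that
for every `x ∈ M \ S` there is `m > 0` with `Tᵏx ∈ K` for all `k ≥ m`. -/
theorem stmt0 {M : Type*} [MetricSpace M] [CompactSpace M]
    (T : M → M) (hT : Continuous T)
    (S : Set M) (hSne : S.Nonempty) (hScomp : IsCompact S)
    (hSint : interior S = ∅)
    (hTS : T '' S ⊆ S) (hTSc : T '' Sᶜ ⊆ Sᶜ)
    (hrepel : ∃ ε > (0 : ℝ), ∀ x ∈ Sᶜ, ∃ k₀ > 0, ∀ k ≥ k₀,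
      ε ≤ Metric.infDist (T^[k] x) S) :
    ∃ K : Set M, IsCompact K ∧ K ⊆ Sᶜ ∧ T '' K ⊆ K ∧
      ∀ x ∈ Sᶜ, ∃ m > 0, ∀ k ≥ m, T^[k] x ∈ K := by
  obtain ⟨ε, hε, hrep⟩ := hrepel
  have hcont : Continuous fun x => Metric.infDist x S := Metric.continuous_infDist_pt S
  set A : Set M := {x | ε / 2 ≤ Metric.infDist x S} with hA
  have hAc : IsCompact A := (isClosed_le continuous_const hcont).isCompact
  have hAS : A ⊆ Sᶜ := by
    intro x hx hxS
    have h0 := Metric.infDist_zero_of_mem hxS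
    have h1 : ε / 2 ≤ Metric.infDist x S := hx
    linarith
  have hit : ∀ (k : ℕ) (x : M), x ∈ Sᶜ → T^[k] x ∈ Sᶜ := by
    intro k
    induction k with
    | zero => intro x hx; simpa using hx
    | succ k ih =>
      intro x hx
      rw [Function.iterate_succ_apply]
      exact ih _ (hTSc ⟨x, hx, rfl⟩)
  let V : ℕ → Set M := fun n =>
    ⋃ k ∈ Set.Icc 1 n, {x | ε / 2 < Metric.infDist (T^[k] x) S}
  have hVo : ∀ n, IsOpen (V n) := fun n =>
    isOpen_biUnion fun k _ => isOpen_lt continuous_const (hcont.comp (hT.iterate k))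
  have hVm : Monotone V := fun a b hab =>
    Set.biUnion_subset_biUnion_left (Set.Icc_subset_Icc_right hab)
  have hcov : A ⊆ ⋃ n, V n := by
    intro x hx
    obtain ⟨k, hk, h⟩ := hrep x (hAS hx)
    have h1 := h k le_rfl
    refine Set.mem_iUnion.2 ⟨k, Set.mem_biUnion (x := k) ⟨hk, le_rfl⟩ ?_⟩
    show ε / 2 < _
    linarith
  obtain ⟨N, hN⟩ := hAc.elim_directed_cover V hVo hcov hVm.directed_le
  refine ⟨⋃ k ∈ Set.Iic N, T^[k] '' A, ?_, ?_, ?_, ?_⟩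
  · exact (Set.finite_Iic N).isCompact_biUnion fun k _ => hAc.image (hT.iterate k)
  · refine Set.iUnion₂_subset fun k _ => ?_
    rintro _ ⟨x, hx, rfl⟩
    exact hit k x (hAS hx)
  · rintro _ ⟨y, hy, rfl⟩
    obtain ⟨k, hk, x, hx, rfl⟩ := Set.mem_iUnion₂.1 hy
    have hk' : k ≤ N := hk
    obtain ⟨j, hj, hjx⟩ := Set.mem_iUnion₂.1 (hN hx)
    have hjl : ε / 2 < Metric.infDist (T^[j] x) S := hjx
    have hjA : T^[j] x ∈ A := hjl.le
    have hj1 : 1 ≤ j := hj.1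
    have hj2 : j ≤ N := hj.2
    rw [← Function.iterate_succ_apply' T k x]
    rcases Nat.lt_or_ge k N with h | h
    · exact Set.mem_iUnion₂.2 ⟨k + 1, h, x, hx, rfl⟩
    · refine Set.mem_iUnion₂.2 ⟨k + 1 - j, ?_, T^[j] x, hjA, ?_⟩
      · show k + 1 - j ≤ N
        omega
      · rw [← Function.iterate_add_apply]
        congr 2
        omega
  · intro x hx
    obtain ⟨k₀, hk₀, h⟩ := hrep x hx
    refine ⟨k₀, hk₀, fun k hk => Set.mem_iUnion₂.2 ⟨0, Nat.zero_le N, T^[k] x, ?_, rfl⟩⟩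
    have h1 := h k hk
    show ε / 2 ≤ _
    linarith
end

section
/- Let T : ℝ₊ⁿ → ℝ₊ⁿ be a Kolmogorov map which is dissipative with global attractor J, and set ∂J = J ∩ ∂ℝ₊ⁿ. If there exist real numbers ν₁, …, νₙ > 0 such that Σᵢ₌₁ⁿ νᵢ ln Fᵢ(x) > 0 for all x ∈ Ω(∂J), then T is permanent. -/
open Set Filter Metric Topology

/-- The nonnegative cone ℝ₊ⁿ. -/
def orthant (n : ℕ) : Set (Fin n → ℝ) := {x | ∀ i, 0 ≤ x i}

/-- The open cone int ℝ₊ⁿ. -/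
def intOrthant (n : ℕ) : Set (Fin n → ℝ) := {x | ∀ i, 0 < x i}

/-- The boundary ∂ℝ₊ⁿ = ℝ₊ⁿ \ int ℝ₊ⁿ. -/
def bdryOrthant (n : ℕ) : Set (Fin n → ℝ) := orthant n \ intOrthant n

/-- T is permanent: there is a compact positively invariant set `K ⊆ int ℝ₊ⁿ`
absorbing every orbit starting in `int ℝ₊ⁿ`. -/
def Permanent {n : ℕ} (T : (Fin n → ℝ) → (Fin n → ℝ)) : Prop :=
  ∃ K : Set (Fin n → ℝ), IsCompact K ∧ K ⊆ intOrthant n ∧ T '' K ⊆ K ∧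
    ∀ x ∈ intOrthant n, ∃ m : ℕ, 0 < m ∧ ∀ k ≥ m, T^[k] x ∈ K

/-- ω(x): the set of limit points of the orbit (Tᵏx)ₖ≥₀. -/
def omegaSet {n : ℕ} (T : (Fin n → ℝ) → (Fin n → ℝ)) (x : Fin n → ℝ) :
    Set (Fin n → ℝ) :=
  {y | ∃ φ : ℕ → ℕ, StrictMono φ ∧ Tendsto (fun k => T^[φ k] x) atTop (𝓝 y)}

/-- Ω(S): the closure of the union of the ω(x) over x ∈ S. -/
def bigOmega {n : ℕ} (T : (Fin n → ℝ) → (Fin n → ℝ)) (S : Set (Fin n → ℝ)) :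
    Set (Fin n → ℝ) :=
  closure (⋃ x ∈ S, omegaSet T x)

/-- J is a global attractor for T on ℝ₊ⁿ: a nonempty compact invariant
(T(J) = J) subset of ℝ₊ⁿ attracting every bounded subset of ℝ₊ⁿ. -/
def IsGlobalAttractor {n : ℕ} (T : (Fin n → ℝ) → (Fin n → ℝ))
    (J : Set (Fin n → ℝ)) : Prop :=
  J.Nonempty ∧ IsCompact J ∧ J ⊆ orthant n ∧ T '' J = J ∧
    ∀ D ⊆ orthant n, Bornology.IsBounded D → ∀ ε > (0 : ℝ), ∃ k₀ : ℕ,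
      ∀ k ≥ k₀, ∀ x ∈ D, T^[k] x ∈ Metric.thickening ε J

/-- If along a sequence `g` is eventually at least `δ > 0`, its partial sums exceed 1. -/
lemma exists_sum_gt (a : ℕ → ℝ) (δ : ℝ) (hδ : 0 < δ) (h : ∀ᶠ j in atTop, δ ≤ a j) :
    ∃ k, 1 ≤ k ∧ 1 < ∑ j ∈ Finset.range k, a j := by
  obtain ⟨m, hm⟩ := eventually_atTop.1 h
  have key : ∀ l : ℕ, (∑ j ∈ Finset.range m, a j) + l * δ ≤ ∑ j ∈ Finset.range (m + l), a j := by
    intro l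
    induction l with
    | zero => simp
    | succ l ih =>
      rw [← add_assoc, Finset.sum_range_succ]
      have := hm (m + l) (by omega)
      push_cast
      linarith
  obtain ⟨l, hl⟩ := exists_nat_gt ((1 - ∑ j ∈ Finset.range m, a j) / δ)
  rw [div_lt_iff₀ hδ] at hl
  refine ⟨m + (l + 1), by omega, ?_⟩
  have := key (l + 1)
  push_cast at this
  linarith

/-- Abstract sequence lemma: eventual lower bound. -/
lemma seq_lower (a : ℕ → ℝ) (ha : ∀ k, 0 < a k) (p c : ℝ) (hp : 0 < p) (hc : 0 < c) (hc1 : c ≤ 1)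
    (M k0 : ℕ) (hstep : ∀ k ≥ k0, c * a k ≤ a (k + 1))
    (hjump : ∀ k ≥ k0, a k ≤ p → ∃ j, 1 ≤ j ∧ j ≤ M ∧ 2 * a k ≤ a (k + j)) :
    ∃ m, k0 ≤ m ∧ ∀ k ≥ m, c ^ (M + 1) * (c * p) ≤ a k := by
  have h1 : ∃ m ≥ k0, p < a m := by
    by_contra! hcon
    have : ∀ l : ℕ, ∃ k ≥ k0, 2 ^ l * a k0 ≤ a k := by
      intro l
      induction l with
      | zero => exact ⟨k0, le_rfl, by simp⟩
      | succ l ih =>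
        obtain ⟨k, hk, hk2⟩ := ih
        obtain ⟨j, _, _, hj⟩ := hjump k hk (hcon k hk)
        refine ⟨k + j, by omega, ?_⟩
        rw [pow_succ]
        linarith
    obtain ⟨l, hl⟩ := pow_unbounded_of_one_lt (p / a k0) (one_lt_two)
    rw [div_lt_iff₀ (ha k0)] at hl
    obtain ⟨k, hk, hk2⟩ := this l
    linarith [hcon k hk]
  obtain ⟨m, hm, hpm⟩ := h1
  have hpow : ∀ t ≥ k0, ∀ i : ℕ, c ^ i * a t ≤ a (t + i) := by
    intro t ht i
    induction i with
    | zero => simp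
    | succ i ih =>
      have := hstep (t + i) (by omega)
      rw [← add_assoc, pow_succ]
      nlinarith
  have hchk : ∀ d : ℕ, ∃ t ≥ m, t ≤ m + d ∧ m + d < t + (M + 1) ∧ c * p ≤ a t := by
    intro d
    induction d with
    | zero => exact ⟨m, le_rfl, by omega, by omega, by nlinarith⟩
    | succ d ih =>
      obtain ⟨t, ht, htd, hdt, hct⟩ := ih
      by_cases hlt : m + (d + 1) < t + (M + 1)
      · exact ⟨t, ht, by omega, hlt, hct⟩
      · by_cases hpt : a t ≤ p
        · obtain ⟨j, hj1, hjM, hj⟩ := hjump t (by omega) hpt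
          exact ⟨t + j, by omega, by omega, by omega, by linarith [ha t]⟩
        · push Not at hpt
          refine ⟨t + 1, by omega, by omega, by omega, ?_⟩
          have := hstep t (by omega)
          nlinarith
  refine ⟨m, hm, fun k hk => ?_⟩
  obtain ⟨t, ht, htd, hdt, hct⟩ := hchk (k - m)
  have e : t + (k - t) = k := by omega
  have h2 := hpow t (by omega) (k - t)
  rw [e] at h2
  refine le_trans ?_ h2
  have h3 : c ^ (M + 1) ≤ c ^ (k - t) := pow_le_pow_of_le_one hc.le hc1 (by omega)
  exact mul_le_mul h3 hct (by positivity) (by positivity)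

/-- Permanence criterion for dissipative Kolmogorov maps. -/
theorem stmt1 (n : ℕ) (F : Fin n → (Fin n → ℝ) → ℝ)
    (hFcont : ∀ i, ContinuousOn (F i) (orthant n))
    (hFpos : ∀ i, ∀ x ∈ orthant n, 0 < F i x)
    (T : (Fin n → ℝ) → (Fin n → ℝ)) (hT : ∀ x i, T x i = x i * F i x)
    (J : Set (Fin n → ℝ)) (hJ : IsGlobalAttractor T J)
    (ν : Fin n → ℝ) (hν : ∀ i, 0 < ν i)
    (hg : ∀ x ∈ bigOmega T (J ∩ bdryOrthant n),
      0 < ∑ i, ν i * Real.log (F i x)) :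
    Permanent T := by
  obtain ⟨hJne, hJc, hJO, hTJ, hattr⟩ := hJ
  -- basic facts
  have hOcl : IsClosed (orthant n) := by
    have : orthant n = ⋂ i, {x | 0 ≤ x i} := by ext x; simp [orthant]
    rw [this]
    exact isClosed_iInter fun i => isClosed_le continuous_const (continuous_apply i)
  have hIop : IsOpen (intOrthant n) := by
    have : intOrthant n = ⋂ i, {x | 0 < x i} := by ext x; simp [intOrthant]
    rw [this]
    exact isOpen_iInter_of_finite fun i => isOpen_lt continuous_const (continuous_apply i)
  have hInt_sub : intOrthant n ⊆ orthant n := fun x hx i => (hx i).le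
  have hTO : MapsTo T (orthant n) (orthant n) := fun x hx i => by
    rw [hT]; exact mul_nonneg (hx i) (hFpos i x hx).le
  have hTI : MapsTo T (intOrthant n) (intOrthant n) := fun x hx i => by
    rw [hT]; exact mul_pos (hx i) (hFpos i x (hInt_sub hx))
  have hTJ' : MapsTo T J J := fun x hx => hTJ ▸ mem_image_of_mem T hx
  have hTc : ContinuousOn T (orthant n) := by
    refine continuousOn_pi.2 fun i => ?_
    have : (fun x => T x i) = fun x => x i * F i x := funext fun x => hT x i
    rw [this]
    exact (continuous_apply i).continuousOn.mul (hFcont i)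
  have hTkO : ∀ k, MapsTo T^[k] (orthant n) (orthant n) := fun k => hTO.iterate k
  have hTkc : ∀ k, ContinuousOn T^[k] (orthant n) := fun k => hTc.iterate hTO k
  set g : (Fin n → ℝ) → ℝ := fun x => ∑ i, ν i * Real.log (F i x) with hgdef
  have hgc : ContinuousOn g (orthant n) := by
    refine continuousOn_finsetSum _ fun i _ => continuousOn_const.mul ?_
    exact (hFcont i).log fun x hx => (hFpos i x hx).ne'
  set P : (Fin n → ℝ) → ℝ := fun x => ∏ i, x i ^ ν i with hPdef
  have hPc : Continuous P := by
    refine continuous_finsetProd _ fun i _ => ?_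
    exact (continuous_apply i).rpow_const fun x => Or.inr (hν i).le
  have hPT : ∀ x ∈ orthant n, P (T x) = P x * Real.exp (g x) := by
    intro x hx
    simp only [hPdef, hgdef, Real.exp_sum, ← Finset.prod_mul_distrib]
    refine Finset.prod_congr rfl fun i _ => ?_
    rw [hT, Real.mul_rpow (hx i) (hFpos i x hx).le, Real.rpow_def_of_pos (hFpos i x hx),
      mul_comm (ν i)]
  have hPpos : ∀ x ∈ intOrthant n, 0 < P x := fun x hx =>
    Finset.prod_pos fun i _ => Real.rpow_pos_of_pos (hx i) _
  have hPI : ∀ x ∈ orthant n, 0 < P x → x ∈ intOrthant n := by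
    intro x hx hP i
    refine lt_of_le_of_ne (hx i) fun h0 => ?_
    have : P x = 0 := Finset.prod_eq_zero (Finset.mem_univ i) (by
      rw [← h0, Real.zero_rpow (hν i).ne'])
    linarith
  have hPTk : ∀ x ∈ orthant n, ∀ k, P (T^[k] x) =
      P x * Real.exp (∑ j ∈ Finset.range k, g (T^[j] x)) := by
    intro x hx k
    induction k with
    | zero => simp
    | succ k ih =>
      rw [Function.iterate_succ_apply', hPT _ (hTkO k hx), ih, Finset.sum_range_succ,
        Real.exp_add, mul_assoc]
  have hSc : ∀ k, ContinuousOn (fun x => ∑ j ∈ Finset.range k, g (T^[j] x)) (orthant n) :=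
    fun k => continuousOn_finsetSum _ fun j _ => hgc.comp (hTkc j) (hTkO j)
  -- the boundary part of J
  set B := J ∩ bdryOrthant n with hB
  have hBJ : B = J \ intOrthant n := by
    ext x
    constructor
    · exact fun h => ⟨h.1, h.2.2⟩
    · exact fun h => ⟨h.1, hJO h.1, h.2⟩
  have hBc : IsCompact B := hBJ ▸ hJc.diff hIop
  have hΩJ : bigOmega T B ⊆ J := by
    refine closure_minimal ?_ hJc.isClosed
    refine iUnion₂_subset fun x hx => ?_
    rintro y ⟨φ, _, hy⟩
    exact hJc.isClosed.mem_of_tendsto hy (Eventually.of_forall fun k => hTJ'.iterate _ hx.1)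
  have hΩc : IsCompact (bigOmega T B) := hJc.of_isClosed_subset isClosed_closure hΩJ
  obtain ⟨δ, hδ, hδΩ⟩ := hΩc.exists_forall_le' (hgc.mono (hΩJ.trans hJO)) hg
  have hsum : ∀ x ∈ B, ∃ k, 1 ≤ k ∧ 1 < ∑ j ∈ Finset.range k, g (T^[j] x) := by
    intro x hx
    refine exists_sum_gt _ (δ / 2) (by linarith) ?_
    by_contra hcon
    have hfr : ∃ᶠ j in atTop, g (T^[j] x) < δ / 2 := by
      simpa [Filter.Frequently] using hcon
    obtain ⟨φ, hφ, hφg⟩ := extraction_of_frequently_atTop hfr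
    obtain ⟨y, hyJ, ψ, hψ, hy⟩ := hJc.tendsto_subseq
      (fun k => (hTJ'.iterate (φ k) hx.1 : T^[φ k] x ∈ J))
    have hyΩ : y ∈ bigOmega T B :=
      subset_closure (mem_iUnion₂.2 ⟨x, hx, φ ∘ ψ, hφ.comp hψ, hy⟩)
    have h1 := hδΩ y hyΩ
    have hy' : Tendsto (fun k => T^[φ (ψ k)] x) atTop (𝓝[orthant n] y) :=
      tendsto_nhdsWithin_iff.2 ⟨hy, Eventually.of_forall fun k => hTkO _ (hJO hx.1)⟩
    have h2 : Tendsto (fun k => g (T^[φ (ψ k)] x)) atTop (𝓝 (g y)) :=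
      (hgc y (hJO hyJ)).tendsto.comp hy'
    have h3 : g y ≤ δ / 2 := le_of_tendsto h2 (Eventually.of_forall fun k => (hφg (ψ k)).le)
    linarith
  have hU : ∃ M : ℕ, ∃ U : Set (Fin n → ℝ), IsOpen U ∧ B ⊆ U ∧ ∀ x ∈ U, x ∈ orthant n →
      ∃ k, 1 ≤ k ∧ k ≤ M ∧ 1 < ∑ j ∈ Finset.range k, g (T^[j] x) := by
    refine hBc.induction_on (p := fun s => ∃ M : ℕ, ∃ U : Set (Fin n → ℝ), IsOpen U ∧ s ⊆ U ∧
      ∀ x ∈ U, x ∈ orthant n →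
      ∃ k, 1 ≤ k ∧ k ≤ M ∧ 1 < ∑ j ∈ Finset.range k, g (T^[j] x)) ?_ ?_ ?_ ?_
    · exact ⟨0, ∅, isOpen_empty, Subset.rfl, fun x hx => hx.elim⟩
    · rintro s t hst ⟨M, U, h1, h2, h3⟩
      exact ⟨M, U, h1, hst.trans h2, h3⟩
    · rintro s t ⟨M, U, h1, h2, h3⟩ ⟨M', U', h1', h2', h3'⟩
      refine ⟨max M M', U ∪ U', h1.union h1', union_subset_union h2 h2', ?_⟩
      rintro x (hx | hx) hxO
      · obtain ⟨k, a, b, c⟩ := h3 x hx hxO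
        exact ⟨k, a, le_max_of_le_left b, c⟩
      · obtain ⟨k, a, b, c⟩ := h3' x hx hxO
        exact ⟨k, a, le_max_of_le_right b, c⟩
    · intro x hx
      obtain ⟨k, hk, hkx⟩ := hsum x hx
      have hev := (hSc k x (hJO hx.1)).eventually (lt_mem_nhds hkx)
      obtain ⟨U, hUo, hxU, hUs⟩ := mem_nhdsWithin.1 hev
      refine ⟨U, mem_nhdsWithin_of_mem_nhds (hUo.mem_nhds hxU), k, U, hUo, Subset.rfl, ?_⟩
      intro z hz hzO
      exact ⟨k, hk, le_rfl, hUs ⟨hz, hzO⟩⟩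
  obtain ⟨M, U, hUo, hBU, hUS⟩ := hU
  obtain ⟨p', hp', hpU⟩ := (hJc.diff hUo).exists_forall_le' (a := 0) hPc.continuousOn (by
    intro x hx
    refine hPpos x ?_
    by_contra hxI
    exact hx.2 (hBU (hBJ ▸ ⟨hx.1, hxI⟩)))
  set p := p' / 2 with hpdef
  have hp : 0 < p := by positivity
  have hVo : IsOpen (U ∪ {x | p < P x}) := hUo.union (isOpen_lt continuous_const hPc)
  have hJV : J ⊆ U ∪ {x | p < P x} := by
    intro x hx
    by_cases hxU : x ∈ U
    · exact Or.inl hxU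
    · right
      have := hpU x ⟨hx, hxU⟩
      change p < P x
      linarith
  obtain ⟨ε, hε, hεV⟩ := hJc.exists_thickening_subset_open hVo hJV
  set N := cthickening ε J ∩ orthant n with hN
  have hNc : IsCompact N := hJc.cthickening.inter_right hOcl
  obtain ⟨C, hC⟩ := hNc.bddBelow_image (hgc.mono inter_subset_right)
  have hC' : ∀ x ∈ N, C ≤ g x := fun x hx => hC (mem_image_of_mem g hx)
  set c := Real.exp (min C 0) with hcdef
  have hc : 0 < c := Real.exp_pos _
  have hc1 : c ≤ 1 := Real.exp_le_one_iff.2 (min_le_right _ _)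
  set q := c ^ (M + 1) * (c * p) with hq
  have hqpos : 0 < q := by positivity
  set L := N ∩ {x | q ≤ P x} with hL
  have hLc : IsCompact L := hNc.inter_right (isClosed_le continuous_const hPc)
  have hLO : L ⊆ orthant n := fun x hx => hx.1.2
  have hev : ∀ x ∈ intOrthant n, ∃ m, ∀ k ≥ m, T^[k] x ∈ L := by
    intro x hx
    have hxO := hInt_sub hx
    obtain ⟨k0, hk0⟩ := hattr {x} (singleton_subset_iff.2 hxO) Bornology.isBounded_singleton ε hε
    have hth : ∀ k ≥ k0, T^[k] x ∈ thickening ε J := fun k hk => hk0 k hk x rfl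
    have hkN : ∀ k ≥ k0, T^[k] x ∈ N := fun k hk =>
      ⟨thickening_subset_cthickening _ _ (hth k hk), hTkO k hxO⟩
    have hkP : ∀ k, 0 < P (T^[k] x) := fun k => hPpos _ (hTI.iterate k hx)
    obtain ⟨m, hm, hmq⟩ := seq_lower (fun k => P (T^[k] x)) hkP p c hp hc hc1 M k0 (by
      intro k hk
      rw [Function.iterate_succ_apply', hPT _ (hTkO k hxO), mul_comm]
      refine mul_le_mul_of_nonneg_left ?_ (hkP k).le
      exact Real.exp_le_exp.2 ((min_le_left _ _).trans (hC' _ (hkN k hk)))) (by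
      intro k hk hkp
      have hkU : T^[k] x ∈ U := by
        rcases hεV (hth k hk) with h | h
        · exact h
        · exact absurd h (not_lt.2 hkp)
      obtain ⟨j, hj1, hjM, hj⟩ := hUS _ hkU (hTkO k hxO)
      refine ⟨j, hj1, hjM, ?_⟩
      rw [add_comm k j, Function.iterate_add_apply, hPTk _ (hTkO k hxO), mul_comm]
      refine mul_le_mul_of_nonneg_left ?_ (hkP k).le
      have := Real.add_one_le_exp (∑ i ∈ Finset.range j, g (T^[i] (T^[k] x)))
      linarith)
    exact ⟨m, fun k hk => ⟨hkN k (by omega), hmq k hk⟩⟩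
  refine ⟨{x | ∀ k, T^[k] x ∈ L}, ?_, ?_, ?_, ?_⟩
  · have : {x | ∀ k, T^[k] x ∈ L} = L ∩ ⋂ k, (orthant n ∩ T^[k] ⁻¹' L) := by
      ext x
      simp only [mem_ofPred_eq, mem_inter_iff, mem_iInter, mem_preimage]
      exact ⟨fun h => ⟨h 0, fun k => ⟨hLO (h 0), h k⟩⟩, fun h k => (h.2 k).2⟩
    rw [this]
    exact hLc.inter_right (isClosed_iInter fun k =>
      (hTkc k).preimage_isClosed_of_isClosed hOcl hLc.isClosed)
  · intro x hx
    have h0 : x ∈ L := hx 0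
    exact hPI x (hLO h0) (hqpos.trans_le h0.2)
  · rintro _ ⟨x, hx, rfl⟩ k
    rw [← Function.iterate_succ_apply]
    exact hx (k + 1)
  · intro x hx
    obtain ⟨m, hm⟩ := hev x hx
    refine ⟨m + 1, by omega, fun k hk j => ?_⟩
    rw [← Function.iterate_add_apply]
    exact hm _ (by omega)
end

section
/- Let T : ℝ₊ⁿ → ℝ₊ⁿ be a Kolmogorov map admitting a carrying simplex Σ, and set ∂Σ = Σ ∩ ∂ℝ₊ⁿ. If there exist real numbers ν₁, …, νₙ > 0 such that Σᵢ₌₁ⁿ νᵢ ln Fᵢ(x) > 0 for all x ∈ Ω(∂Σ), then T is permanent. -/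
open Set Filter Metric Topology

/-- A carrying simplex for T: a compact invariant unordered subset of
ℝ₊ⁿ \ {0}, homeomorphic to the standard probability simplex via the radial
projection, attracting every nontrivial orbit asymptotically, on which T is
a homeomorphism. -/
def IsCarryingSimplex {n : ℕ} (T : (Fin n → ℝ) → (Fin n → ℝ))
    (S : Set (Fin n → ℝ)) : Prop :=
  S ⊆ orthant n \ {0} ∧
  IsCompact S ∧ T '' S = S ∧
  (∀ x ∈ orthant n \ {0}, ∃ z ∈ S,
    Tendsto (fun k => dist (T^[k] x) (T^[k] z)) atTop (𝓝 0)) ∧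
  (∀ x ∈ S, ∀ z ∈ S, (∀ i, x i ≤ z i) → x = z) ∧
  Set.BijOn (fun x => (∑ i, x i)⁻¹ • x) S (stdSimplex ℝ (Fin n)) ∧
  Set.BijOn T S S

/-- A compact set whose core is visited by every orbit generates an absorbing set. -/
theorem absorbing_aux {n : ℕ} (T : (Fin n → ℝ) → (Fin n → ℝ)) (Y U O : Set (Fin n → ℝ))
    (hYo : IsOpen Y) (hTY : ∀ x ∈ Y, T x ∈ Y) (hTc : ContinuousOn T Y)
    (hU : IsCompact U) (hUY : U ⊆ Y) (hO : IsOpen O) (hOU : O ⊆ U)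
    (hit : ∀ x ∈ Y, ∃ k, T^[k] x ∈ O) :
    ∃ K : Set (Fin n → ℝ), IsCompact K ∧ K ⊆ Y ∧ T '' K ⊆ K ∧
      ∀ x ∈ Y, ∃ m : ℕ, 0 < m ∧ ∀ k ≥ m, T^[k] x ∈ K := by
  have hmaps : MapsTo T Y Y := hTY
  have hitc : ∀ k, ContinuousOn (T^[k]) Y := fun k => hTc.iterate hmaps k
  have hcover : U ⊆ ⋃ k : ℕ, Y ∩ T^[k+1] ⁻¹' O := by
    intro x hx
    obtain ⟨k, hk⟩ := hit (T x) (hTY x (hUY hx))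
    exact mem_iUnion.2 ⟨k, hUY hx, by simpa [Function.iterate_succ_apply] using hk⟩
  obtain ⟨t, ht⟩ := hU.elim_finite_subcover _
    (fun k => (hitc (k+1)).isOpen_inter_preimage hYo hO) hcover
  obtain ⟨N, hN⟩ : ∃ N : ℕ, ∀ j ∈ t, j ≤ N := ⟨t.sup id, fun j hj => Finset.le_sup (f := id) hj⟩
  have hKinv : ∀ x ∈ ⋃ k ∈ Set.Iic N, T^[k] '' U, T x ∈ ⋃ k ∈ Set.Iic N, T^[k] '' U := by
    intro x hx
    simp only [mem_iUnion, mem_Iic, mem_image] at hx ⊢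
    obtain ⟨k, hk, u, hu, rfl⟩ := hx
    rcases Nat.lt_or_ge k N with h | h
    · exact ⟨k+1, h, u, hu, Function.iterate_succ_apply' _ _ _⟩
    · have hkN : k = N := le_antisymm hk h
      subst hkN
      have := ht hu
      simp only [mem_iUnion] at this
      obtain ⟨j, hj, -, hj2⟩ := this
      refine ⟨k - j, Nat.sub_le _ _, T^[j+1] u, hOU hj2, ?_⟩
      rw [← Function.iterate_add_apply, ← Function.iterate_succ_apply' T]
      congr 2
      have := hN j hj
      omega
  refine ⟨⋃ k ∈ Set.Iic N, T^[k] '' U, ?_, ?_, ?_, ?_⟩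
  · exact (Set.finite_Iic N).isCompact_biUnion
      (fun k _ => hU.image_of_continuousOn ((hitc k).mono hUY))
  · intro x hx
    simp only [mem_iUnion, mem_image] at hx
    obtain ⟨k, _, u, hu, rfl⟩ := hx
    exact hmaps.iterate k (hUY hu)
  · rintro _ ⟨x, hx, rfl⟩
    exact hKinv x hx
  · intro x hx
    obtain ⟨k0, hk0⟩ := hit x hx
    have h0 : T^[k0] x ∈ ⋃ k ∈ Set.Iic N, T^[k] '' U := by
      simp only [mem_iUnion, mem_Iic, mem_image]
      exact ⟨0, Nat.zero_le _, _, hOU hk0, rfl⟩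
    refine ⟨k0 + 1, Nat.succ_pos _, fun k hk => ?_⟩
    obtain ⟨d, rfl⟩ : ∃ d, k = d + k0 := ⟨k - k0, by omega⟩
    clear hk
    rw [Function.iterate_add_apply]
    have hm : MapsTo T (⋃ k ∈ Set.Iic N, T^[k] '' U) (⋃ k ∈ Set.Iic N, T^[k] '' U) := hKinv
    exact hm.iterate d h0

/-- Growth of products along an orbit whose limit points all have growth rate above one. -/
theorem growth_aux {n : ℕ} (T : (Fin n → ℝ) → (Fin n → ℝ)) (S P : Set (Fin n → ℝ))
    (G : (Fin n → ℝ) → ℝ) (hGc : ContinuousOn G P) (hGpos : ∀ x ∈ P, 0 < G x)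
    (hS : IsCompact S) (hSP : S ⊆ P) (hTS : MapsTo T S S) (y : Fin n → ℝ) (hy : y ∈ S)
    (hω : ∀ z ∈ omegaSet T y, 1 < G z) :
    ∃ k, 2 < ∏ j ∈ Finset.range k, G (T^[j] y) := by
  have horb : ∀ j, T^[j] y ∈ S := fun j => hTS.iterate j hy
  have hev : ∃ δ > 0, ∃ m, ∀ j ≥ m, 1 + δ ≤ G (T^[j] y) := by
    by_contra! hcon
    have h1 : ∀ p N : ℕ, ∃ j, N ≤ j ∧ G (T^[j] y) < 1 + 1 / ((p : ℝ) + 1) := by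
      intro p N
      obtain ⟨j, hj, hj2⟩ := hcon (1 / ((p : ℝ) + 1)) (by positivity) N
      exact ⟨j, hj, hj2⟩
    obtain ⟨φ, hφ, hφ2⟩ := extraction_forall_of_frequently
      (P := fun p j => G (T^[j] y) < 1 + 1 / ((p : ℝ) + 1))
      (fun p => frequently_atTop.2 (fun N => by
        obtain ⟨j, hj, hj2⟩ := h1 p N; exact ⟨j, hj, hj2⟩))
    obtain ⟨z, hz, ψ, hψ, hlim⟩ := hS.tendsto_subseq (fun p => horb (φ p))
    have hzω : z ∈ omegaSet T y := ⟨φ ∘ ψ, hφ.comp hψ, hlim⟩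
    have hGlim : Tendsto (fun p => G (T^[φ (ψ p)] y)) atTop (𝓝 (G z)) := by
      have := hGc z (hSP hz)
      exact this.tendsto.comp (tendsto_nhdsWithin_iff.2
        ⟨hlim, Eventually.of_forall fun p => hSP (horb _)⟩)
    have hb : Tendsto (fun p : ℕ => (1 : ℝ) + 1 / (((ψ p : ℕ) : ℝ) + 1)) atTop (𝓝 (1 + 0)) :=
      tendsto_const_nhds.add ((tendsto_one_div_add_atTop_nhds_zero_nat (𝕜 := ℝ)).comp
        hψ.tendsto_atTop)
    have := le_of_tendsto_of_tendsto' hGlim hb (fun p => (hφ2 (ψ p)).le)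
    have := hω z hzω
    linarith
  obtain ⟨δ, hδ, m, hm⟩ := hev
  set C := ∏ j ∈ Finset.range m, G (T^[j] y) with hC
  have hCpos : 0 < C := Finset.prod_pos fun j _ => hGpos _ (hSP (horb j))
  have hgrow : ∀ p : ℕ, C * (1 + δ) ^ p ≤ ∏ j ∈ Finset.range (m + p), G (T^[j] y) := by
    intro p
    induction p with
    | zero => simp [hC]
    | succ p ih =>
      rw [← Nat.add_assoc, Finset.prod_range_succ, pow_succ, ← mul_assoc]
      exact mul_le_mul ih (hm _ (by omega)) (by positivity) (le_trans (by positivity) ih)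
  obtain ⟨p, hp⟩ := pow_unbounded_of_one_lt (2 / C) (by linarith : 1 < 1 + δ)
  refine ⟨m + p, lt_of_lt_of_le ?_ (hgrow p)⟩
  rw [div_lt_iff₀ hCpos] at hp
  linarith

/-- Permanence criterion via the carrying simplex. -/
theorem stmt3 (n : ℕ) (F : Fin n → (Fin n → ℝ) → ℝ)
    (hFcont : ∀ i, ContinuousOn (F i) (orthant n))
    (hFpos : ∀ i, ∀ x ∈ orthant n, 0 < F i x)
    (T : (Fin n → ℝ) → (Fin n → ℝ)) (hT : ∀ x i, T x i = x i * F i x)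
    (S : Set (Fin n → ℝ)) (hS : IsCarryingSimplex T S)
    (ν : Fin n → ℝ) (hν : ∀ i, 0 < ν i)
    (hg : ∀ x ∈ bigOmega T (S ∩ bdryOrthant n),
      0 < ∑ i, ν i * Real.log (F i x)) :
    Permanent T := by
  rcases Nat.eq_zero_or_pos n with hn | hn
  · subst hn
    refine ⟨univ, isCompact_univ, fun x _ i => i.elim0, subset_univ _, fun x _ => ⟨1, one_pos, fun _ _ => mem_univ _⟩⟩
  obtain ⟨hSsub, hScomp, hTS, hattr, -, hbij, -⟩ := hS
  let i0 : Fin n := ⟨0, hn⟩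
  have hSne : S.Nonempty := by
    have : (stdSimplex ℝ (Fin n)).Nonempty := ⟨_, single_mem_stdSimplex ℝ i0⟩
    obtain ⟨p, hp⟩ := this
    obtain ⟨s, hs, -⟩ := hbij.surjOn hp
    exact ⟨s, hs⟩
  have hSP : S ⊆ orthant n := fun x hx => (hSsub hx).1
  have hTSm : MapsTo T S S := fun x hx => hTS ▸ mem_image_of_mem T hx
  have hint : intOrthant n ⊆ orthant n := fun x hx i => (hx i).le
  have hTP : MapsTo T (orthant n) (orthant n) := fun x hx i => by
    rw [hT]; exact mul_nonneg (hx i) (hFpos i x hx).le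
  have hTY : MapsTo T (intOrthant n) (intOrthant n) := fun x hx i => by
    rw [hT]; exact mul_pos (hx i) (hFpos i x (hint hx))
  have hTcP : ContinuousOn T (orthant n) := by
    refine continuousOn_pi.2 fun i => ?_
    have : (fun x => T x i) = fun x => x i * F i x := funext fun x => hT x i
    rw [this]
    exact (continuous_apply i).continuousOn.mul (hFcont i)
  have hPclosed : IsClosed (orthant n) := by
    have : orthant n = ⋂ i, {x | 0 ≤ x i} := by ext; simp [orthant]
    rw [this]
    exact isClosed_iInter fun i => isClosed_le continuous_const (continuous_apply i)
  have hYopen : IsOpen (intOrthant n) := by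
    have : intOrthant n = ⋂ i, {x | 0 < x i} := by ext; simp [intOrthant]
    rw [this]
    exact isOpen_iInter_of_finite fun i => isOpen_lt continuous_const (continuous_apply i)
  -- the average Lyapunov function and its growth factor
  let V : (Fin n → ℝ) → ℝ := fun x => ∏ i, x i ^ ν i
  let G : (Fin n → ℝ) → ℝ := fun x => ∏ i, F i x ^ ν i
  have hVc : Continuous V := continuous_finsetProd _ fun i _ =>
    (Real.continuous_rpow_const (hν i).le).comp (continuous_apply i)
  have hGc : ContinuousOn G (orthant n) := continuousOn_finsetProd _ fun i _ =>
    (hFcont i).rpow_const fun x hx => Or.inr (hν i).le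
  have hGpos : ∀ x ∈ orthant n, 0 < G x := fun x hx =>
    Finset.prod_pos fun i _ => Real.rpow_pos_of_pos (hFpos i x hx) _
  have hVpos : ∀ x ∈ intOrthant n, 0 < V x := fun x hx =>
    Finset.prod_pos fun i _ => Real.rpow_pos_of_pos (hx i) _
  have hVnn : ∀ x ∈ orthant n, 0 ≤ V x := fun x hx =>
    Finset.prod_nonneg fun i _ => Real.rpow_nonneg (hx i) _
  have hV0 : ∀ x ∈ orthant n, x ∉ intOrthant n → V x = 0 := by
    intro x hx hx2
    simp only [intOrthant, mem_ofPred_eq, not_forall, not_lt] at hx2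
    obtain ⟨i, hi⟩ := hx2
    have : x i = 0 := le_antisymm hi (hx i)
    exact Finset.prod_eq_zero (Finset.mem_univ i) (by rw [this, Real.zero_rpow (hν i).ne'])
  have hVpos' : ∀ x ∈ orthant n, 0 < V x → x ∈ intOrthant n := by
    intro x hx h
    by_contra h2
    exact h.ne' (hV0 x hx h2)
  have hVT : ∀ x ∈ orthant n, V (T x) = V x * G x := by
    intro x hx
    simp only [V, G, ← Finset.prod_mul_distrib]
    refine Finset.prod_congr rfl fun i _ => ?_
    rw [hT, Real.mul_rpow (hx i) (hFpos i x hx).le]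
  have hVk : ∀ x ∈ orthant n, ∀ k, V (T^[k] x) = V x * ∏ j ∈ Finset.range k, G (T^[j] x) := by
    intro x hx k
    induction k with
    | zero => simp
    | succ k ih =>
      rw [Function.iterate_succ_apply', hVT _ (hTP.iterate k hx), ih, Finset.prod_range_succ,
        mul_assoc]
  have hlogG : ∀ x ∈ orthant n, Real.log (G x) = ∑ i, ν i * Real.log (F i x) := by
    intro x hx
    simp only [G]
    rw [Real.log_prod (fun i _ => (Real.rpow_pos_of_pos (hFpos i x hx) _).ne')]
    exact Finset.sum_congr rfl fun i _ => Real.log_rpow (hFpos i x hx) _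
  have hgrow : ∀ y ∈ S, y ∉ intOrthant n → ∃ k, 2 < ∏ j ∈ Finset.range k, G (T^[j] y) := by
    intro y hy hy2
    refine growth_aux T S (orthant n) G hGc hGpos hScomp hSP hTSm y hy fun z hz => ?_
    have hzS : z ∈ S := by
      obtain ⟨φ, -, hlim⟩ := hz
      exact hScomp.isClosed.mem_of_tendsto hlim (Eventually.of_forall fun k => hTSm.iterate _ hy)
    have hzΩ : z ∈ bigOmega T (S ∩ bdryOrthant n) :=
      subset_closure (mem_iUnion₂.2 ⟨y, ⟨hy, hSP hy, hy2⟩, hz⟩)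
    have := hg z hzΩ
    rw [← hlogG z (hSP hzS)] at this
    exact (Real.log_pos_iff (hGpos z (hSP hzS)).le).1 this
  -- points without growth stay away from the boundary of the simplex
  have hGkc : ∀ k, ContinuousOn (fun x => ∏ j ∈ Finset.range k, G (T^[j] x)) (orthant n) :=
    fun k => continuousOn_finsetProd _ fun j _ => hGc.comp (hTcP.iterate hTP j) (hTP.iterate j)
  let B : Set (Fin n → ℝ) := Metric.cthickening 1 S ∩
    ⋂ k : ℕ, orthant n ∩ (fun x => ∏ j ∈ Finset.range k, G (T^[j] x)) ⁻¹' Iic 2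
  have hBc : IsCompact B := hScomp.cthickening.inter_right
    (isClosed_iInter fun k => (hGkc k).preimage_isClosed_of_isClosed hPclosed isClosed_Iic)
  have hhc : Continuous fun x => V x + infDist x S := hVc.add (continuous_infDist_pt S)
  have hBlow : ∃ c > 0, c ≤ 1 ∧ ∀ x ∈ B, 2 * c < V x + infDist x S := by
    rcases B.eq_empty_or_nonempty with hB | hB
    · exact ⟨1, one_pos, le_rfl, by simp [hB]⟩
    · obtain ⟨b, hb, hmin⟩ := hBc.exists_isMinOn hB hhc.continuousOn
      have hbP : b ∈ orthant n := (mem_iInter.1 hb.2 0).1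
      have hpos : 0 < V b + infDist b S := by
        by_contra hle
        have h1 := hVnn b hbP
        have h2 : 0 ≤ infDist b S := infDist_nonneg
        have h3 : infDist b S = 0 := by linarith
        have h4 : V b = 0 := by linarith
        have hbS : b ∈ S := (hScomp.isClosed.mem_iff_infDist_zero hSne).2 h3
        obtain ⟨k, hk⟩ := hgrow b hbS (fun h => (hVpos b h).ne' h4)
        have := (mem_iInter.1 hb.2 k).2
        simp only [mem_preimage, mem_Iic] at this
        linarith
      refine ⟨min 1 ((V b + infDist b S) / 3), by positivity, min_le_left _ _, fun x hx => ?_⟩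
      have h1 : V b + infDist b S ≤ V x + infDist x S := hmin hx
      have h2 := min_le_right 1 ((V b + infDist b S) / 3)
      linarith
  obtain ⟨c, hc, hc1, hBlow⟩ := hBlow
  have hcth : ∀ r : ℝ, 0 ≤ r → ∀ x, infDist x S ≤ r → x ∈ Metric.cthickening r S := by
    intro r hr x hx
    rw [hScomp.cthickening_eq_biUnion_closedBall hr]
    obtain ⟨s, hs, hs2⟩ := hScomp.exists_infDist_eq_dist hSne x
    exact mem_iUnion₂.2 ⟨s, hs, by rw [mem_closedBall, ← hs2]; exact hx⟩
  have hescape : ∀ x ∈ orthant n, infDist x S ≤ c → V x ≤ c →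
      ∃ k, 2 < ∏ j ∈ Finset.range k, G (T^[j] x) := by
    intro x hx h1 h2
    by_contra! hcon
    have : x ∈ B := ⟨hcth 1 zero_le_one x (h1.trans hc1),
      mem_iInter.2 fun k => ⟨hx, hcon k⟩⟩
    have := hBlow x this
    linarith
  let U : Set (Fin n → ℝ) := Metric.cthickening c S ∩ (orthant n ∩ {x | c ≤ V x})
  let O : Set (Fin n → ℝ) := intOrthant n ∩ ({x | infDist x S < c} ∩ {x | c < V x})
  refine absorbing_aux T (intOrthant n) U O hYopen hTY (hTcP.mono hint) ?_ ?_ ?_ ?_ ?_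
  · exact hScomp.cthickening.inter_right
      (hPclosed.inter (isClosed_le continuous_const hVc))
  · exact fun x hx => hVpos' x hx.2.1 (lt_of_lt_of_le hc hx.2.2)
  · exact hYopen.inter ((isOpen_lt (continuous_infDist_pt S) continuous_const).inter
      (isOpen_lt continuous_const hVc))
  · intro x hx
    have h1 : infDist x S < c := hx.2.1
    have h2 : c < V x := hx.2.2
    have h3 : c ≤ V x := h2.le
    exact ⟨hcth c hc.le x h1.le, hint hx.1, h3⟩
  · intro x hx
    by_contra! hcon
    have hx0 : x ≠ 0 := fun h => by
      have := hx i0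
      simp [h] at this
    obtain ⟨z, hz, hzlim⟩ := hattr x ⟨hint hx, hx0⟩
    obtain ⟨m, hm⟩ := eventually_atTop.1 (hzlim.eventually (gt_mem_nhds hc))
    have hnear : ∀ k ≥ m, infDist (T^[k] x) S < c := fun k hk =>
      lt_of_le_of_lt (infDist_le_dist_of_mem (hTSm.iterate k hz)) (hm k hk)
    have hYk : ∀ k, T^[k] x ∈ intOrthant n := fun k => hTY.iterate k hx
    have hVle : ∀ k ≥ m, V (T^[k] x) ≤ c := by
      intro k hk
      by_contra! h
      exact hcon k ⟨hYk k, hnear k hk, h⟩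
    have hdouble : ∀ p : ℕ, ∃ k ≥ m, 2 ^ p * V (T^[m] x) ≤ V (T^[k] x) := by
      intro p
      induction p with
      | zero => exact ⟨m, le_rfl, by simp⟩
      | succ p ih =>
        obtain ⟨k, hk, hk2⟩ := ih
        obtain ⟨j, hj⟩ := hescape _ (hint (hYk k)) (hnear k hk).le (hVle k hk)
        refine ⟨j + k, by omega, ?_⟩
        rw [Function.iterate_add_apply, hVk _ (hint (hYk k)), pow_succ]
        nlinarith [hVpos _ (hYk k)]
    have hVm := hVpos _ (hYk m)
    obtain ⟨p, hp⟩ := pow_unbounded_of_one_lt (c / V (T^[m] x)) (one_lt_two)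
    obtain ⟨k, hk, hk2⟩ := hdouble p
    rw [div_lt_iff₀ hVm] at hp
    linarith [hVle k hk]
end

section
/- Let T ∈ DCS(3,f). If there exist real numbers ν₁, ν₂, ν₃ > 0 such that Σᵢ₌₁³ νᵢ ln Fᵢ(x̂) > 0 for every nonzero fixed point x̂ of T lying in ∂ℝ₊³, then T is permanent. If instead Σᵢ₌₁³ νᵢ ln Fᵢ(x̂) < 0 for every nonzero fixed point x̂ of T lying in ∂ℝ₊³, then T is impermanent. -/
open Set Filter Metric Topology Polynomial

/-- The class 𝓕 of C¹ growth functions `f(z,r)` defined on ℝ₊ × (0,∞),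
bundled with the partial derivative `fz = ∂f/∂z`, satisfying
(i) f(r,r) = 1 and ∂f/∂z < 0, and (ii) f(z,r) + z ∂f/∂z(z,r) > 0. -/
structure GrowthF where
  f : ℝ → ℝ → ℝ
  fz : ℝ → ℝ → ℝ
  smooth : ContDiffOn ℝ 1 (fun p : ℝ × ℝ => f p.1 p.2) (Set.Ici 0 ×ˢ Set.Ioi 0)
  hasDeriv : ∀ z r : ℝ, 0 ≤ z → 0 < r →
    HasDerivWithinAt (fun w => f w r) (fz z r) (Set.Ici 0) z
  pos : ∀ z r : ℝ, 0 ≤ z → 0 < r → 0 < f z r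
  unit : ∀ r : ℝ, 0 < r → f r r = 1
  fz_neg : ∀ z r : ℝ, 0 ≤ z → 0 < r → fz z r < 0
  contest : ∀ z r : ℝ, 0 ≤ z → 0 < r → 0 < f z r + z * fz z r

/-- Fᵢ(x) = fᵢ(rᵢ Σⱼ μᵢⱼ xⱼ, rᵢ). -/
def DCS.F {n : ℕ} (fam : Fin n → GrowthF) (r : Fin n → ℝ) (μ : Fin n → Fin n → ℝ)
    (i : Fin n) (x : Fin n → ℝ) : ℝ :=
  (fam i).f (r i * ∑ j, μ i j * x j) (r i)

/-- A map T of the class DCS(n,f): Tᵢ(x) = xᵢ fᵢ(rᵢ Σⱼ μᵢⱼ xⱼ, rᵢ) = xᵢ Fᵢ(x). -/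
def DCS.map {n : ℕ} (fam : Fin n → GrowthF) (r : Fin n → ℝ) (μ : Fin n → Fin n → ℝ)
    (x : Fin n → ℝ) (i : Fin n) : ℝ :=
  x i * DCS.F fam r μ i x

/-- The Jacobian matrix DT(x): (DT(x))ᵢⱼ = δᵢⱼFᵢ(x) + xᵢ ∂fᵢ/∂z((RUx)ᵢ,rᵢ)·rᵢμᵢⱼ. -/
def DCS.jac {n : ℕ} (fam : Fin n → GrowthF) (r : Fin n → ℝ) (μ : Fin n → Fin n → ℝ)
    (x : Fin n → ℝ) : Matrix (Fin n) (Fin n) ℝ :=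
  Matrix.of fun i j => (if i = j then DCS.F fam r μ i x else 0)
    + x i * (fam i).fz (r i * ∑ k, μ i k * x k) (r i) * (r i * μ i j)

namespace DCSAux

theorem f_anti (g : GrowthF) {r : ℝ} (hr : 0 < r) : StrictAntiOn (fun z => g.f z r) (Ici 0) := by
  apply strictAntiOn_of_deriv_neg (convex_Ici 0)
  · intro z hz
    exact (g.hasDeriv z r hz hr).continuousWithinAt
  · intro z hz
    rw [interior_Ici] at hz
    have h := (g.hasDeriv z r (le_of_lt hz) hr).hasDerivAt (Ici_mem_nhds hz)
    rw [h.deriv]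
    exact g.fz_neg z r (le_of_lt hz) hr

theorem zf_mono (g : GrowthF) {r : ℝ} (hr : 0 < r) :
    StrictMonoOn (fun z => z * g.f z r) (Ici 0) := by
  apply strictMonoOn_of_deriv_pos (convex_Ici 0)
  · intro z hz
    exact continuousWithinAt_id.mul (g.hasDeriv z r hz hr).continuousWithinAt
  · intro z hz
    rw [interior_Ici] at hz
    have h := (g.hasDeriv z r (le_of_lt hz) hr).hasDerivAt (Ici_mem_nhds hz)
    have h2 := (hasDerivAt_id z).mul h
    have h3 : deriv (fun z => z * g.f z r) z = 1 * g.f z r + z * g.fz z r := h2.deriv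
    rw [h3, one_mul]
    exact g.contest z r (le_of_lt hz) hr

theorem f_scale_lt (g : GrowthF) {r : ℝ} (hr : 0 < r) {z l : ℝ} (hz : 0 ≤ z) (hl : 1 < l) :
    g.f z r < l * g.f (l * z) r := by
  rcases hz.eq_or_lt with h | h
  · subst h
    have := g.pos 0 r le_rfl hr
    simp only [mul_zero]
    nlinarith
  · have hlz : z < l * z := by nlinarith
    have := zf_mono g hr (a := z) (b := l * z) hz (hz.trans hlz.le) hlz
    simp only at this
    have h2 : z * g.f z r < z * (l * g.f (l * z) r) := by linarith [this, mul_assoc l z (g.f (l*z) r), mul_left_comm l z (g.f (l*z) r)]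
    exact lt_of_mul_lt_mul_left h2 hz

variable {n : ℕ} (fam : Fin n → GrowthF) (r : Fin n → ℝ) (μ : Fin n → Fin n → ℝ)

theorem z_nonneg (hr : ∀ i, 0 < r i) (hμ : ∀ i j, 0 < μ i j) {x : Fin n → ℝ}
    (hx : x ∈ orthant n) (i : Fin n) : 0 ≤ r i * ∑ j, μ i j * x j :=
  mul_nonneg (hr i).le (Finset.sum_nonneg fun j _ => mul_nonneg (hμ i j).le (hx j))

theorem F_pos (hr : ∀ i, 0 < r i) (hμ : ∀ i j, 0 < μ i j) {x : Fin n → ℝ}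
    (hx : x ∈ orthant n) (i : Fin n) : 0 < DCS.F fam r μ i x :=
  (fam i).pos _ _ (z_nonneg r μ hr hμ hx i) (hr i)

theorem map_orthant (hr : ∀ i, 0 < r i) (hμ : ∀ i j, 0 < μ i j) {x : Fin n → ℝ}
    (hx : x ∈ orthant n) : DCS.map fam r μ x ∈ orthant n := fun i =>
  mul_nonneg (hx i) (F_pos fam r μ hr hμ hx i).le

theorem F_cont (hr : ∀ i, 0 < r i) (hμ : ∀ i j, 0 < μ i j) (i : Fin n) :
    ContinuousOn (DCS.F fam r μ i) (orthant n) := by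
  have h1 : ContinuousOn (fun z => (fam i).f z (r i)) (Ici 0) := fun z hz =>
    ((fam i).hasDeriv z (r i) hz (hr i)).continuousWithinAt
  have h2 : Continuous (fun x : Fin n → ℝ => r i * ∑ j, μ i j * x j) := by fun_prop
  exact h1.comp h2.continuousOn fun x hx => z_nonneg r μ hr hμ hx i

theorem map_cont (hr : ∀ i, 0 < r i) (hμ : ∀ i j, 0 < μ i j) :
    ContinuousOn (DCS.map fam r μ) (orthant n) := by
  rw [continuousOn_pi]
  intro i
  exact (continuous_apply i).continuousOn.mul (F_cont fam r μ hr hμ i)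

theorem F_anti (hr : ∀ i, 0 < r i) (hμ : ∀ i j, 0 < μ i j) {x y : Fin n → ℝ}
    (hx : x ∈ orthant n) (hxy : ∀ i, x i ≤ y i) (i : Fin n) :
    DCS.F fam r μ i y ≤ DCS.F fam r μ i x := by
  have hy : y ∈ orthant n := fun i => (hx i).trans (hxy i)
  apply (f_anti (fam i) (hr i)).antitoneOn (z_nonneg r μ hr hμ hx i) (z_nonneg r μ hr hμ hy i)
  apply mul_le_mul_of_nonneg_left _ (hr i).le
  exact Finset.sum_le_sum fun j _ => mul_le_mul_of_nonneg_left (hxy j) (hμ i j).le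

theorem F_smul (i : Fin n) (l : ℝ) (x : Fin n → ℝ) :
    DCS.F fam r μ i (fun j => l * x j) = (fam i).f (l * (r i * ∑ j, μ i j * x j)) (r i) := by
  unfold DCS.F
  congr 1
  simp only [Finset.mul_sum]
  apply Finset.sum_congr rfl
  intros
  ring

theorem map_scale_lt (hr : ∀ i, 0 < r i) (hμ : ∀ i j, 0 < μ i j) {x y : Fin n → ℝ}
    (hx : x ∈ orthant n) (hy : y ∈ orthant n) {i : Fin n} {l : ℝ} (hl : 1 < l)
    (hi : y i = l * x i) (hxi : 0 < x i) (hj : ∀ j, y j ≤ l * x j) :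
    DCS.map fam r μ x i < DCS.map fam r μ y i := by
  have h1 := F_anti fam r μ hr hμ hy (y := fun j => l * x j) hj i
  rw [F_smul] at h1
  have h2 := f_scale_lt (fam i) (hr i) (z_nonneg r μ hr hμ hx i) hl
  unfold DCS.map
  rw [hi]
  have h3 : DCS.F fam r μ i x < l * DCS.F fam r μ i y :=
    lt_of_lt_of_le h2 (mul_le_mul_of_nonneg_left h1 (by linarith))
  nlinarith

theorem map_scale_le (hr : ∀ i, 0 < r i) (hμ : ∀ i j, 0 < μ i j) {x y : Fin n → ℝ}
    (hx : x ∈ orthant n) (hy : y ∈ orthant n) {i : Fin n} (hi : x i ≤ y i)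
    (hj : ∀ j, j ≠ i → y j ≤ x j) :
    DCS.map fam r μ x i ≤ DCS.map fam r μ y i := by
  rcases (hx i).eq_or_lt with h | h
  · have := map_orthant fam r μ hr hμ hy i
    have h0 : DCS.map fam r μ x i = 0 := by unfold DCS.map; rw [← h, zero_mul]
    rw [h0]; exact this
  · rcases hi.eq_or_lt with h' | h'
    · have h1 := F_anti fam r μ hr hμ hy (y := x) (fun j => by
        by_cases hji : j = i
        · subst hji; exact h'.ge
        · exact hj j hji) i
      unfold DCS.map
      rw [← h']
      exact mul_le_mul_of_nonneg_left h1 h.le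
    · have hl : 1 < y i / x i := by rwa [one_lt_div h]
      refine (map_scale_lt fam r μ hr hμ hx hy hl (by field_simp) h ?_).le
      intro j
      by_cases hji : j = i
      · subst hji; exact (div_mul_cancel₀ _ h.ne').ge
      · have := hj j hji
        have := hx j
        nlinarith

theorem single_orthant {C : ℝ} (hC0 : 0 ≤ C) (i : Fin n) :
    (Pi.single i C : Fin n → ℝ) ∈ orthant n := by
  intro j
  by_cases h : j = i
  · subst h; simpa using hC0
  · simp [h]

theorem box_coord (hr : ∀ i, 0 < r i) (hμ : ∀ i j, 0 < μ i j) {C : ℝ} {i : Fin n}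
    (hC : 1 ≤ μ i i * C) {x : Fin n → ℝ} (hxo : x ∈ orthant n) (hx : x i ≤ C) :
    DCS.map fam r μ x i ≤ C := by
  have hC0 : 0 ≤ C := (hxo i).trans hx
  have hy := single_orthant hC0 i
  have h := map_scale_le fam r μ hr hμ hxo hy (i := i) (by simpa using hx) (by
    intro j hj
    simpa [hj] using hxo j)
  refine h.trans ?_
  have h1 : DCS.F fam r μ i (Pi.single i C) ≤ 1 := by
    have hz := z_nonneg r μ hr hμ hy i
    unfold DCS.F
    rw [← (fam i).unit (r i) (hr i)]
    refine (f_anti (fam i) (hr i)).antitoneOn (hr i).le hz ?_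
    simp only [Pi.single_apply, mul_ite, mul_zero, Finset.sum_ite_eq', Finset.mem_univ, if_true]
    exact le_mul_of_one_le_right (hr i).le hC
  unfold DCS.map
  simp only [Pi.single_eq_same]
  exact mul_le_of_le_one_right hC0 h1

theorem box_map (hr : ∀ i, 0 < r i) (hμ : ∀ i j, 0 < μ i j) {C : ℝ} (hC : ∀ i, 1 ≤ μ i i * C)
    {x : Fin n → ℝ} (hx : x ∈ Icc (0 : Fin n → ℝ) (fun _ => C)) :
    DCS.map fam r μ x ∈ Icc (0 : Fin n → ℝ) (fun _ => C) := by
  have hxo : x ∈ orthant n := fun i => hx.1 i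
  exact ⟨fun i => map_orthant fam r μ hr hμ hxo i, fun i =>
    box_coord fam r μ hr hμ (hC i) hxo (hx.2 i)⟩

theorem iter_mem {α : Type*} {T : α → α} {X : Set α} (h : MapsTo T X X) {x : α} (hx : x ∈ X)
    (k : ℕ) : T^[k] x ∈ X := h.iterate k hx

theorem seq_conv {u : ℕ → ℝ} {C : ℝ} (h0 : ∀ k, 0 ≤ u k) (h1 : ∀ k, u k ≤ C)
    (h : Monotone u ∨ Antitone u) : ∃ l, Tendsto u atTop (𝓝 l) := by
  rcases h with h | h
  · exact ⟨_, tendsto_atTop_ciSup h ⟨C, by rintro _ ⟨k, rfl⟩; exact h1 k⟩⟩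
  · exact ⟨_, tendsto_atTop_ciInf h ⟨0, by rintro _ ⟨k, rfl⟩; exact h0 k⟩⟩

theorem map_zero_coord {x : Fin n → ℝ} {c : Fin n} (hc : x c = 0) : DCS.map fam r μ x c = 0 := by
  unfold DCS.map; rw [hc, zero_mul]

/-- retrotone alternative on a planar face -/
theorem retro (hr : ∀ i, 0 < r i) (hμ : ∀ i j, 0 < μ i j) {a b c : Fin n}
    (habc : ∀ i, i = a ∨ i = b ∨ i = c) {p q : Fin n → ℝ}
    (hp : p ∈ orthant n) (hq : q ∈ orthant n) (hpc : p c = 0) (hqc : q c = 0)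
    (hpa : 0 < p a) (hpb : 0 < p b) (ha : p a < q a) (hb : p b < q b) :
    DCS.map fam r μ p a < DCS.map fam r μ q a ∨ DCS.map fam r μ p b < DCS.map fam r μ q b := by
  have hla : 1 < q a / p a := by rwa [one_lt_div hpa]
  have hlb : 1 < q b / p b := by rwa [one_lt_div hpb]
  have ea : q a = q a / p a * p a := by field_simp
  have eb : q b = q b / p b * p b := by field_simp
  rcases le_total (q a / p a) (q b / p b) with h | h
  · right
    refine map_scale_lt fam r μ hr hμ hp hq hlb eb hpb fun j => ?_
    rcases habc j with rfl | rfl | rfl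
    · rw [ea]; exact mul_le_mul_of_nonneg_right h hpa.le
    · exact eb.le
    · rw [hpc, hqc]; simp
  · left
    refine map_scale_lt fam r μ hr hμ hp hq hla ea hpa fun j => ?_
    rcases habc j with rfl | rfl | rfl
    · exact ea.le
    · rw [eb]; exact mul_le_mul_of_nonneg_right h hpb.le
    · rw [hpc, hqc]; simp

/-- orbit convergence once mixed -/
theorem conv_mixed (hr : ∀ i, 0 < r i) (hμ : ∀ i j, 0 < μ i j) {a b c : Fin n} (hab : a ≠ b)
    (habc : ∀ i, i = a ∨ i = b ∨ i = c) {x : Fin n → ℝ} (hx : x ∈ orthant n) (hxc : x c = 0)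
    (h1 : x a ≤ DCS.map fam r μ x a) (h2 : DCS.map fam r μ x b ≤ x b) :
    ∀ k, ((DCS.map fam r μ)^[k] x a ≤ (DCS.map fam r μ)^[k+1] x a) ∧
      ((DCS.map fam r μ)^[k+1] x b ≤ (DCS.map fam r μ)^[k] x b) := by
  have ho : ∀ k, (DCS.map fam r μ)^[k] x ∈ orthant n := fun k =>
    iter_mem (fun _ h => map_orthant fam r μ hr hμ h) hx k
  have hc : ∀ k, (DCS.map fam r μ)^[k] x c = 0 := by
    intro k
    induction k with
    | zero => exact hxc
    | succ k ih => rw [Function.iterate_succ_apply']; exact map_zero_coord fam r μ ih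
  intro k
  induction k with
  | zero => exact ⟨h1, h2⟩
  | succ k ih =>
    have e := fun k => Function.iterate_succ_apply' (DCS.map fam r μ) k x
    constructor
    · have key := map_scale_le fam r μ hr hμ (ho k) (ho (k+1)) ih.1 fun j hj => by
        rcases habc j with rfl | rfl | rfl
        · exact absurd rfl hj
        · exact ih.2
        · rw [hc, hc]
      rwa [← e, ← e] at key
    · have key := map_scale_le fam r μ hr hμ (ho (k+1)) (ho k) ih.2 fun j hj => by
        rcases habc j with rfl | rfl | rfl
        · exact ih.1
        · exact absurd rfl hj
        · rw [hc, hc]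
      rwa [← e, ← e] at key

theorem conv_face (hr : ∀ i, 0 < r i) (hμ : ∀ i j, 0 < μ i j) {a b c : Fin n} (hab : a ≠ b)
    (habc : ∀ i, i = a ∨ i = b ∨ i = c) {C : ℝ} (hC : ∀ i, 1 ≤ μ i i * C)
    {x : Fin n → ℝ} (hx : x ∈ Icc (0 : Fin n → ℝ) (fun _ => C)) (hxc : x c = 0) :
    ∃ y, Tendsto (fun k => (DCS.map fam r μ)^[k] x) atTop (𝓝 y) := by
  set T := DCS.map fam r μ with hT
  have hbox : ∀ k, T^[k] x ∈ Icc (0 : Fin n → ℝ) (fun _ => C) := fun k =>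
    iter_mem (fun _ h => box_map fam r μ hr hμ hC h) hx k
  have ho : ∀ k, T^[k] x ∈ orthant n := fun k i => (hbox k).1 i
  have hc : ∀ k, T^[k] x c = 0 := by
    intro k
    induction k with
    | zero => exact hxc
    | succ k ih => rw [Function.iterate_succ_apply']; exact map_zero_coord fam r μ ih
  -- it suffices that from some time on both coordinates are monotone
  suffices hs : ∃ m, (Monotone (fun k => T^[k+m] x a) ∨ Antitone (fun k => T^[k+m] x a)) ∧
      (Monotone (fun k => T^[k+m] x b) ∨ Antitone (fun k => T^[k+m] x b)) by
    obtain ⟨m, ha, hb⟩ := hs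
    obtain ⟨la, hla⟩ := seq_conv (fun k => (hbox (k+m)).1 a) (fun k => (hbox (k+m)).2 a) ha
    obtain ⟨lb, hlb⟩ := seq_conv (fun k => (hbox (k+m)).1 b) (fun k => (hbox (k+m)).2 b) hb
    have : ∀ i, ∃ l, Tendsto (fun k => T^[k+m] x i) atTop (𝓝 l) := by
      intro i
      rcases habc i with rfl | rfl | rfl
      · exact ⟨la, hla⟩
      · exact ⟨lb, hlb⟩
      · exact ⟨0, by simp only [hc]; exact tendsto_const_nhds⟩
    choose y hy using this
    refine ⟨y, ?_⟩
    rw [← tendsto_add_atTop_iff_nat m]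
    exact tendsto_pi_nhds.2 hy
  by_cases hm : ∃ m, (T^[m] x a ≤ T (T^[m] x) a ∧ T (T^[m] x) b ≤ T^[m] x b) ∨
      (T^[m] x b ≤ T (T^[m] x) b ∧ T (T^[m] x) a ≤ T^[m] x a)
  · obtain ⟨m, h | h⟩ := hm
    · have := conv_mixed fam r μ hr hμ hab habc (ho m) (hc m) h.1 h.2
      simp only [← hT, ← Function.iterate_add_apply] at this
      refine ⟨m, Or.inl (monotone_nat_of_le_succ fun k => (this k).1),
        Or.inr (antitone_nat_of_succ_le fun k => (this k).2)⟩
    · have := conv_mixed fam r μ hr hμ hab.symm (c := c) (fun i => by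
        rcases habc i with h | h | h <;> simp [h]) (ho m) (hc m) h.1 h.2
      simp only [← hT, ← Function.iterate_add_apply] at this
      refine ⟨m, Or.inr (antitone_nat_of_succ_le fun k => (this k).2),
        Or.inl (monotone_nat_of_le_succ fun k => (this k).1)⟩
  · push Not at hm
    have hpos : ∀ k, 0 < T^[k] x a ∧ 0 < T^[k] x b := by
      intro k
      obtain ⟨h1, h2⟩ := hm k
      constructor
      · refine lt_of_le_of_ne (ho k a) fun h => ?_
        have h0 : T (T^[k] x) a = 0 := map_zero_coord fam r μ h.symm
        have := h1 (by rw [h0, ← h])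
        have := h2 this.le
        rw [h0, ← h] at this; exact lt_irrefl _ this
      · refine lt_of_le_of_ne (ho k b) fun h => ?_
        have h0 : T (T^[k] x) b = 0 := map_zero_coord fam r μ h.symm
        have := h2 (by rw [h0, ← h])
        have := h1 this.le
        rw [h0, ← h] at this; exact lt_irrefl _ this
    have hAB : ∀ k, (T^[k] x a < T (T^[k] x) a ∧ T^[k] x b < T (T^[k] x) b) ∨
        (T (T^[k] x) a < T^[k] x a ∧ T (T^[k] x) b < T^[k] x b) := by
      intro k
      obtain ⟨h1, h2⟩ := hm k
      rcases le_or_gt (T^[k] x a) (T (T^[k] x) a) with h | h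
      · have hb := h1 h
        left
        refine ⟨lt_of_not_ge fun h' => ?_, hb⟩
        exact absurd (h2 hb.le) (not_lt.2 h')
      · right
        refine ⟨h, lt_of_not_ge fun h' => ?_⟩
        exact absurd (h2 h') (not_lt.2 h.le)
    refine ⟨0, ?_⟩
    simp only [add_zero]
    rcases hAB 0 with h0 | h0
    · have : ∀ k, T^[k] x a < T (T^[k] x) a ∧ T^[k] x b < T (T^[k] x) b := by
        intro k
        induction k with
        | zero => exact h0
        | succ k ih =>
          rcases hAB (k+1) with h | h
          · exact h
          · exfalso
            rw [Function.iterate_succ_apply'] at h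
            have hk := hc (k+1)
            have hok := ho (k+1)
            rw [Function.iterate_succ_apply'] at hk hok
            rcases retro fam r μ hr hμ habc (ho k) hok (hc k) hk (hpos k).1 (hpos k).2
              ih.1 ih.2 with h' | h'
            · exact lt_asymm h' h.1
            · exact lt_asymm h' h.2
      simp only [← Function.iterate_succ_apply' T] at this
      exact ⟨Or.inl (monotone_nat_of_le_succ fun k => (this k).1.le),
        Or.inl (monotone_nat_of_le_succ fun k => (this k).2.le)⟩
    · have : ∀ k, T (T^[k] x) a < T^[k] x a ∧ T (T^[k] x) b < T^[k] x b := by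
        intro k
        induction k with
        | zero => exact h0
        | succ k ih =>
          rcases hAB (k+1) with h | h
          · exfalso
            rw [Function.iterate_succ_apply'] at h
            have hk := hc (k+1)
            have hok := ho (k+1)
            have hpk := hpos (k+1)
            rw [Function.iterate_succ_apply'] at hk hok hpk
            rcases retro fam r μ hr hμ habc hok (ho k) hk (hc k) hpk.1 hpk.2
              ih.1 ih.2 with h' | h'
            · exact lt_asymm h' h.1
            · exact lt_asymm h' h.2
          · exact h
      simp only [← Function.iterate_succ_apply' T] at this
      exact ⟨Or.inr (antitone_nat_of_succ_le fun k => (this k).1.le),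
        Or.inr (antitone_nat_of_succ_le fun k => (this k).2.le)⟩

end DCSAux
namespace DCSAux

theorem unif {α : Type*} [PseudoMetricSpace α] {X : Set α} (hX : IsCompact X) {T : α → α}
    (hT : MapsTo T X X) (hTc : ContinuousOn T X) {P s : α → ℝ} (hP : ContinuousOn P X)
    (hs : ContinuousOn s X) (hP0 : ∀ x ∈ X, 0 ≤ P x)
    (h : ∀ x ∈ X, P x = 0 → ∃ k, 0 < k ∧ 0 < ∑ m ∈ Finset.range k, s (T^[m] x)) :
    ∃ p > 0, ∃ N : ℕ, ∀ x ∈ X, P x ≤ p →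
      ∃ k, 1 ≤ k ∧ k ≤ N ∧ p ≤ ∑ m ∈ Finset.range k, s (T^[m] x) := by
  by_contra hcon
  push Not at hcon
  have h1 : ∀ n : ℕ, ∃ x ∈ X, P x ≤ 1 / ((n : ℝ) + 1) ∧ ∀ k, 1 ≤ k → k ≤ n →
      ∑ m ∈ Finset.range k, s (T^[m] x) < 1 / ((n : ℝ) + 1) := fun n =>
    hcon (1 / ((n : ℝ) + 1)) (by positivity) n
  choose u huX hu1 hu2 using h1
  obtain ⟨x, hx, φ, hφ, hlim⟩ := hX.tendsto_subseq huX
  have hw : Tendsto (u ∘ φ) atTop (𝓝[X] x) :=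
    tendsto_nhdsWithin_iff.2 ⟨hlim, Eventually.of_forall fun n => huX _⟩
  have h0 : Tendsto (fun n => 1 / ((φ n : ℝ) + 1)) atTop (𝓝 0) :=
    tendsto_one_div_add_atTop_nhds_zero_nat.comp hφ.tendsto_atTop
  have hPx : P x = 0 := by
    refine le_antisymm ?_ (hP0 x hx)
    exact le_of_tendsto_of_tendsto' ((hP x hx).tendsto.comp hw) h0 fun n => hu1 _
  obtain ⟨k, hk, hpos⟩ := h x hx hPx
  have hc : ContinuousOn (fun x => ∑ m ∈ Finset.range k, s (T^[m] x)) X :=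
    continuousOn_finsetSum _ fun m _ => hs.comp (hTc.iterate hT m) (hT.iterate m)
  have hle : ∑ m ∈ Finset.range k, s (T^[m] x) ≤ 0 := by
    refine le_of_tendsto_of_tendsto ((hc x hx).tendsto.comp hw) h0 ?_
    filter_upwards [hφ.tendsto_atTop.eventually_ge_atTop k] with n hn
    exact (hu2 (φ n) k hk hn).le
  linarith

theorem seq_below (L M : ℝ) (N : ℕ) (hM : 0 ≤ M) (e : ℝ) (he : 0 ≤ e) : ∀ (k : ℕ) (a : ℕ → ℝ),
    (∀ k, |a (k+1) - a k| ≤ M) → (∀ k, a k ≤ L → ∃ j, 1 ≤ j ∧ j ≤ N ∧ a k + e ≤ a (k + j)) →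
    L - M ≤ a 0 → L - M - N * M ≤ a k := by
  intro k
  induction k using Nat.strong_induction_on with
  | _ k ih =>
  intro a h1 h2 h0
  have hNM : 0 ≤ N * M := by positivity
  have hstep : ∀ k : ℕ, a 0 - k * M ≤ a k := by
    intro k
    induction k with
    | zero => simp
    | succ k ih => have := abs_le.1 (h1 k); push_cast; linarith
  rcases le_or_gt (a 0) L with h | h
  · obtain ⟨j, hj1, hjN, hj⟩ := h2 0 h
    rw [zero_add] at hj
    rcases lt_or_ge k j with hk | hk
    · have := hstep k
      have hkN : (k : ℝ) * M ≤ N * M :=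
        mul_le_mul_of_nonneg_right (by exact_mod_cast (hk.le.trans hjN)) hM
      linarith
    · have := ih (k - j) (by omega) (fun m => a (m + j)) (fun m => by
        have := h1 (m + j); rwa [show m + j + 1 = m + 1 + j by ring] at this) (fun m hm => by
        obtain ⟨i, hi⟩ := h2 (m + j) hm
        exact ⟨i, by rwa [show m + i + j = m + j + i by ring]⟩) (by simp only [zero_add]; linarith)
      simp only [Nat.sub_add_cancel hk] at this
      exact this
  · rcases Nat.eq_zero_or_pos k with rfl | hk
    · linarith
    · have := ih (k - 1) (by omega) (fun m => a (m + 1)) (fun m => h1 (m + 1)) (fun m hm => by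
        obtain ⟨i, hi⟩ := h2 (m + 1) hm
        exact ⟨i, by rwa [show m + i + 1 = m + 1 + i by ring]⟩) (by
          have := abs_le.1 (h1 0); simp only [zero_add] at *; linarith)
      simp only [Nat.sub_add_cancel hk] at this
      exact this

theorem seq_above (L M A : ℝ) (N : ℕ) (hM : 0 ≤ M) (hAL : A ≤ L) : ∀ (k : ℕ) (a : ℕ → ℝ),
    (∀ k, |a (k+1) - a k| ≤ M) → (∀ k, a k ≤ L → ∃ j, 1 ≤ j ∧ j ≤ N ∧ a (k + j) ≤ a k) →
    a 0 ≤ A → a k ≤ A + N * M := by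
  intro k
  induction k using Nat.strong_induction_on with
  | _ k ih =>
  intro a h1 h2 h0
  have hstep : ∀ k : ℕ, a k ≤ a 0 + k * M := by
    intro k
    induction k with
    | zero => simp
    | succ k ih => have := abs_le.1 (h1 k); push_cast; linarith
  obtain ⟨j, hj1, hjN, hj⟩ := h2 0 (h0.trans hAL)
  rw [zero_add] at hj
  rcases lt_or_ge k j with hk | hk
  · have := hstep k
    have hkN : (k : ℝ) * M ≤ N * M :=
      mul_le_mul_of_nonneg_right (by exact_mod_cast (hk.le.trans hjN)) hM
    linarith
  · have := ih (k - j) (by omega) (fun m => a (m + j)) (fun m => by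
      have := h1 (m + j); rwa [show m + j + 1 = m + 1 + j by ring] at this) (fun m hm => by
      obtain ⟨i, hi⟩ := h2 (m + j) hm
      exact ⟨i, by rwa [show m + i + j = m + j + i by ring]⟩) (by simp only [zero_add]; linarith)
    simp only [Nat.sub_add_cancel hk] at this
    exact this

/-- the sequence reaches above L -/
theorem seq_hit (L : ℝ) (N : ℕ) (e U : ℝ) (he : 0 < e) (a : ℕ → ℝ)
    (hU : ∀ k, a k ≤ U)
    (h2 : ∀ k, a k ≤ L → ∃ j, 1 ≤ j ∧ j ≤ N ∧ a k + e ≤ a (k + j)) : ∃ k, L < a k := by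
  by_contra hcon
  push Not at hcon
  have : ∀ n : ℕ, ∃ k, a 0 + n * e ≤ a k := by
    intro n
    induction n with
    | zero => exact ⟨0, by simp⟩
    | succ n ih =>
      obtain ⟨k, hk⟩ := ih
      obtain ⟨j, -, -, hj⟩ := h2 k (hcon k)
      exact ⟨k + j, by push_cast; linarith⟩
  obtain ⟨n, hn⟩ := exists_nat_gt ((U - a 0) / e)
  obtain ⟨k, hk⟩ := this n
  rw [div_lt_iff₀ he] at hn
  linarith [hU k]

variable (fam : Fin 3 → GrowthF) (r : Fin 3 → ℝ) (μ : Fin 3 → Fin 3 → ℝ) (ν : Fin 3 → ℝ)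

theorem bdry_conv (hr : ∀ i, 0 < r i) (hμ : ∀ i j, 0 < μ i j) {C : ℝ} (hC : ∀ i, 1 ≤ μ i i * C)
    {x : Fin 3 → ℝ} (hx : x ∈ Icc (0 : Fin 3 → ℝ) (fun _ => C)) {c : Fin 3} (hxc : x c = 0) :
    ∃ y, Tendsto (fun k => (DCS.map fam r μ)^[k] x) atTop (𝓝 y) := by
  have : ∃ a b : Fin 3, a ≠ b ∧ ∀ i, i = a ∨ i = b ∨ i = c := by
    clear hxc; revert c; decide
  obtain ⟨a, b, hab, habc⟩ := this
  exact conv_face fam r μ hr hμ hab habc hC hx hxc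

theorem bdry_sum (hr : ∀ i, 0 < r i) (hμ : ∀ i j, 0 < μ i j) {C : ℝ} (hC : ∀ i, 1 ≤ μ i i * C)
    {X : Set (Fin 3 → ℝ)} (hXc : IsClosed X) (hXT : MapsTo (DCS.map fam r μ) X X)
    (hXb : X ⊆ Icc (0 : Fin 3 → ℝ) (fun _ => C)) {s : (Fin 3 → ℝ) → ℝ}
    (hs : ContinuousOn s (orthant 3))
    (hpos : ∀ y ∈ X, y ∈ bdryOrthant 3 → DCS.map fam r μ y = y → 0 < s y)
    {x : Fin 3 → ℝ} (hx : x ∈ X) (hxb : x ∈ bdryOrthant 3) :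
    ∃ k, 0 < k ∧ 0 < ∑ m ∈ Finset.range k, s ((DCS.map fam r μ)^[m] x) := by
  set T := DCS.map fam r μ with hT
  have hXo : X ⊆ orthant 3 := fun x hx i => (hXb hx).1 i
  obtain ⟨c, hc⟩ : ∃ c, x c = 0 := by
    have := hxb.2
    simp only [intOrthant, mem_ofPred_eq, not_forall, not_lt] at this
    obtain ⟨c, hc⟩ := this
    exact ⟨c, le_antisymm hc (hxb.1 c)⟩
  obtain ⟨y, hy⟩ := bdry_conv fam r μ hr hμ hC (hXb hx) hc
  rw [← hT] at hy
  have hmem : ∀ k, T^[k] x ∈ X := fun k => hXT.iterate k hx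
  have hyX : y ∈ X := hXc.mem_of_tendsto hy (Eventually.of_forall hmem)
  have hw : Tendsto (fun k => T^[k] x) atTop (𝓝[orthant 3] y) :=
    tendsto_nhdsWithin_iff.2 ⟨hy, Eventually.of_forall fun n => hXo (hmem n)⟩
  have hfix : T y = y := by
    have h1 := ((map_cont fam r μ hr hμ) y (hXo hyX)).tendsto.comp hw
    have h2 := (tendsto_add_atTop_iff_nat 1).2 hy
    refine tendsto_nhds_unique h1 (h2.congr fun k => ?_)
    exact Function.iterate_succ_apply' T k x
  have hck : ∀ k, T^[k] x c = 0 := by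
    intro k
    induction k with
    | zero => exact hc
    | succ k ih => rw [Function.iterate_succ_apply']; exact map_zero_coord fam r μ ih
  have hyc : y c = 0 := by
    have h1 := ((continuous_apply c).tendsto y).comp hy
    refine tendsto_nhds_unique h1 (tendsto_const_nhds.congr fun k => ?_)
    exact (hck k).symm
  have hyb : y ∈ bdryOrthant 3 := ⟨hXo hyX, fun h => (h c).ne' hyc⟩
  have hsy := hpos y hyX hyb hfix
  have hlim := ((hs y (hXo hyX)).tendsto.comp hw).cesaro
  obtain ⟨k, hk1, hk2⟩ := ((hlim.eventually (lt_mem_nhds hsy)).and (eventually_gt_atTop 0)).exists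
  refine ⟨k, hk2, ?_⟩
  have : (0 : ℝ) < (k : ℝ)⁻¹ := by positivity
  exact pos_of_mul_pos_right hk1 this.le

noncomputable def P (x : Fin 3 → ℝ) : ℝ := ∏ i, x i ^ ν i
noncomputable def lp (x : Fin 3 → ℝ) : ℝ := ∑ i, ν i * Real.log (x i)
noncomputable def sg (x : Fin 3 → ℝ) : ℝ := ∑ i, ν i * Real.log (DCS.F fam r μ i x)

theorem P_cont (hν : ∀ i, 0 < ν i) : Continuous (P ν) := by
  unfold P
  refine continuous_finsetProd _ fun i _ => ?_
  exact (Real.continuous_rpow_const (hν i).le).comp (continuous_apply i)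

theorem P_nonneg {x : Fin 3 → ℝ} (hx : x ∈ orthant 3) : 0 ≤ P ν x :=
  Finset.prod_nonneg fun i _ => Real.rpow_nonneg (hx i) _

theorem P_int {x : Fin 3 → ℝ} (hx : x ∈ intOrthant 3) : P ν x = Real.exp (lp ν x) := by
  unfold P lp
  rw [Real.exp_sum]
  exact Finset.prod_congr rfl fun i _ => by rw [Real.rpow_def_of_pos (hx i), mul_comm]

theorem P_pos {x : Fin 3 → ℝ} (hx : x ∈ intOrthant 3) : 0 < P ν x := by
  rw [P_int ν hx]; exact Real.exp_pos _

theorem P_bdry (hν : ∀ i, 0 < ν i) {x : Fin 3 → ℝ} (hx : x ∈ orthant 3) (h : x ∉ intOrthant 3) :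
    P ν x = 0 := by
  simp only [intOrthant, mem_ofPred_eq, not_forall, not_lt] at h
  obtain ⟨c, hc⟩ := h
  refine Finset.prod_eq_zero (Finset.mem_univ c) ?_
  rw [le_antisymm hc (hx c), Real.zero_rpow (hν c).ne']

theorem sg_cont (hr : ∀ i, 0 < r i) (hμ : ∀ i j, 0 < μ i j) :
    ContinuousOn (sg fam r μ ν) (orthant 3) := by
  unfold sg
  refine continuousOn_finsetSum _ fun i _ => continuousOn_const.mul ?_
  exact (F_cont fam r μ hr hμ i).log fun x hx => (F_pos fam r μ hr hμ hx i).ne'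

theorem int_sub {x : Fin 3 → ℝ} (hx : x ∈ intOrthant 3) : x ∈ orthant 3 := fun i => (hx i).le

theorem map_int (hr : ∀ i, 0 < r i) (hμ : ∀ i j, 0 < μ i j) {x : Fin 3 → ℝ}
    (hx : x ∈ intOrthant 3) : DCS.map fam r μ x ∈ intOrthant 3 := fun i =>
  mul_pos (hx i) (F_pos fam r μ hr hμ (int_sub hx) i)

theorem lp_map (hr : ∀ i, 0 < r i) (hμ : ∀ i j, 0 < μ i j) {x : Fin 3 → ℝ}
    (hx : x ∈ intOrthant 3) : lp ν (DCS.map fam r μ x) = lp ν x + sg fam r μ ν x := by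
  unfold lp sg DCS.map
  rw [← Finset.sum_add_distrib]
  refine Finset.sum_congr rfl fun i _ => ?_
  rw [Real.log_mul (hx i).ne' (F_pos fam r μ hr hμ (int_sub hx) i).ne']
  ring

theorem lp_iter (hr : ∀ i, 0 < r i) (hμ : ∀ i j, 0 < μ i j) {x : Fin 3 → ℝ}
    (hx : x ∈ intOrthant 3) (k : ℕ) : lp ν ((DCS.map fam r μ)^[k] x) =
      lp ν x + ∑ m ∈ Finset.range k, sg fam r μ ν ((DCS.map fam r μ)^[m] x) := by
  induction k with
  | zero => simp
  | succ k ih =>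
    rw [Function.iterate_succ_apply', lp_map fam r μ ν hr hμ
      (iter_mem (fun _ h => map_int fam r μ hr hμ h) hx k), ih, Finset.sum_range_succ, add_assoc]

theorem absorb_coord (hr : ∀ i, 0 < r i) (hμ : ∀ i j, 0 < μ i j) {C : ℝ} {i : Fin 3}
    (hC0 : 0 < C) (hC : 1 < μ i i * C) {x : Fin 3 → ℝ} (hx : x ∈ orthant 3) :
    ∃ m, (DCS.map fam r μ)^[m] x i ≤ C := by
  by_contra hcon
  push Not at hcon
  set T := DCS.map fam r μ with hT
  have ho : ∀ k, T^[k] x ∈ orthant 3 := fun k =>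
    iter_mem (fun _ h => map_orthant fam r μ hr hμ h) hx k
  have hs := single_orthant hC0.le i
  set q := DCS.F fam r μ i (Pi.single i C) with hq
  have hq0 : 0 < q := F_pos fam r μ hr hμ hs i
  have hq1 : q < 1 := by
    have hz := z_nonneg r μ hr hμ hs i
    rw [hq]
    unfold DCS.F
    rw [← (fam i).unit (r i) (hr i)]
    refine (f_anti (fam i) (hr i)) (hr i).le hz ?_
    simp only [Pi.single_apply, mul_ite, mul_zero, Finset.sum_ite_eq', Finset.mem_univ, if_true]
    exact lt_mul_of_one_lt_right (hr i) hC
  have hk : ∀ k, T^[k] x i ≤ q ^ k * x i := by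
    intro k
    induction k with
    | zero => simp
    | succ k ih =>
      have h1 : DCS.F fam r μ i (T^[k] x) ≤ q := F_anti fam r μ hr hμ hs (fun j => by
        by_cases hj : j = i
        · subst hj; simpa using (hcon k).le
        · simpa [hj] using ho k j) i
      rw [Function.iterate_succ_apply']
      have h2 : T (T^[k] x) i ≤ T^[k] x i * q := mul_le_mul_of_nonneg_left h1 (ho k i)
      calc _ ≤ _ := h2
        _ ≤ q ^ k * x i * q := mul_le_mul_of_nonneg_right ih hq0.le
        _ = _ := by ring
  have hxi : 0 < x i := hC0.trans (hcon 0)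
  obtain ⟨k, hk'⟩ := exists_pow_lt_of_lt_one (div_pos hC0 hxi) hq1
  rw [lt_div_iff₀ hxi] at hk'
  linarith [hk k, hcon k]

theorem absorb (hr : ∀ i, 0 < r i) (hμ : ∀ i j, 0 < μ i j) {C : ℝ}
    (hC0 : 0 < C) (hC : ∀ i, 1 < μ i i * C) {x : Fin 3 → ℝ} (hx : x ∈ orthant 3) :
    ∃ m, (DCS.map fam r μ)^[m] x ∈ Icc (0 : Fin 3 → ℝ) (fun _ => C) := by
  have ho : ∀ k, (DCS.map fam r μ)^[k] x ∈ orthant 3 := fun k =>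
    iter_mem (fun _ h => map_orthant fam r μ hr hμ h) hx k
  choose m hm using fun i => absorb_coord fam r μ hr hμ hC0 (hC i) hx
  refine ⟨Finset.univ.sup m, fun i => ho _ i, fun i => ?_⟩
  have hle : m i ≤ Finset.univ.sup m := Finset.le_sup (Finset.mem_univ i)
  have : ∀ k, (DCS.map fam r μ)^[m i + k] x i ≤ C := by
    intro k
    induction k with
    | zero => exact hm i
    | succ k ih =>
      rw [← add_assoc, Function.iterate_succ_apply']
      exact box_coord fam r μ hr hμ (hC i).le (ho _) ih
  obtain ⟨k, hk⟩ := Nat.exists_eq_add_of_le hle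
  rw [hk]; exact this k

theorem exists_C (hμ : ∀ i j, 0 < μ i j) : ∃ C : ℝ, 0 < C ∧ ∀ i, 1 < μ i i * C := by
  have h0 : ∀ i, 0 < (μ i i)⁻¹ := fun i => inv_pos.2 (hμ i i)
  refine ⟨1 + ∑ i, (μ i i)⁻¹, by have := Finset.sum_nonneg (fun i (_ : i ∈ Finset.univ) => (h0 i).le); linarith, fun i => ?_⟩
  have h1 : (μ i i)⁻¹ ≤ ∑ i, (μ i i)⁻¹ :=
    Finset.single_le_sum (f := fun i => (μ i i)⁻¹) (fun i _ => (h0 i).le) (Finset.mem_univ i)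
  calc 1 = μ i i * (μ i i)⁻¹ := (mul_inv_cancel₀ (hμ i i).ne').symm
    _ < _ := mul_lt_mul_of_pos_left (by linarith) (hμ i i)

theorem F_zero_gt (hr : ∀ i, 0 < r i) (i : Fin 3) : 1 < DCS.F fam r μ i 0 := by
  unfold DCS.F
  simp only [Pi.zero_apply, mul_zero, Finset.sum_const_zero]
  rw [← (fam i).unit (r i) (hr i)]
  exact f_anti (fam i) (hr i) (mem_Ici.2 le_rfl) (hr i).le (hr i)

theorem main_perm (hr : ∀ i, 0 < r i) (hμ : ∀ i j, 0 < μ i j) (hν : ∀ i, 0 < ν i)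
    (H : ∀ x ∈ bdryOrthant 3, x ≠ 0 → DCS.map fam r μ x = x → 0 < sg fam r μ ν x) :
    Permanent (DCS.map fam r μ) := by
  obtain ⟨C, hC0, hC⟩ := exists_C μ hμ
  set T := DCS.map fam r μ with hT
  set X := Icc (0 : Fin 3 → ℝ) (fun _ => C) with hX
  have hXo : X ⊆ orthant 3 := fun x hx i => hx.1 i
  have hXT : MapsTo T X X := fun x hx => box_map fam r μ hr hμ (fun i => (hC i).le) hx
  have hXc : IsCompact X := isCompact_Icc
  have hTc : ContinuousOn T X := (map_cont fam r μ hr hμ).mono hXo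
  have hsc := sg_cont fam r μ ν hr hμ
  have hPc := P_cont ν hν
  obtain ⟨p, hp, N, hN⟩ := unif hXc hXT hTc hPc.continuousOn (hsc.mono hXo)
    (fun x hx => P_nonneg ν (hXo hx)) (fun x hx hPx => by
      refine bdry_sum fam r μ hr hμ (fun i => (hC i).le) isClosed_Icc hXT subset_rfl hsc ?_ hx
        ⟨hXo hx, fun h => (P_pos ν h).ne' hPx⟩
      intro y _ hyb hfix
      by_cases hy0 : y = 0
      · subst hy0
        refine Finset.sum_pos (fun i _ => mul_pos (hν i) (Real.log_pos (F_zero_gt fam r μ hr i))) ⟨0, Finset.mem_univ _⟩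
      · exact H y hyb hy0 hfix)
  obtain ⟨M, hM⟩ := hXc.exists_bound_of_continuousOn (hsc.mono hXo)
  have hM0 : 0 ≤ M := (norm_nonneg _).trans (hM 0 ⟨le_rfl, fun _ => hC0.le⟩)
  obtain ⟨U, hU⟩ := hXc.exists_bound_of_continuousOn hPc.continuousOn
  set L := Real.log p with hL
  set q := Real.exp (L - M - N * M) with hq
  -- facts for interior points of X
  have facts : ∀ x ∈ X, x ∈ intOrthant 3 →
      (∀ k, |lp ν (T^[k+1] x) - lp ν (T^[k] x)| ≤ M) ∧
      (∀ k, lp ν (T^[k] x) ≤ L → ∃ j, 1 ≤ j ∧ j ≤ N ∧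
        lp ν (T^[k] x) + p ≤ lp ν (T^[k+j] x)) := by
    intro x hx hxi
    have hk : ∀ k, T^[k] x ∈ X := fun k => hXT.iterate k hx
    have hki : ∀ k, T^[k] x ∈ intOrthant 3 := fun k =>
      iter_mem (fun _ h => map_int fam r μ hr hμ h) hxi k
    refine ⟨fun k => ?_, fun k hkL => ?_⟩
    · rw [Function.iterate_succ_apply', lp_map fam r μ ν hr hμ (hki k), add_sub_cancel_left]
      exact hM _ (hk k)
    · obtain ⟨j, h1, h2, h3⟩ := hN (T^[k] x) (hk k) (by
        rw [P_int ν (hki k), ← Real.exp_log hp]; exact Real.exp_le_exp.2 hkL)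
      refine ⟨j, h1, h2, ?_⟩
      rw [add_comm k j, Function.iterate_add_apply, lp_iter fam r μ ν hr hμ (hki k) j]
      linarith
  refine ⟨{x | x ∈ X ∧ ∀ k, q ≤ P ν (T^[k] x)}, ?_, ?_, ?_, ?_⟩
  · refine hXc.of_isClosed_subset ?_ fun x hx => hx.1
    have : {x | x ∈ X ∧ ∀ k, q ≤ P ν (T^[k] x)} =
        ⋂ k, (X ∩ (fun x => P ν (T^[k] x)) ⁻¹' Ici q) := by
      ext x
      simp only [mem_ofPred_eq, mem_iInter, mem_inter_iff, mem_preimage, mem_Ici]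
      exact ⟨fun h k => ⟨h.1, h.2 k⟩, fun h => ⟨(h 0).1, fun k => (h k).2⟩⟩
    rw [this]
    refine isClosed_iInter fun k => ?_
    exact (hPc.comp_continuousOn (hTc.iterate hXT k)).preimage_isClosed_of_isClosed
      isClosed_Icc isClosed_Ici
  · rintro x ⟨hx, hk⟩
    by_contra hxi
    have := hk 0
    rw [Function.iterate_zero, id, P_bdry ν hν (hXo hx) hxi] at this
    exact absurd (Real.exp_pos (L - M - N * M)) (not_lt.2 this)
  · rintro _ ⟨x, ⟨hx, hk⟩, rfl⟩
    exact ⟨hXT hx, fun k => hk (k+1)⟩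
  · intro x hxi
    obtain ⟨m, hm⟩ := absorb fam r μ hr hμ hC0 hC (int_sub hxi)
    rw [← hT, ← hX] at hm
    have hki : ∀ k, T^[k] x ∈ intOrthant 3 := fun k =>
      iter_mem (fun _ h => map_int fam r μ hr hμ h) hxi k
    obtain ⟨f1, f2⟩ := facts _ hm (hki m)
    obtain ⟨k0, hk0⟩ := seq_hit L N p (Real.log U) hp (fun k => lp ν (T^[k] (T^[m] x))) (fun k => by
      have h1 := hU _ (hXT.iterate k hm)
      rw [← Function.iterate_add_apply] at h1 ⊢
      rw [P_int ν (hki _), Real.norm_eq_abs, abs_of_pos (Real.exp_pos _)] at h1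
      exact (Real.le_log_iff_exp_le (lt_of_lt_of_le (Real.exp_pos _) h1)).2 h1) f2
    rw [← Function.iterate_add_apply] at hk0
    have hz : T^[k0+m] x ∈ X := by
      rw [Function.iterate_add_apply]; exact hXT.iterate k0 hm
    obtain ⟨g1, g2⟩ := facts _ hz (hki _)
    have hlow : ∀ k, q ≤ P ν (T^[k] (T^[k0+m] x)) := by
      intro k
      have := seq_below L M N hM0 p hp.le k (fun k => lp ν (T^[k] (T^[k0+m] x))) g1 g2 (by
        simp only [Function.iterate_zero, id]; linarith)
      rw [← Function.iterate_add_apply] at this ⊢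
      rw [P_int ν (hki _)]
      exact Real.exp_le_exp.2 this
    refine ⟨k0 + m + 1, by omega, fun k hk => ?_⟩
    obtain ⟨d, rfl⟩ := Nat.exists_eq_add_of_le hk
    have e : k0 + m + 1 + d = (d + 1) + (k0 + m) := by ring
    rw [e, Function.iterate_add_apply]
    refine ⟨hXT.iterate _ hz, fun k => ?_⟩
    rw [← Function.iterate_add_apply T k (d+1)]
    exact hlow _

theorem main_imperm (hr : ∀ i, 0 < r i) (hμ : ∀ i j, 0 < μ i j) (hν : ∀ i, 0 < ν i)
    (H : ∀ x ∈ bdryOrthant 3, x ≠ 0 → DCS.map fam r μ x = x → sg fam r μ ν x < 0) :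
    ¬ Permanent (DCS.map fam r μ) := by
  obtain ⟨C, hC0, hC⟩ := exists_C μ hμ
  set T := DCS.map fam r μ with hT
  set Y := Icc (0 : Fin 3 → ℝ) (fun _ => C) with hY
  have hYo : Y ⊆ orthant 3 := fun x hx i => hx.1 i
  have hYT : MapsTo T Y Y := fun x hx => box_map fam r μ hr hμ (fun i => (hC i).le) hx
  -- lower bound for F on the box
  obtain ⟨c, hc0, hc1, hcF⟩ : ∃ c : ℝ, 0 < c ∧ c ≤ 1 ∧ ∀ x ∈ Y, ∀ i, c ≤ DCS.F fam r μ i x := by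
    have hCo : (fun _ => C : Fin 3 → ℝ) ∈ orthant 3 := fun _ => hC0.le
    have hp := fun i => F_pos fam r μ hr hμ hCo i
    refine ⟨min 1 (Finset.univ.inf' Finset.univ_nonempty
      (fun i => DCS.F fam r μ i (fun _ => C))), lt_min one_pos ?_, min_le_left _ _, ?_⟩
    · exact (Finset.lt_inf'_iff _).2 fun i _ => hp i
    · intro x hx i
      exact (min_le_right _ _).trans ((Finset.inf'_le _ (Finset.mem_univ i)).trans
        (F_anti fam r μ hr hμ (hYo hx) hx.2 i))
  -- growth near the origin
  obtain ⟨d, hd0, hdF⟩ : ∃ d : ℝ, 0 < d ∧ ∀ x ∈ orthant 3, ∑ i, x i ≤ d →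
      ∀ i, 1 ≤ DCS.F fam r μ i x := by
    have h0 : (0 : Fin 3 → ℝ) ∈ orthant 3 := fun _ => le_rfl
    have hev : ∀ᶠ x in 𝓝[orthant 3] (0 : Fin 3 → ℝ), ∀ i, 1 < DCS.F fam r μ i x :=
      eventually_all.2 fun i => (F_cont fam r μ hr hμ i 0 h0).eventually
        (lt_mem_nhds (F_zero_gt fam r μ hr i))
    rw [Metric.nhdsWithin_basis_ball.eventually_iff] at hev
    obtain ⟨e, he, hb⟩ := hev
    refine ⟨e / 2, by positivity, fun x hx hs i => (hb ⟨?_, hx⟩ i).le⟩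
    rw [mem_ball_zero_iff, pi_norm_lt_iff he]
    intro j
    rw [Real.norm_of_nonneg (hx j)]
    have := Finset.single_le_sum (f := x) (fun i _ => hx i) (Finset.mem_univ j)
    linarith
  set δ := min d C with hδ
  have hδ0 : 0 < δ := lt_min hd0 hC0
  set ε := c * δ with hε
  have hε0 : 0 < ε := mul_pos hc0 hδ0
  have hεC : ε ≤ C := (mul_le_of_le_one_left hδ0.le hc1).trans (min_le_right _ _)
  set X := Y ∩ {x | ε ≤ ∑ i, x i} with hX
  have hXcl : IsClosed {x : Fin 3 → ℝ | ε ≤ ∑ i, x i} :=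
    isClosed_le continuous_const (by fun_prop)
  have hXc : IsCompact X := isCompact_Icc.inter_right hXcl
  have hXY : X ⊆ Y := inter_subset_left
  have hXo : X ⊆ orthant 3 := hXY.trans hYo
  have hXT : MapsTo T X X := by
    rintro x ⟨hx, hs⟩
    refine ⟨hYT hx, ?_⟩
    simp only [mem_ofPred_eq] at hs ⊢
    rcases le_or_gt (∑ i, x i) δ with h | h
    · refine hs.trans (Finset.sum_le_sum fun i _ => ?_)
      exact le_mul_of_one_le_right (hx.1 i) (hdF x (hYo hx) (h.trans (min_le_left _ _)) i)
    · calc ε ≤ c * ∑ i, x i := mul_le_mul_of_nonneg_left h.le hc0.le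
        _ = ∑ i, c * x i := Finset.mul_sum _ _ _
        _ ≤ _ := Finset.sum_le_sum fun i _ => by
          rw [mul_comm]; exact mul_le_mul_of_nonneg_left (hcF x hx i) (hx.1 i)
  have hTc : ContinuousOn T X := (map_cont fam r μ hr hμ).mono hXo
  have hsc := sg_cont fam r μ ν hr hμ
  have hPc := P_cont ν hν
  obtain ⟨p, hp, N, hN⟩ := unif hXc hXT hTc hPc.continuousOn (hsc.mono hXo).neg
    (fun x hx => P_nonneg ν (hXo hx)) (fun x hx hPx => by
      refine bdry_sum fam r μ hr hμ (fun i => (hC i).le) hXc.isClosed hXT hXY hsc.neg ?_ hx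
        ⟨hXo hx, fun h => (P_pos ν h).ne' hPx⟩
      intro y hyX hyb hfix
      have hy0 : y ≠ 0 := by
        rintro rfl
        have : ε ≤ ∑ i : Fin 3, (0 : Fin 3 → ℝ) i := hyX.2
        simp only [Pi.zero_apply, Finset.sum_const_zero] at this
        linarith
      exact neg_pos.2 (H y hyb hy0 hfix))
  obtain ⟨M, hM⟩ := hXc.exists_bound_of_continuousOn (hsc.mono hXo)
  rintro ⟨K, hKc, hKi, -, hKa⟩
  have hKne : K.Nonempty := by
    obtain ⟨m, -, hm⟩ := hKa (fun _ => 1) (fun _ => one_pos)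
    exact ⟨_, hm m le_rfl⟩
  obtain ⟨z, hzK, hz⟩ := hKc.exists_isMinOn hKne hPc.continuousOn
  set L := Real.log p with hL
  set A := min L (lp ν z - N * M - 1) with hA
  -- a starting point
  obtain ⟨x, hxX, hxi, hxA⟩ : ∃ x ∈ X, x ∈ intOrthant 3 ∧ lp ν x ≤ A := by
    have hlim : Tendsto (fun t : ℝ => P ν ![C, t, t]) (𝓝[>] 0) (𝓝 0) := by
      have hcont : Continuous (fun t : ℝ => P ν ![C, t, t]) := hPc.comp (by fun_prop)
      have := hcont.tendsto 0
      rw [P_bdry ν hν (x := ![C, 0, 0]) (fun i => by fin_cases i <;> simp [hC0.le])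
        (fun h => by simpa using h 1)] at this
      exact this.mono_left nhdsWithin_le_nhds
    obtain ⟨t, ht1, ht0, htC⟩ := ((hlim.eventually (gt_mem_nhds (Real.exp_pos A))).and
      (Ioo_mem_nhdsGT hC0)).exists
    have hi : (![C, t, t] : Fin 3 → ℝ) ∈ intOrthant 3 := fun i => by
      fin_cases i <;> simp [hC0, ht0]
    refine ⟨![C, t, t], ⟨⟨fun i => (hi i).le, fun i => ?_⟩, ?_⟩, hi, ?_⟩
    · fin_cases i <;> simp [htC.le]
    · simp only [mem_ofPred_eq, Fin.sum_univ_three, Matrix.cons_val]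
      linarith
    · rw [P_int ν hi] at ht1
      exact (Real.exp_lt_exp.1 ht1).le
  have hM0 : 0 ≤ M := (norm_nonneg _).trans (hM x hxX)
  have hk : ∀ k, T^[k] x ∈ X := fun k => hXT.iterate k hxX
  have hki : ∀ k, T^[k] x ∈ intOrthant 3 := fun k =>
    iter_mem (fun _ h => map_int fam r μ hr hμ h) hxi k
  obtain ⟨m, -, hm⟩ := hKa x hxi
  have hmK := hm m le_rfl
  have h1 : lp ν (T^[m] x) ≤ A + N * M := by
    refine seq_above L M A N hM0 (min_le_left _ _) m (fun k => lp ν (T^[k] x)) ?_ ?_ hxA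
    · intro k
      rw [Function.iterate_succ_apply', lp_map fam r μ ν hr hμ (hki k), add_sub_cancel_left]
      exact hM _ (hk k)
    · intro k hkL
      obtain ⟨j, h1, h2, h3⟩ := hN (T^[k] x) (hk k) (by
        rw [P_int ν (hki k), ← Real.exp_log hp]; exact Real.exp_le_exp.2 hkL)
      refine ⟨j, h1, h2, ?_⟩
      rw [add_comm k j, Function.iterate_add_apply, lp_iter fam r μ ν hr hμ (hki k) j]
      simp only [Pi.neg_apply, Finset.sum_neg_distrib] at h3
      linarith
  have h2 : P ν z ≤ P ν (T^[m] x) := hz hmK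
  rw [P_int ν (hKi hzK), P_int ν (hki m), Real.exp_le_exp] at h2
  have h3 : A ≤ lp ν z - N * M - 1 := min_le_right _ _
  linarith

end DCSAux

/-- For T ∈ DCS(3,f): if there are ν₁,ν₂,ν₃ > 0 with
Σ νᵢ ln Fᵢ(x̂) > 0 for every nonzero fixed point x̂ on ∂ℝ₊³, then T is
permanent; if instead Σ νᵢ ln Fᵢ(x̂) < 0 for every such x̂, then T is
impermanent. -/
theorem stmt5 (fam : Fin 3 → GrowthF) (r : Fin 3 → ℝ) (μ : Fin 3 → Fin 3 → ℝ)
    (hr : ∀ i, 0 < r i) (hμ : ∀ i j, 0 < μ i j)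
    (ν : Fin 3 → ℝ) (hν : ∀ i, 0 < ν i) :
    ((∀ x ∈ bdryOrthant 3, x ≠ 0 → DCS.map fam r μ x = x →
        0 < ∑ i, ν i * Real.log (DCS.F fam r μ i x)) →
      Permanent (DCS.map fam r μ)) ∧
    ((∀ x ∈ bdryOrthant 3, x ≠ 0 → DCS.map fam r μ x = x →
        ∑ i, ν i * Real.log (DCS.F fam r μ i x) < 0) →
      ¬ Permanent (DCS.map fam r μ)) := by
  exact ⟨DCSAux.main_perm fam r μ ν hr hμ hν, DCSAux.main_imperm fam r μ ν hr hμ hν⟩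
end

section
/- Let T ∈ DCS(3,f) with γ₁₂ > 0, γ₂₃ > 0, γ₃₁ > 0 and γ₂₁ < 0, γ₃₂ < 0, γ₁₃ < 0 (so that the boundary of the carrying simplex is a May–Leonard heteroclinic cycle q₍₁₎ → q₍₂₎ → q₍₃₎ → q₍₁₎ connecting the axial fixed points q₍ᵢ₎ = (1/μᵢᵢ)eᵢ). Set 𝒢ᵢⱼ = ln fⱼ(rⱼ μⱼᵢ/μᵢᵢ, rⱼ) and ϱ = 𝒢₁₂𝒢₂₃𝒢₃₁ + 𝒢₂₁𝒢₁₃𝒢₃₂. If ϱ > 0, then T is permanent; if ϱ < 0, then T is impermanent. -/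
open Set Filter Metric Topology Polynomial

/-- 𝒢ᵢⱼ = ln fⱼ(rⱼ μⱼᵢ/μᵢᵢ, rⱼ) = ln Fⱼ(q₍ᵢ₎). -/
noncomputable def Gq (fam : Fin 3 → GrowthF) (r : Fin 3 → ℝ) (μ : Fin 3 → Fin 3 → ℝ)
    (i j : Fin 3) : ℝ :=
  Real.log ((fam j).f (r j * (μ j i / μ i i)) (r j))

/-! ### Average Lyapunov functions on a compact forward invariant set -/

/-- Birkhoff sums of `ψ` along the orbit of `x`. -/
noncomputable def bsum {α : Type} (T : α → α) (ψ : α → ℝ) (k : ℕ) (x : α) : ℝ :=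
  ∑ m ∈ Finset.range k, ψ (T^[m] x)

theorem mapsTo_iter {α : Type} {T : α → α} {Z : Set α} (hT : ∀ x ∈ Z, T x ∈ Z) (k : ℕ) :
    ∀ x ∈ Z, T^[k] x ∈ Z := by
  intro x hx
  induction k with
  | zero => simpa using hx
  | succ k ih => rw [Function.iterate_succ_apply']; exact hT _ ih

theorem P_iter {α : Type} {T : α → α} {Z : Set α} {P ψ : α → ℝ} (hT : ∀ x ∈ Z, T x ∈ Z)
    (hP : ∀ x ∈ Z, P (T x) = P x * Real.exp (ψ x)) (k : ℕ) :
    ∀ x ∈ Z, P (T^[k] x) = P x * Real.exp (bsum T ψ k x) := by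
  intro x hx
  induction k with
  | zero => simp [bsum]
  | succ k ih =>
    rw [Function.iterate_succ_apply', hP _ (mapsTo_iter hT k x hx), ih]
    unfold bsum
    rw [Finset.sum_range_succ, Real.exp_add]
    ring

theorem cover_lemma {α : Type} [TopologicalSpace α] {T : α → α} {Z : Set α} {P ψ : α → ℝ}
    (hZ : IsCompact Z) (hTc : Continuous T) (hψ : Continuous ψ) (hPc : Continuous P)
    (hP0 : ∀ x ∈ Z, 0 ≤ P x)
    (h : ∀ x ∈ Z, P x = 0 → ∃ k, 0 < bsum T ψ k x) :
    ∃ n : ℕ, ∃ ε : ℝ, 0 < ε ∧ ∀ x ∈ Z, ε < P x ∨ ∃ k ≤ n, ε < bsum T ψ k x := by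
  have hb : ∀ k, Continuous (bsum T ψ k) := by
    intro k
    unfold bsum
    exact continuous_finsetSum _ fun m _ => hψ.comp (hTc.iterate m)
  let V : ℕ → Set α := fun n =>
    {x | 1 / ((n : ℝ) + 1) < P x} ∪ ⋃ k ∈ Set.Iic n, {x | 1 / ((n : ℝ) + 1) < bsum T ψ k x}
  have hVo : ∀ n, IsOpen (V n) := by
    intro n
    refine (isOpen_lt continuous_const hPc).union ?_
    exact isOpen_biUnion fun k _ => isOpen_lt continuous_const (hb k)
  have hmono : Monotone V := by
    intro n m hnm x hx
    have hle : 1 / ((m : ℝ) + 1) ≤ 1 / ((n : ℝ) + 1) := by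
      apply one_div_le_one_div_of_le (by positivity)
      have : (n : ℝ) ≤ m := by exact_mod_cast hnm
      linarith
    rcases hx with hx | hx
    · left; exact lt_of_le_of_lt hle hx
    · right
      simp only [Set.mem_iUnion, Set.mem_ofPred_eq, Set.mem_Iic] at hx ⊢
      obtain ⟨k, hk, hk'⟩ := hx
      exact ⟨k, hk.trans hnm, lt_of_le_of_lt hle hk'⟩
  have hcov : Z ⊆ ⋃ n, V n := by
    intro x hx
    rw [Set.mem_iUnion]
    rcases (hP0 x hx).lt_or_eq with hp | hp
    · obtain ⟨n, hn⟩ := exists_nat_one_div_lt hp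
      exact ⟨n, Or.inl hn⟩
    · obtain ⟨k, hk⟩ := h x hx hp.symm
      obtain ⟨n, hn⟩ := exists_nat_one_div_lt hk
      refine ⟨max n k, Or.inr ?_⟩
      simp only [Set.mem_iUnion, Set.mem_ofPred_eq, Set.mem_Iic]
      refine ⟨k, le_max_right _ _, lt_of_le_of_lt ?_ hn⟩
      apply one_div_le_one_div_of_le (by positivity)
      have : (n : ℝ) ≤ ((max n k : ℕ) : ℝ) := by exact_mod_cast le_max_left n k
      linarith
  obtain ⟨n, hn⟩ := hZ.elim_directed_cover V hVo hcov hmono.directed_le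
  refine ⟨n, 1 / ((n : ℝ) + 1), by positivity, fun x hx => ?_⟩
  rcases hn hx with h1 | h1
  · left; exact h1
  · right
    simpa only [Set.mem_iUnion, Set.mem_ofPred_eq, Set.mem_Iic, exists_prop] using h1

theorem persist_lemma {α : Type} [TopologicalSpace α] {T : α → α} {Z : Set α} {P ψ : α → ℝ}
    (hZ : IsCompact Z) (hTc : Continuous T) (hψ : Continuous ψ) (hPc : Continuous P)
    (hT : ∀ x ∈ Z, T x ∈ Z)
    (hP : ∀ x ∈ Z, P (T x) = P x * Real.exp (ψ x))
    (hP0 : ∀ x ∈ Z, 0 ≤ P x)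
    (h : ∀ x ∈ Z, P x = 0 → ∃ k, 0 < bsum T ψ k x) :
    ∃ η : ℝ, 0 < η ∧ ∀ x ∈ Z, 0 < P x → ∃ m, ∀ k ≥ m, η ≤ P (T^[k] x) := by
  obtain ⟨n, ε, hε, hcov⟩ := cover_lemma hZ hTc hψ hPc hP0 h
  obtain ⟨C0, hC0⟩ := hZ.exists_bound_of_continuousOn hψ.continuousOn
  set C := max C0 0 with hC
  have hC0' : 0 ≤ C := le_max_right _ _
  have hCb : ∀ x ∈ Z, -C ≤ ψ x := by
    intro x hx
    have := hC0 x hx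
    rw [Real.norm_eq_abs] at this
    have h2 := (abs_le.1 (this.trans (le_max_left C0 0))).1
    exact h2
  have hSb : ∀ k, ∀ x ∈ Z, -(C * k) ≤ bsum T ψ k x := by
    intro k x hx
    have : ∑ m ∈ Finset.range k, (-C) ≤ bsum T ψ k x :=
      Finset.sum_le_sum fun m _ => hCb _ (mapsTo_iter hT m x hx)
    simp at this
    linarith
  set θ := ε * Real.exp (-C) with hθ
  have hθ0 : 0 < θ := by positivity
  have hθε : θ ≤ ε := by
    have : Real.exp (-C) ≤ 1 := Real.exp_le_one_iff.2 (by linarith)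
    nlinarith
  have hstep : ∀ x ∈ Z, P x ≤ ε → ∃ k, 1 ≤ k ∧ k ≤ n ∧ P x * Real.exp ε ≤ P (T^[k] x) := by
    intro x hx hpx
    rcases hcov x hx with h1 | ⟨k, hk, h1⟩
    · linarith
    · refine ⟨k, ?_, hk, ?_⟩
      · rcases Nat.eq_zero_or_pos k with h0 | h0
        · subst h0; simp [bsum] at h1; linarith
        · exact h0
      · rw [P_iter hT hP k x hx]
        exact mul_le_mul_of_nonneg_left (Real.exp_le_exp.2 h1.le) (hP0 x hx)
  have hret : ∀ x ∈ Z, θ ≤ P x → ∃ k, 1 ≤ k ∧ k ≤ n + 1 ∧ θ ≤ P (T^[k] x) := by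
    intro x hx hpx
    by_cases hpε : P x ≤ ε
    · obtain ⟨k, h1, h2, h3⟩ := hstep x hx hpε
      refine ⟨k, h1, by omega, ?_⟩
      have : 1 ≤ Real.exp ε := Real.one_le_exp hε.le
      nlinarith
    · push Not at hpε
      refine ⟨1, le_rfl, by omega, ?_⟩
      rw [Function.iterate_one, hP x hx]
      exact mul_le_mul hpε.le (Real.exp_le_exp.2 (hCb x hx)) (Real.exp_pos _).le (hP0 x hx)
  refine ⟨θ * Real.exp (-(C * (n + 1))), by positivity, ?_⟩
  intro x hx hpx
  have hstay : ∀ k, ∀ y ∈ Z, θ ≤ P y → θ * Real.exp (-(C * (n + 1))) ≤ P (T^[k] y) := by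
    intro k
    induction k using Nat.strong_induction_on with
    | _ k ih =>
      intro y hy hpy
      by_cases hk : k ≤ n + 1
      · rw [P_iter hT hP k y hy]
        refine mul_le_mul hpy (Real.exp_le_exp.2 ?_) (Real.exp_pos _).le (hP0 y hy)
        refine le_trans ?_ (hSb k y hy)
        have : (k : ℝ) ≤ n + 1 := by exact_mod_cast hk
        nlinarith
      · obtain ⟨j, h1, h2, h3⟩ := hret y hy hpy
        have := ih (k - j) (by omega) (T^[j] y) (mapsTo_iter hT j y hy) h3
        rw [← Function.iterate_add_apply] at this
        rwa [show k - j + j = k by omega] at this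
  have hreach : ∃ m, θ ≤ P (T^[m] x) := by
    by_contra hcon
    push Not at hcon
    have hgrow : ∀ j : ℕ, ∃ k, P x * Real.exp ε ^ j ≤ P (T^[k] x) := by
      intro j
      induction j with
      | zero => exact ⟨0, by simp⟩
      | succ j ih =>
        obtain ⟨k, hk⟩ := ih
        obtain ⟨k', _, _, hk'⟩ := hstep _ (mapsTo_iter hT k x hx) ((hcon k).le.trans hθε)
        refine ⟨k' + k, ?_⟩
        rw [Function.iterate_add_apply]
        refine le_trans ?_ hk'
        rw [pow_succ, ← mul_assoc]
        exact mul_le_mul_of_nonneg_right hk (Real.exp_pos _).le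
    obtain ⟨j, hj⟩ := pow_unbounded_of_one_lt (θ / P x) (Real.one_lt_exp_iff.2 hε)
    obtain ⟨k, hk⟩ := hgrow j
    rw [div_lt_iff₀ hpx] at hj
    have := hcon k
    nlinarith
  obtain ⟨m, hm⟩ := hreach
  refine ⟨m, fun k hk => ?_⟩
  have := hstay (k - m) _ (mapsTo_iter hT m x hx) hm
  rw [← Function.iterate_add_apply] at this
  rwa [show k - m + m = k by omega] at this

theorem attract_lemma {α : Type} [TopologicalSpace α] {T : α → α} {Z : Set α} {P ψ : α → ℝ}
    (hZ : IsCompact Z) (hTc : Continuous T) (hψ : Continuous ψ) (hPc : Continuous P)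
    (hT : ∀ x ∈ Z, T x ∈ Z)
    (hP : ∀ x ∈ Z, P (T x) = P x * Real.exp (ψ x))
    (hP0 : ∀ x ∈ Z, 0 ≤ P x)
    (h : ∀ x ∈ Z, P x = 0 → ∃ k, bsum T ψ k x < 0) :
    ∃ ε : ℝ, 0 < ε ∧ ∀ x ∈ Z, P x ≤ ε → ∀ ρ > 0, ∀ m : ℕ, ∃ k ≥ m, P (T^[k] x) < ρ := by
  have hneg : ∀ k x, bsum T (fun y => -ψ y) k x = -bsum T ψ k x := by
    intro k x; simp [bsum]
  obtain ⟨n, ε, hε, hcov⟩ := cover_lemma (ψ := fun y => -ψ y) hZ hTc hψ.neg hPc hP0 (by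
    intro x hx hp
    obtain ⟨k, hk⟩ := h x hx hp
    exact ⟨k, by rw [hneg]; linarith⟩)
  refine ⟨ε, hε, ?_⟩
  intro x hx hpx ρ hρ m
  have hdec : ∀ j : ℕ, ∃ k ≥ j, P (T^[k] x) ≤ ε * Real.exp (-ε) ^ j := by
    intro j
    induction j with
    | zero => exact ⟨0, le_rfl, by simpa using hpx⟩
    | succ j ih =>
      obtain ⟨k, hkj, hk⟩ := ih
      have hZk := mapsTo_iter hT k x hx
      have he1 : Real.exp (-ε) ≤ 1 := Real.exp_le_one_iff.2 (by linarith)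
      have hle : P (T^[k] x) ≤ ε :=
        hk.trans (mul_le_of_le_one_right hε.le (pow_le_one₀ (Real.exp_pos _).le he1))
      rcases hcov _ hZk with h1 | ⟨k', _, h1⟩
      · linarith
      · rw [hneg] at h1
        have hk1 : 1 ≤ k' := by
          rcases Nat.eq_zero_or_pos k' with h0 | h0
          · subst h0; simp [bsum] at h1; linarith
          · exact h0
        refine ⟨k' + k, by omega, ?_⟩
        rw [Function.iterate_add_apply, P_iter hT hP k' _ hZk, pow_succ, ← mul_assoc]
        exact mul_le_mul hk (Real.exp_le_exp.2 (by linarith)) (Real.exp_pos _).le (by positivity)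
  have ht : Tendsto (fun j : ℕ => ε * Real.exp (-ε) ^ j) atTop (𝓝 (ε * 0)) :=
    (tendsto_pow_atTop_nhds_zero_of_lt_one (Real.exp_pos _).le
      (Real.exp_lt_one_iff.2 (by linarith))).const_mul ε
  rw [mul_zero] at ht
  obtain ⟨j, hj, hjm⟩ := ((ht.eventually (gt_mem_nhds hρ)).and (eventually_ge_atTop m)).exists
  obtain ⟨k, hk, hk'⟩ := hdec j
  exact ⟨k, hjm.trans hk, hk'.trans_lt hj⟩

theorem bsum_pos_of_tendsto {α : Type} [TopologicalSpace α] {T : α → α} {ψ : α → ℝ} {x q : α}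
    (hψ : Continuous ψ) (h : Tendsto (fun k => T^[k] x) atTop (𝓝 q)) (hq : 0 < ψ q) :
    ∃ k, 0 < bsum T ψ k x := by
  have h1 : Tendsto (fun k => ψ (T^[k] x)) atTop (𝓝 (ψ q)) := (hψ.tendsto q).comp h
  have h2 := h1.cesaro
  obtain ⟨k, hk⟩ := (h2.eventually (lt_mem_nhds hq)).exists
  refine ⟨k, ?_⟩
  by_contra hcon
  push Not at hcon
  have : (k : ℝ)⁻¹ * ∑ i ∈ Finset.range k, ψ (T^[i] x) ≤ 0 :=
    mul_nonpos_of_nonneg_of_nonpos (by positivity) hcon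
  linarith

/-! ### One-dimensional growth functions -/

/-- Properties of the normalized growth functions used below. -/
structure GH (g : ℝ → ℝ) : Prop where
  cont : Continuous g
  pos : ∀ s, 0 < g s
  anti : ∀ s t, 0 ≤ s → s < t → g t < g s
  one : g 1 = 1
  mono : ∀ s t, 0 ≤ s → s ≤ t → s * g s ≤ t * g t

namespace GH
variable {g : ℝ → ℝ}

theorem gt_one (h : GH g) {s : ℝ} (h0 : 0 ≤ s) (h1 : s < 1) : 1 < g s := by
  have := h.anti s 1 h0 h1; rwa [h.one] at this

theorem lt_one (h : GH g) {s : ℝ} (h1 : 1 < s) : g s < 1 := by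
  have := h.anti 1 s zero_le_one h1; rwa [h.one] at this

theorem ge_one (h : GH g) {s : ℝ} (h0 : 0 ≤ s) (h1 : s ≤ 1) : 1 ≤ g s := by
  rcases h1.lt_or_eq with h2 | h2
  · exact (h.gt_one h0 h2).le
  · rw [h2, h.one]

theorem le_one (h : GH g) {s : ℝ} (h1 : 1 ≤ s) : g s ≤ 1 := by
  rcases h1.lt_or_eq with h2 | h2
  · exact (h.lt_one h2).le
  · rw [← h2, h.one]

theorem mul_le_one (h : GH g) {s : ℝ} (h0 : 0 ≤ s) (h1 : s ≤ 1) : s * g s ≤ 1 := by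
  have := h.mono s 1 h0 h1; rwa [h.one, one_mul] at this

theorem one_le_mul (h : GH g) {s : ℝ} (h1 : 1 ≤ s) : 1 ≤ s * g s := by
  have := h.mono 1 s zero_le_one h1; rwa [h.one, one_mul] at this

theorem eq_one (h : GH g) {s : ℝ} (h0 : 0 ≤ s) (h1 : g s = 1) : s = 1 := by
  rcases lt_trichotomy s 1 with h2 | h2 | h2
  · have := h.gt_one h0 h2; linarith
  · exact h2
  · have := h.lt_one h2; linarith

end GH

/-- Planar competition in which the second species dominates the first. -/
theorem planar {g1 g2 : ℝ → ℝ} (h1 : GH g1) (h2 : GH g2) {a b c d : ℝ}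
    (hc : 0 < c) (hd : 0 < d) (hca : c < a) (hdb : d < b) (u v : ℕ → ℝ)
    (hu0 : 0 ≤ u 0) (hv0 : 0 < v 0)
    (hu : ∀ n, u (n + 1) = u n * g1 (a * u n + b * v n))
    (hv : ∀ n, v (n + 1) = v n * g2 (c * u n + d * v n)) :
    Tendsto u atTop (𝓝 0) ∧ Tendsto v atTop (𝓝 (1 / d)) := by
  have ha : 0 < a := hc.trans hca
  have hb : 0 < b := hd.trans hdb
  have hup : ∀ n, 0 ≤ u n := by
    intro n
    induction n with
    | zero => exact hu0
    | succ n ih => rw [hu]; exact mul_nonneg ih (h1.pos _).le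
  have hvp : ∀ n, 0 < v n := by
    intro n
    induction n with
    | zero => exact hv0
    | succ n ih => rw [hv]; exact mul_pos ih (h2.pos _)
  have hs2 : ∀ n, 0 < c * u n + d * v n := fun n => by
    have := hup n; have := hvp n; positivity
  have hs12 : ∀ n, c * u n + d * v n < a * u n + b * v n := fun n => by
    have := hup n; have := hvp n; nlinarith
  -- invariance of `s₂ ≤ 1`
  have inv2 : ∀ n, c * u n + d * v n ≤ 1 → c * u (n + 1) + d * v (n + 1) ≤ 1 := by
    intro n hn
    set s1 := a * u n + b * v n with hs1
    set s2 := c * u n + d * v n with hs2d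
    have p2 := hs2 n
    have p12 := hs12 n
    have k2 : g2 s2 ≤ 1 / s2 := by
      rw [le_div_iff₀ p2]; have := h2.mul_le_one p2.le hn; linarith
    have k1 : g1 s1 ≤ 1 / s2 := by
      rw [le_div_iff₀ p2]
      rcases le_total s1 1 with h | h
      · have := h1.mul_le_one (p2.le.trans p12.le) h
        have := h1.pos s1
        nlinarith
      · have := h1.le_one h
        have := h1.pos s1
        nlinarith
    rw [hu, hv]
    calc c * (u n * g1 s1) + d * (v n * g2 s2)
        = (c * u n) * g1 s1 + (d * v n) * g2 s2 := by ring
      _ ≤ (c * u n) * (1 / s2) + (d * v n) * (1 / s2) :=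
          add_le_add (mul_le_mul_of_nonneg_left k1 (mul_nonneg hc.le (hup n)))
            (mul_le_mul_of_nonneg_left k2 (mul_nonneg hd.le (hvp n).le))
      _ = s2 * (1 / s2) := by rw [hs2d]; ring
      _ = 1 := mul_one_div_cancel p2.ne'
  have inv1 : ∀ n, 1 ≤ a * u n + b * v n → 1 ≤ a * u (n + 1) + b * v (n + 1) := by
    intro n hn
    set s1 := a * u n + b * v n with hs1
    set s2 := c * u n + d * v n with hs2d
    have p2 := hs2 n
    have p12 := hs12 n
    have p1 : 0 < s1 := p2.trans p12
    have k1 : 1 / s1 ≤ g1 s1 := by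
      rw [div_le_iff₀ p1]; have := h1.one_le_mul hn; linarith
    have k2 : 1 / s1 ≤ g2 s2 := by
      rw [div_le_iff₀ p1]
      rcases le_total s2 1 with h | h
      · have := h2.ge_one p2.le h
        nlinarith
      · have := h2.one_le_mul h
        have := h2.pos s2
        nlinarith
    rw [hu, hv]
    calc (1 : ℝ) = s1 * (1 / s1) := by field_simp
      _ = (a * u n) * (1 / s1) + (b * v n) * (1 / s1) := by rw [hs1]; ring
      _ ≤ (a * u n) * g1 s1 + (b * v n) * g2 s2 :=
          add_le_add (mul_le_mul_of_nonneg_left k1 (mul_nonneg ha.le (hup n)))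
            (mul_le_mul_of_nonneg_left k2 (mul_nonneg hb.le (hvp n).le))
      _ = a * (u n * g1 s1) + b * (v n * g2 s2) := by ring
  have inv2' : ∀ N, c * u N + d * v N ≤ 1 → ∀ k, c * u (k + N) + d * v (k + N) ≤ 1 := by
    intro N hN k
    induction k with
    | zero => simpa using hN
    | succ k ih => rw [show k + 1 + N = (k + N) + 1 by ring]; exact inv2 _ ih
  have inv1' : ∀ N, 1 ≤ a * u N + b * v N → ∀ k, 1 ≤ a * u (k + N) + b * v (k + N) := by
    intro N hN k
    induction k with
    | zero => simpa using hN
    | succ k ih => rw [show k + 1 + N = (k + N) + 1 by ring]; exact inv1 _ ih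
  -- the limit
  have fin : ∀ A B : ℝ, Tendsto u atTop (𝓝 A) → Tendsto v atTop (𝓝 B) →
      (0 < B ∨ 1 ≤ c * A + d * B) → A = 0 ∧ B = 1 / d := by
    intro A B hA hB hor
    have hA0 : 0 ≤ A := ge_of_tendsto' hA hup
    have hB0 : 0 ≤ B := ge_of_tendsto' hB fun n => (hvp n).le
    have eA : A = A * g1 (a * A + b * B) := by
      have t1 : Tendsto (fun n => u (n + 1)) atTop (𝓝 A) := hA.comp (tendsto_add_atTop_nat 1)
      have t2 : Tendsto (fun n => u n * g1 (a * u n + b * v n)) atTop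
          (𝓝 (A * g1 (a * A + b * B))) :=
        hA.mul ((h1.cont.tendsto _).comp ((hA.const_mul a).add (hB.const_mul b)))
      simp only [← hu] at t2
      exact tendsto_nhds_unique t1 t2
    have eB : B = B * g2 (c * A + d * B) := by
      have t1 : Tendsto (fun n => v (n + 1)) atTop (𝓝 B) := hB.comp (tendsto_add_atTop_nat 1)
      have t2 : Tendsto (fun n => v n * g2 (c * u n + d * v n)) atTop
          (𝓝 (B * g2 (c * A + d * B))) :=
        hB.mul ((h2.cont.tendsto _).comp ((hA.const_mul c).add (hB.const_mul d)))
      simp only [← hv] at t2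
      exact tendsto_nhds_unique t1 t2
    have hAz : 1 < a * A + b * B → A = 0 := by
      intro hgt
      have := h1.lt_one hgt
      nlinarith
    have hBpos : 0 < B := by
      rcases hor with h | h
      · exact h
      · by_contra hcon
        have hB' : B = 0 := le_antisymm (not_lt.1 hcon) hB0
        have hApos : 0 < A := by
          rcases hA0.lt_or_eq with h' | h'
          · exact h'
          · rw [← h', hB'] at h; norm_num at h
        have := hAz (by rw [hB'] at h ⊢; nlinarith)
        linarith
    have g2e : g2 (c * A + d * B) = 1 := by
      have : B * (g2 (c * A + d * B) - 1) = 0 := by linarith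
      rcases mul_eq_zero.1 this with h | h <;> linarith
    have s2e := h2.eq_one (by positivity) g2e
    have Az := hAz (by nlinarith)
    refine ⟨Az, ?_⟩
    rw [Az] at s2e
    field_simp
    linarith
  have uanti : ∀ n, 1 ≤ a * u n + b * v n → u (n + 1) ≤ u n := fun n hn => by
    rw [hu]; exact mul_le_of_le_one_right (hup n) (h1.le_one hn)
  have umono : ∀ n, a * u n + b * v n ≤ 1 → u n ≤ u (n + 1) := fun n hn => by
    rw [hu]; exact le_mul_of_one_le_right (hup n) (h1.ge_one ((hs2 n).trans (hs12 n)).le hn)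
  have vanti : ∀ n, 1 ≤ c * u n + d * v n → v (n + 1) ≤ v n := fun n hn => by
    rw [hv]; exact mul_le_of_le_one_right (hvp n).le (h2.le_one hn)
  have vmono : ∀ n, c * u n + d * v n ≤ 1 → v n ≤ v (n + 1) := fun n hn => by
    rw [hv]; exact le_mul_of_one_le_right (hvp n).le (h2.ge_one (hs2 n).le hn)
  have vbd : ∀ n, c * u n + d * v n ≤ 1 → v n ≤ 1 / d := fun n hn => by
    rw [le_div_iff₀ hd]; have := hup n; nlinarith
  suffices hmain : ∃ A B : ℝ, Tendsto u atTop (𝓝 A) ∧ Tendsto v atTop (𝓝 B) ∧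
      (0 < B ∨ 1 ≤ c * A + d * B) by
    obtain ⟨A, B, hA, hB, hor⟩ := hmain
    obtain ⟨rfl, rfl⟩ := fin A B hA hB hor
    exact ⟨hA, hB⟩
  by_cases hc2 : ∃ n, c * u n + d * v n ≤ 1
  · obtain ⟨N2, hN2⟩ := hc2
    by_cases hc1 : ∃ n, 1 ≤ a * u n + b * v n
    · obtain ⟨N1, hN1⟩ := hc1
      have q1 : ∀ k, 1 ≤ a * u (k + (N1 + N2)) + b * v (k + (N1 + N2)) := by
        intro k; have := inv1' N1 hN1 (k + N2)
        rwa [show k + N2 + N1 = k + (N1 + N2) by ring] at this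
      have q2 : ∀ k, c * u (k + (N1 + N2)) + d * v (k + (N1 + N2)) ≤ 1 := by
        intro k; have := inv2' N2 hN2 (k + N1)
        rwa [show k + N1 + N2 = k + (N1 + N2) by ring] at this
      have mu : Antitone fun k => u (k + (N1 + N2)) := antitone_nat_of_succ_le fun k => by
        have := uanti _ (q1 k)
        rwa [show k + (N1 + N2) + 1 = k + 1 + (N1 + N2) by ring] at this
      have mv : Monotone fun k => v (k + (N1 + N2)) := monotone_nat_of_le_succ fun k => by
        have := vmono _ (q2 k)
        rwa [show k + (N1 + N2) + 1 = k + 1 + (N1 + N2) by ring] at this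
      have tu := tendsto_atTop_ciInf mu ⟨0, by rintro _ ⟨k, rfl⟩; exact hup _⟩
      have tv := tendsto_atTop_ciSup mv ⟨1 / d, by rintro _ ⟨k, rfl⟩; exact vbd _ (q2 k)⟩
      refine ⟨_, _, (tendsto_add_atTop_iff_nat (f := u) (N1 + N2)).1 tu,
        (tendsto_add_atTop_iff_nat (f := v) (N1 + N2)).1 tv, Or.inl ?_⟩
      exact lt_of_lt_of_le (hvp _) (mv.ge_of_tendsto tv 0)
    · push Not at hc1
      have q2 : ∀ k, c * u k + d * v k ≤ 1 := fun k => ((hs12 k).trans (hc1 k)).le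
      have mu : Monotone u := monotone_nat_of_le_succ fun k => umono _ (hc1 k).le
      have mv : Monotone v := monotone_nat_of_le_succ fun k => vmono _ (q2 k)
      have tu := tendsto_atTop_ciSup mu ⟨1 / c, by
        rintro _ ⟨k, rfl⟩
        rw [le_div_iff₀ hc]; have := hvp k; have := q2 k; nlinarith⟩
      have tv := tendsto_atTop_ciSup mv ⟨1 / d, by rintro _ ⟨k, rfl⟩; exact vbd _ (q2 k)⟩
      refine ⟨_, _, tu, tv, Or.inl ?_⟩
      exact lt_of_lt_of_le (hvp _) (mv.ge_of_tendsto tv 0)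
  · push Not at hc2
    have mu : Antitone u := antitone_nat_of_succ_le fun k =>
      uanti _ ((hc2 k).trans (hs12 k)).le
    have mv : Antitone v := antitone_nat_of_succ_le fun k => vanti _ (hc2 k).le
    have tu := tendsto_atTop_ciInf mu ⟨0, by rintro _ ⟨k, rfl⟩; exact hup _⟩
    have tv := tendsto_atTop_ciInf mv ⟨0, by rintro _ ⟨k, rfl⟩; exact (hvp _).le⟩
    refine ⟨_, _, tu, tv, Or.inr ?_⟩
    exact ge_of_tendsto' ((tu.const_mul c).add (tv.const_mul d)) fun n => (hc2 n).le

/-! ### The three-dimensional map -/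

/-- The map with normalized growth functions. -/
def TT (g : Fin 3 → ℝ → ℝ) (μ : Fin 3 → Fin 3 → ℝ) (x : Fin 3 → ℝ) : Fin 3 → ℝ :=
  fun i => x i * g i (∑ j, μ i j * x j)

/-- The average Lyapunov function. -/
noncomputable def PP (p : Fin 3 → ℝ) (x : Fin 3 → ℝ) : ℝ := ∏ j, x j ^ p j

/-- The logarithmic growth of `PP`. -/
noncomputable def psi (g : Fin 3 → ℝ → ℝ) (μ : Fin 3 → Fin 3 → ℝ) (p : Fin 3 → ℝ)
    (x : Fin 3 → ℝ) : ℝ := ∑ j, p j * Real.log (g j (∑ k, μ j k * x k))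

/-- Axial fixed points. -/
noncomputable def qq (μ : Fin 3 → Fin 3 → ℝ) (i : Fin 3) : Fin 3 → ℝ :=
  fun j => if j = i then 1 / μ i i else 0

section main
variable {g : Fin 3 → ℝ → ℝ} {μ : Fin 3 → Fin 3 → ℝ} {p : Fin 3 → ℝ}

theorem TT_cont (hg : ∀ i, GH (g i)) : Continuous (TT g μ) := by
  unfold TT
  refine continuous_pi fun i => ?_
  exact (continuous_apply i).mul ((hg i).cont.comp (by fun_prop))

theorem psi_cont (hg : ∀ i, GH (g i)) : Continuous (psi g μ p) := by
  unfold psi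
  refine continuous_finsetSum _ fun i _ => continuous_const.mul ?_
  exact Continuous.log ((hg i).cont.comp (by fun_prop)) fun x => ((hg i).pos _).ne'

theorem PP_cont (hp : ∀ i, 0 < p i) : Continuous (PP p) := by
  unfold PP
  refine continuous_finsetProd _ fun i _ => ?_
  exact (continuous_apply i).rpow_const fun x => Or.inr (hp i).le

theorem PP_nonneg {x : Fin 3 → ℝ} (hx : ∀ i, 0 ≤ x i) : 0 ≤ PP p x :=
  Finset.prod_nonneg fun i _ => Real.rpow_nonneg (hx i) _

theorem PP_pos {x : Fin 3 → ℝ} (hx : ∀ i, 0 < x i) : 0 < PP p x :=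
  Finset.prod_pos fun i _ => Real.rpow_pos_of_pos (hx i) _

theorem PP_ne_zero (hp : ∀ i, 0 < p i) {x : Fin 3 → ℝ} (hx : ∀ i, 0 ≤ x i) (h : PP p x ≠ 0) :
    ∀ i, 0 < x i := by
  intro i
  refine lt_of_le_of_ne (hx i) fun h0 => h ?_
  refine Finset.prod_eq_zero (Finset.mem_univ i) ?_
  rw [← h0, Real.zero_rpow (hp i).ne']

theorem PP_eq_zero {x : Fin 3 → ℝ} (hx : ∀ i, 0 ≤ x i) (h : PP p x = 0) :
    ∃ i, x i = 0 := by
  by_contra hcon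
  push Not at hcon
  have := PP_pos (p := p) fun i => lt_of_le_of_ne (hx i) (hcon i).symm
  linarith

theorem TT_nonneg (hg : ∀ i, GH (g i)) {x : Fin 3 → ℝ} (hx : ∀ i, 0 ≤ x i) (i : Fin 3) :
    0 ≤ TT g μ x i := mul_nonneg (hx i) ((hg i).pos _).le

theorem TT_pos (hg : ∀ i, GH (g i)) {x : Fin 3 → ℝ} (hx : ∀ i, 0 < x i) (i : Fin 3) :
    0 < TT g μ x i := mul_pos (hx i) ((hg i).pos _)

theorem PP_TT (hg : ∀ i, GH (g i)) {x : Fin 3 → ℝ} (hx : ∀ i, 0 ≤ x i) :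
    PP p (TT g μ x) = PP p x * Real.exp (psi g μ p x) := by
  unfold PP psi TT
  rw [Real.exp_sum, ← Finset.prod_mul_distrib]
  refine Finset.prod_congr rfl fun i _ => ?_
  rw [Real.mul_rpow (hx i) ((hg i).pos _).le, Real.rpow_def_of_pos ((hg i).pos _), mul_comm (p i)]

/-- Orbits on a face converge to the dominating axial fixed point. -/
theorem face (hg : ∀ i, GH (g i)) (hμ : ∀ i j, 0 < μ i j) (a b c : Fin 3)
    (hsum : ∀ h : Fin 3 → ℝ, ∑ j, h j = h a + h b + h c)
    (hall : ∀ j, j = a ∨ j = b ∨ j = c) (hab : a ≠ b) (hcb : c ≠ b)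
    (h1 : μ b a < μ a a) (h2 : μ b b < μ a b)
    {x : Fin 3 → ℝ} (hx : 0 ≤ x a) (hxb : 0 < x b) (hxc : x c = 0) :
    Tendsto (fun k => (TT g μ)^[k] x) atTop (𝓝 (qq μ b)) := by
  have hc : ∀ k, (TT g μ)^[k] x c = 0 := by
    intro k
    induction k with
    | zero => simpa using hxc
    | succ k ih => rw [Function.iterate_succ_apply']; simp [TT, ih]
  have := planar (hg a) (hg b) (hμ b a) (hμ b b) h1 h2
    (fun k => (TT g μ)^[k] x a) (fun k => (TT g μ)^[k] x b) hx hxb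
    (by intro n; rw [Function.iterate_succ_apply']; simp only [TT]; rw [hsum, hc n]; simp)
    (by intro n; rw [Function.iterate_succ_apply']; simp only [TT]; rw [hsum, hc n]; simp)
  rw [tendsto_pi_nhds]
  intro j
  rcases hall j with rfl | rfl | rfl
  · simpa [qq, hab] using this.1
  · simpa [qq] using this.2
  · simp only [hc]; simp [qq, hcb]

theorem boundary_limit (hg : ∀ i, GH (g i)) (hμ : ∀ i j, 0 < μ i j)
    (hd : ∀ i : Fin 3, μ (i + 1) i < μ i i ∧ μ (i + 1) (i + 1) < μ i (i + 1))
    {x : Fin 3 → ℝ} (hx : ∀ i, 0 ≤ x i) (hx0 : ∃ i, x i = 0) (hne : ∃ i, x i ≠ 0) :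
    ∃ i, Tendsto (fun k => (TT g μ)^[k] x) atTop (𝓝 (qq μ i)) := by
  have key : ∀ i : Fin 3, 0 < x (i + 1) → x (i + 2) = 0 →
      ∃ i, Tendsto (fun k => (TT g μ)^[k] x) atTop (𝓝 (qq μ i)) := by
    intro i h1 h2
    refine ⟨i + 1, face hg hμ i (i + 1) (i + 2) ?_ ?_ ?_ ?_ (hd i).1 (hd i).2 (hx i) h1 h2⟩
    · intro h; fin_cases i <;> simp [Fin.sum_univ_three] <;> ring
    · clear * -; revert i; decide
    · clear * -; revert i; decide
    · clear * -; revert i; decide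
  obtain ⟨c, hc⟩ := hx0
  by_cases h : 0 < x (c + 2)
  · exact key (c + 1) (by rwa [show c + 1 + 1 = c + 2 by clear * -; revert c; decide])
      (by rwa [show c + 1 + 2 = c by clear * -; revert c; decide])
  · have h0 : x (c + 2) = 0 := le_antisymm (not_lt.1 h) (hx _)
    refine key c (lt_of_le_of_ne (hx _) fun h1 => ?_) h0
    obtain ⟨j, hj⟩ := hne
    apply hj
    have : j = c ∨ j = c + 1 ∨ j = c + 2 := by clear * -; revert j c; decide
    rcases this with rfl | rfl | rfl
    · exact hc
    · exact h1.symm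
    · exact h0

/-- The compact box. -/
def box (μ : Fin 3 → Fin 3 → ℝ) : Set (Fin 3 → ℝ) := {x | ∀ i, 0 ≤ x i ∧ x i ≤ 2 / μ i i}

theorem box_compact : IsCompact (box μ) := by
  have : box μ = Set.Icc (fun _ => 0) (fun i => 2 / μ i i) := by
    ext x
    constructor
    · intro h; exact ⟨fun i => (h i).1, fun i => (h i).2⟩
    · intro h; exact fun i => ⟨h.1 i, h.2 i⟩
  rw [this]
  exact isCompact_Icc

theorem le_sum (hμ : ∀ i j, 0 < μ i j) {x : Fin 3 → ℝ} (hx : ∀ i, 0 ≤ x i) (i : Fin 3) :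
    μ i i * x i ≤ ∑ j, μ i j * x j :=
  Finset.single_le_sum (f := fun j => μ i j * x j)
    (fun j _ => mul_nonneg (hμ i j).le (hx j)) (Finset.mem_univ i)

theorem sum_nn (hμ : ∀ i j, 0 < μ i j) {x : Fin 3 → ℝ} (hx : ∀ i, 0 ≤ x i) (i : Fin 3) :
    0 ≤ ∑ j, μ i j * x j :=
  Finset.sum_nonneg fun j _ => mul_nonneg (hμ i j).le (hx j)

theorem coord_inv (hg : ∀ i, GH (g i)) (hμ : ∀ i j, 0 < μ i j) {x : Fin 3 → ℝ}
    (hx : ∀ i, 0 ≤ x i) (i : Fin 3) (h : x i ≤ 2 / μ i i) : TT g μ x i ≤ 2 / μ i i := by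
  have hs := le_sum hμ hx i
  have hs0 := sum_nn hμ hx i
  unfold TT
  set s := ∑ j, μ i j * x j
  rcases le_total 1 s with h1 | h1
  · exact (mul_le_of_le_one_right (hx i) ((hg i).le_one h1)).trans h
  · rw [le_div_iff₀ (hμ i i)]
    have h2 := (hg i).mul_le_one hs0 h1
    have := (hg i).pos s
    nlinarith

theorem box_inv (hg : ∀ i, GH (g i)) (hμ : ∀ i j, 0 < μ i j) :
    ∀ x ∈ box μ, TT g μ x ∈ box μ := fun _ hx i =>
  ⟨TT_nonneg hg (fun j => (hx j).1) i, coord_inv hg hμ (fun j => (hx j).1) i (hx i).2⟩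

theorem iter_nonneg (hg : ∀ i, GH (g i)) {x : Fin 3 → ℝ} (hx : ∀ i, 0 ≤ x i) (k : ℕ) :
    ∀ i, 0 ≤ (TT g μ)^[k] x i :=
  mapsTo_iter (Z := {x : Fin 3 → ℝ | ∀ i, 0 ≤ x i}) (fun _ hy => TT_nonneg hg hy) k x hx

theorem iter_pos (hg : ∀ i, GH (g i)) {x : Fin 3 → ℝ} (hx : ∀ i, 0 < x i) (k : ℕ) :
    ∀ i, 0 < (TT g μ)^[k] x i :=
  mapsTo_iter (Z := {x : Fin 3 → ℝ | ∀ i, 0 < x i}) (fun _ hy => TT_pos hg hy) k x hx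

theorem absorb (hg : ∀ i, GH (g i)) (hμ : ∀ i j, 0 < μ i j) {x : Fin 3 → ℝ}
    (hx : ∀ i, 0 ≤ x i) : ∃ m, (TT g μ)^[m] x ∈ box μ := by
  have h1 : ∀ i, ∃ m, ∀ k ≥ m, (TT g μ)^[k] x i ≤ 2 / μ i i := by
    intro i
    have hex : ∃ m, (TT g μ)^[m] x i ≤ 2 / μ i i := by
      by_contra hcon
      push Not at hcon
      have hdec : ∀ k, (TT g μ)^[k] x i ≤ x i * g i 2 ^ k := by
        intro k
        induction k with
        | zero => simp
        | succ k ih =>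
          rw [Function.iterate_succ_apply', pow_succ, ← mul_assoc]
          have hk := hcon k
          have hs := le_sum hμ (iter_nonneg (μ := μ) hg hx k) i
          rw [div_lt_iff₀ (hμ i i)] at hk
          unfold TT at hs hk ih ⊢
          refine mul_le_mul ih ?_ ((hg i).pos _).le
            (mul_nonneg (hx i) (pow_nonneg ((hg i).pos _).le _))
          exact ((hg i).anti 2 _ (by norm_num) (by linarith)).le
      have ht : Tendsto (fun k : ℕ => x i * g i 2 ^ k) atTop (𝓝 (x i * 0)) :=
        (tendsto_pow_atTop_nhds_zero_of_lt_one ((hg i).pos 2).le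
          ((hg i).lt_one (by norm_num))).const_mul _
      rw [mul_zero] at ht
      have hpos : 0 < 2 / μ i i := div_pos two_pos (hμ i i)
      obtain ⟨k, hk⟩ := (ht.eventually (gt_mem_nhds hpos)).exists
      have := hdec k
      have := hcon k
      linarith
    obtain ⟨m, hm⟩ := hex
    refine ⟨m, fun k hk => ?_⟩
    induction k, hk using Nat.le_induction with
    | base => exact hm
    | succ k _ ih =>
      rw [Function.iterate_succ_apply']
      exact coord_inv hg hμ (iter_nonneg hg hx k) i ih
  choose m hm using h1
  refine ⟨∑ i, m i, fun i => ⟨iter_nonneg hg hx _ i, hm i _ ?_⟩⟩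
  exact Finset.single_le_sum (f := m) (fun _ _ => Nat.zero_le _) (Finset.mem_univ i)

theorem psi_zero_pos (hg : ∀ i, GH (g i)) (hp : ∀ i, 0 < p i) : 0 < psi g μ p 0 := by
  unfold psi
  refine Finset.sum_pos (fun i _ => mul_pos (hp i) (Real.log_pos ?_)) Finset.univ_nonempty
  simpa using (hg i).gt_one le_rfl one_pos

theorem TT_permanent (hg : ∀ i, GH (g i)) (hμ : ∀ i j, 0 < μ i j)
    (hd : ∀ i : Fin 3, μ (i + 1) i < μ i i ∧ μ (i + 1) (i + 1) < μ i (i + 1))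
    (hp : ∀ i, 0 < p i) (hq : ∀ i, 0 < psi g μ p (qq μ i)) : Permanent (TT g μ) := by
  have hb0 : ∀ x ∈ box μ, ∀ i, 0 ≤ x i := fun x hx i => (hx i).1
  obtain ⟨η, hη, hpers⟩ := persist_lemma (T := TT g μ) (ψ := psi g μ p) (P := PP p)
    (box_compact (μ := μ)) (TT_cont hg) (psi_cont hg) (PP_cont hp) (box_inv hg hμ)
    (fun x hx => PP_TT hg (hb0 x hx)) (fun x hx => PP_nonneg (hb0 x hx)) (by
      intro x hx hP
      have h0 := PP_eq_zero (hb0 x hx) hP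
      by_cases hne : ∃ i, x i ≠ 0
      · obtain ⟨i, hi⟩ := boundary_limit hg hμ hd (hb0 x hx) h0 hne
        exact bsum_pos_of_tendsto (psi_cont hg) hi (hq i)
      · push Not at hne
        have hx0 : x = 0 := funext hne
        refine ⟨1, ?_⟩
        simp only [bsum, Finset.sum_range_one, Function.iterate_zero, id, hx0]
        exact psi_zero_pos hg hp)
  refine ⟨{x | x ∈ box μ ∧ ∀ k, η ≤ PP p ((TT g μ)^[k] x)}, ?_, ?_, ?_, ?_⟩
  · have hcl : IsClosed {x : Fin 3 → ℝ | ∀ k, η ≤ PP p ((TT g μ)^[k] x)} := by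
      have : {x : Fin 3 → ℝ | ∀ k, η ≤ PP p ((TT g μ)^[k] x)} =
          ⋂ k, {x | η ≤ PP p ((TT g μ)^[k] x)} := by ext x; simp
      rw [this]
      exact isClosed_iInter fun k =>
        isClosed_le continuous_const ((PP_cont hp).comp ((TT_cont hg).iterate k))
    exact (box_compact (μ := μ)).inter_right hcl
  · rintro x ⟨hx, hk⟩
    have := hk 0
    simp only [Function.iterate_zero, id] at this
    exact PP_ne_zero hp (hb0 x hx) (by linarith)
  · rintro _ ⟨x, ⟨hx, hk⟩, rfl⟩
    refine ⟨box_inv hg hμ x hx, fun k => ?_⟩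
    rw [← Function.iterate_succ_apply]
    exact hk _
  · intro x hx
    obtain ⟨m, hm⟩ := absorb hg hμ (fun i => (hx i).le)
    obtain ⟨m', hm'⟩ := hpers _ hm (PP_pos (iter_pos hg hx m))
    refine ⟨m + m' + 1, by omega, fun k hk => ⟨?_, fun j => ?_⟩⟩
    · have := mapsTo_iter (box_inv hg hμ) (k - m) _ hm
      rw [← Function.iterate_add_apply] at this
      rwa [show k - m + m = k by omega] at this
    · have := hm' (j + (k - m)) (by omega)
      rw [← Function.iterate_add_apply] at this
      rw [← Function.iterate_add_apply]
      rwa [show j + (k - m) + m = j + k by omega] at this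

/-- Away from the origin there is a compact forward invariant set. -/
theorem exists_away (hg : ∀ i, GH (g i)) (hμ : ∀ i j, 0 < μ i j) :
    ∃ ε : ℝ, 0 < ε ∧ ε ≤ 1 / μ 0 0 ∧ ∀ x ∈ box μ, ε ≤ ∑ i, x i → ε ≤ ∑ i, TT g μ x i := by
  -- lower bound for the growth rates
  have hm : ∀ i, ∃ m : ℝ, 0 < m ∧ ∀ x ∈ box μ, m ≤ g i (∑ j, μ i j * x j) := by
    intro i
    have hne : (box μ).Nonempty :=
      ⟨0, fun i => ⟨le_rfl, (div_pos two_pos (hμ i i)).le⟩⟩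
    obtain ⟨y, _, hy⟩ := (box_compact (μ := μ)).exists_isMinOn hne
      (f := fun x => g i (∑ j, μ i j * x j))
      (Continuous.continuousOn ((hg i).cont.comp (by fun_prop)))
    exact ⟨_, (hg i).pos _, fun x hx => hy hx⟩
  choose m hm0 hm using hm
  set M := min 1 (min (m 0) (min (m 1) (m 2))) with hM
  have hM0 : 0 < M := by
    simp only [hM, lt_min_iff]; exact ⟨one_pos, hm0 0, hm0 1, hm0 2⟩
  have hM1 : M ≤ 1 := min_le_left _ _
  have hMi : ∀ i, M ≤ m i := by
    intro i; fin_cases i <;> simp [hM]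
  set S := ∑ i, ∑ j, μ i j with hS
  have hS0 : 0 < S := Finset.sum_pos (fun i _ => Finset.sum_pos (fun j _ => hμ i j)
    Finset.univ_nonempty) Finset.univ_nonempty
  have hSij : ∀ i j, μ i j ≤ S := fun i j =>
    (Finset.single_le_sum (f := fun j => μ i j) (fun j _ => (hμ i j).le)
      (Finset.mem_univ j)).trans
    (Finset.single_le_sum (f := fun i => ∑ j, μ i j)
      (fun i _ => Finset.sum_nonneg fun j _ => (hμ i j).le) (Finset.mem_univ i))
  refine ⟨M * (1 / S), by positivity, ?_, ?_⟩
  · have : 1 / S ≤ 1 / μ 0 0 := one_div_le_one_div_of_le (hμ 0 0) (hSij 0 0)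
    have h0 : 0 < 1 / S := by positivity
    nlinarith
  · intro x hx hε
    have hx0 : ∀ i, 0 ≤ x i := fun i => (hx i).1
    by_cases hle : ∑ i, x i ≤ 1 / S
    · refine hε.trans (Finset.sum_le_sum fun i _ => ?_)
      refine le_mul_of_one_le_right (hx0 i) ((hg i).ge_one (sum_nn hμ hx0 i) ?_)
      calc ∑ j, μ i j * x j ≤ ∑ j, S * x j :=
            Finset.sum_le_sum fun j _ => mul_le_mul_of_nonneg_right (hSij i j) (hx0 j)
        _ = S * ∑ j, x j := by rw [Finset.mul_sum]
        _ ≤ S * (1 / S) := mul_le_mul_of_nonneg_left hle hS0.le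
        _ = 1 := mul_one_div_cancel hS0.ne'
    · push Not at hle
      calc M * (1 / S) ≤ M * ∑ i, x i := mul_le_mul_of_nonneg_left hle.le hM0.le
        _ = ∑ i, x i * M := by rw [Finset.mul_sum]; simp only [mul_comm]
        _ ≤ ∑ i, TT g μ x i := Finset.sum_le_sum fun i _ =>
            mul_le_mul_of_nonneg_left ((hMi i).trans (hm i x hx)) (hx0 i)

theorem TT_impermanent (hg : ∀ i, GH (g i)) (hμ : ∀ i j, 0 < μ i j)
    (hd : ∀ i : Fin 3, μ (i + 1) i < μ i i ∧ μ (i + 1) (i + 1) < μ i (i + 1))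
    (hp : ∀ i, 0 < p i) (hq : ∀ i, psi g μ p (qq μ i) < 0) : ¬ Permanent (TT g μ) := by
  rintro ⟨K, hK, hKi, _, hKa⟩
  obtain ⟨e, he, heμ, hinv⟩ := exists_away (g := g) hg hμ
  set Y : Set (Fin 3 → ℝ) := box μ ∩ {x | e ≤ ∑ i, x i} with hY
  have hYc : IsCompact Y := (box_compact (μ := μ)).inter_right
    (isClosed_le continuous_const (by fun_prop))
  have hb0 : ∀ x ∈ Y, ∀ i, 0 ≤ x i := fun x hx i => (hx.1 i).1
  obtain ⟨ε, hε, hatt⟩ := attract_lemma (T := TT g μ) (ψ := psi g μ p) (P := PP p)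
    hYc (TT_cont hg) (psi_cont hg) (PP_cont hp)
    (fun x hx => ⟨box_inv hg hμ x hx.1, hinv x hx.1 hx.2⟩)
    (fun x hx => PP_TT hg (hb0 x hx)) (fun x hx => PP_nonneg (hb0 x hx)) (by
      intro x hx hP
      have h0 := PP_eq_zero (hb0 x hx) hP
      have hne : ∃ i, x i ≠ 0 := by
        by_contra hcon
        push Not at hcon
        have h2 : e ≤ ∑ i, x i := hx.2
        simp [hcon] at h2
        linarith
      obtain ⟨i, hi⟩ := boundary_limit hg hμ hd (hb0 x hx) h0 hne
      obtain ⟨k, hk⟩ := bsum_pos_of_tendsto (psi_cont (μ := μ) (p := p) hg).neg hi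
        (by have := hq i; simpa using this)
      refine ⟨k, ?_⟩
      simp only [bsum, Pi.neg_apply, Finset.sum_neg_distrib] at hk ⊢
      linarith)
  -- an interior point close to the boundary
  have hpt : ∃ x ∈ Y, (∀ i, 0 < x i) ∧ PP p x ≤ ε := by
    let z : ℝ → Fin 3 → ℝ := fun t i => if i = 0 then 1 / μ 0 0 else t
    have hz : Continuous z := by
      refine continuous_pi fun i => ?_
      by_cases hi : i = 0
      · simp only [z, hi, if_true]; exact continuous_const
      · simp only [z, hi, if_false]; exact continuous_id
    have hz0 : PP p (z 0) = 0 := by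
      refine Finset.prod_eq_zero (Finset.mem_univ 1) ?_
      simp [z, Real.zero_rpow (hp 1).ne']
    have ht : Tendsto (fun t => PP p (z t)) (𝓝[>] 0) (𝓝 0) := by
      have := ((PP_cont hp).comp hz).tendsto 0
      simp only [Function.comp_def, hz0] at this
      exact this.mono_left nhdsWithin_le_nhds
    have ev1 := ht.eventually (gt_mem_nhds hε)
    have ev2 : ∀ᶠ t : ℝ in 𝓝[>] 0, t < min (2 / μ 1 1) (2 / μ 2 2) :=
      nhdsWithin_le_nhds (gt_mem_nhds (lt_min (div_pos two_pos (hμ 1 1))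
        (div_pos two_pos (hμ 2 2))))
    have ev3 : ∀ᶠ t : ℝ in 𝓝[>] 0, 0 < t := self_mem_nhdsWithin
    obtain ⟨t, h1, h2, h3⟩ := (ev1.and (ev2.and ev3)).exists
    have hμ0 : 0 < 1 / μ 0 0 := one_div_pos.2 (hμ 0 0)
    have hzp : ∀ i, 0 < z t i := by
      intro i; simp only [z]; split_ifs
      · exact hμ0
      · exact h3
    rw [lt_min_iff] at h2
    refine ⟨z t, ⟨fun i => ⟨(hzp i).le, ?_⟩, ?_⟩, hzp, h1.le⟩
    · fin_cases i
      · simp only [z]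
        show 1 / μ 0 0 ≤ 2 / μ 0 0
        exact div_le_div_of_nonneg_right (by norm_num) (hμ 0 0).le
      · exact h2.1.le
      · exact h2.2.le
    · refine heμ.trans ?_
      exact Finset.single_le_sum (f := z t) (fun i _ => (hzp i).le) (Finset.mem_univ 0)
  obtain ⟨x, hxY, hxp, hxε⟩ := hpt
  obtain ⟨m, _, hm⟩ := hKa x hxp
  obtain ⟨y, hyK, hy⟩ := hK.exists_isMinOn ⟨_, hm m le_rfl⟩ (PP_cont hp).continuousOn
  obtain ⟨k, hk, hk'⟩ := hatt x hxY hxε (PP p y) (PP_pos (hKi hyK)) m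
  have : PP p y ≤ PP p ((TT g μ)^[k] x) := hy (hm k hk)
  linarith

end main

/-- Weights for the average Lyapunov function. -/
theorem weights {a0 a1 a2 b0 b1 b2 : ℝ} (ha0 : 0 < a0) (ha1 : 0 < a1)
    (hb0 : 0 < b0) (hb1 : 0 < b1) (hb2 : 0 < b2)
    (h : b0 * b1 * b2 < a0 * a1 * a2) :
    ∃ p0 p1 p2 : ℝ, 0 < p0 ∧ 0 < p1 ∧ 0 < p2 ∧
      p2 * b0 < p1 * a0 ∧ p0 * b1 < p2 * a1 ∧ p1 * b2 < p0 * a2 := by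
  -- `p1 = b0 (1 + t) / a0`, `p0 = a1 / (b1 (1 + t))` with `t` small
  have hev : ∀ᶠ t : ℝ in 𝓝[>] 0, b0 * b1 * b2 * (1 + t) ^ 2 < a0 * a1 * a2 := by
    have hc : Continuous fun t : ℝ => b0 * b1 * b2 * (1 + t) ^ 2 := by fun_prop
    have ht := hc.tendsto 0
    exact nhdsWithin_le_nhds (ht.eventually (gt_mem_nhds (by simpa using h)))
  have hev3 : ∀ᶠ t : ℝ in 𝓝[>] 0, 0 < t := self_mem_nhdsWithin
  obtain ⟨t, h1, h2⟩ := (hev.and hev3).exists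
  refine ⟨a0 * a1, b0 * b1 * (1 + t) ^ 2, a0 * b1 * (1 + t), by positivity, by positivity,
    by positivity, ?_, ?_, ?_⟩
  · have : 0 < a0 * b0 * b1 * (1 + t) * t := by positivity
    nlinarith
  · have : 0 < a0 * a1 * b1 * t := by positivity
    nlinarith
  · nlinarith

/-- Normalized growth function, extended by a constant to negative arguments. -/
noncomputable def gg (G : GrowthF) (r : ℝ) (s : ℝ) : ℝ := G.f (r * max s 0) r

theorem gg_GH (G : GrowthF) {r : ℝ} (hr : 0 < r) : GH (gg G r) := by
  have hcon : ContinuousOn (fun z => G.f z r) (Set.Ici 0) := fun z hz =>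
    (G.hasDeriv z r hz hr).continuousWithinAt
  have hd : ∀ z, 0 < z → HasDerivAt (fun w => G.f w r) (G.fz z r) z := fun z hz =>
    (G.hasDeriv z r hz.le hr).hasDerivAt (Ici_mem_nhds hz)
  have hanti : StrictAntiOn (fun z => G.f z r) (Set.Ici 0) := by
    refine strictAntiOn_of_deriv_neg (convex_Ici 0) hcon fun z hz => ?_
    rw [interior_Ici] at hz
    rw [(hd z hz).deriv]
    exact G.fz_neg z r (le_of_lt hz) hr
  have hmono : StrictMonoOn (fun z => z * G.f z r) (Set.Ici 0) := by
    refine strictMonoOn_of_deriv_pos (convex_Ici 0) (continuousOn_id.mul hcon) fun z hz => ?_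
    rw [interior_Ici] at hz
    have h1 : HasDerivAt (fun w => w * G.f w r) (1 * G.f z r + z * G.fz z r) z :=
      (hasDerivAt_id z).mul (hd z hz)
    rw [h1.deriv, one_mul]
    exact G.contest z r (le_of_lt hz) hr
  refine ⟨?_, ?_, ?_, ?_, ?_⟩
  · exact hcon.comp_continuous (by fun_prop) fun s => mul_nonneg hr.le (le_max_right _ _)
  · intro s
    exact G.pos _ _ (mul_nonneg hr.le (le_max_right _ _)) hr
  · intro s t hs hst
    unfold gg
    rw [max_eq_left hs, max_eq_left (hs.trans hst.le)]
    exact hanti (mul_nonneg hr.le hs) (mul_nonneg hr.le (hs.trans hst.le))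
      (mul_lt_mul_of_pos_left hst hr)
  · unfold gg
    rw [max_eq_left zero_le_one, mul_one]
    exact G.unit r hr
  · intro s t hs hst
    unfold gg
    rw [max_eq_left hs, max_eq_left (hs.trans hst)]
    have := hmono.monotoneOn (mul_nonneg hr.le hs : r * s ∈ Set.Ici 0)
      (mul_nonneg hr.le (hs.trans hst) : r * t ∈ Set.Ici 0) (mul_le_mul_of_nonneg_left hst hr.le)
    simp only [mul_assoc] at this
    exact le_of_mul_le_mul_left this hr

theorem permanent_congr {T S : (Fin 3 → ℝ) → (Fin 3 → ℝ)}
    (h : ∀ x ∈ intOrthant 3, T x = S x) (hS : ∀ x ∈ intOrthant 3, S x ∈ intOrthant 3)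
    (hP : Permanent S) : Permanent T := by
  obtain ⟨K, hK, hKi, hKK, hKa⟩ := hP
  have hit : ∀ k, ∀ x ∈ intOrthant 3, T^[k] x = S^[k] x := by
    intro k x hx
    induction k with
    | zero => rfl
    | succ k ih =>
      rw [Function.iterate_succ_apply', Function.iterate_succ_apply', ih,
        h _ (mapsTo_iter hS k x hx)]
  refine ⟨K, hK, hKi, ?_, ?_⟩
  · rintro _ ⟨x, hx, rfl⟩
    rw [h x (hKi hx)]
    exact hKK ⟨x, hx, rfl⟩
  · intro x hx
    obtain ⟨m, hm, hm'⟩ := hKa x hx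
    exact ⟨m, hm, fun k hk => by rw [hit k x hx]; exact hm' k hk⟩

/-- For T ∈ DCS(3,f) in the heteroclinic-cycle (May–Leonard)
configuration γ₁₂, γ₂₃, γ₃₁ > 0 and γ₂₁, γ₃₂, γ₁₃ < 0, set
ϱ = 𝒢₁₂𝒢₂₃𝒢₃₁ + 𝒢₂₁𝒢₁₃𝒢₃₂.  If ϱ > 0 then T is permanent; if ϱ < 0 then T
is impermanent. -/
theorem stmt6 (fam : Fin 3 → GrowthF) (r : Fin 3 → ℝ) (μ : Fin 3 → Fin 3 → ℝ)
    (hr : ∀ i, 0 < r i) (hμ : ∀ i j, 0 < μ i j)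
    (hγ12 : 0 < μ 0 0 - μ 1 0) (hγ23 : 0 < μ 1 1 - μ 2 1)
    (hγ31 : 0 < μ 2 2 - μ 0 2)
    (hγ21 : μ 1 1 - μ 0 1 < 0) (hγ32 : μ 2 2 - μ 1 2 < 0)
    (hγ13 : μ 0 0 - μ 2 0 < 0) :
    (0 < Gq fam r μ 0 1 * Gq fam r μ 1 2 * Gq fam r μ 2 0
        + Gq fam r μ 1 0 * Gq fam r μ 0 2 * Gq fam r μ 2 1 →
      Permanent (DCS.map fam r μ)) ∧
    (Gq fam r μ 0 1 * Gq fam r μ 1 2 * Gq fam r μ 2 0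
        + Gq fam r μ 1 0 * Gq fam r μ 0 2 * Gq fam r μ 2 1 < 0 →
      ¬ Permanent (DCS.map fam r μ)) := by
  set g : Fin 3 → ℝ → ℝ := fun i => gg (fam i) (r i) with hgdef
  have hg : ∀ i, GH (g i) := fun i => gg_GH (fam i) (hr i)
  have hd : ∀ i : Fin 3, μ (i + 1) i < μ i i ∧ μ (i + 1) (i + 1) < μ i (i + 1) := by
    intro i
    fin_cases i
    · exact ⟨sub_pos.1 hγ12, sub_neg.1 hγ21⟩
    · exact ⟨sub_pos.1 hγ23, sub_neg.1 hγ32⟩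
    · exact ⟨sub_pos.1 hγ31, sub_neg.1 hγ13⟩
  have hTS : ∀ x ∈ intOrthant 3, DCS.map fam r μ x = TT g μ x := by
    intro x hx
    funext i
    have hs := sum_nn hμ (fun i => (hx i).le) i
    simp only [DCS.map, DCS.F, TT, hgdef, gg, max_eq_left hs]
  have hSi : ∀ x ∈ intOrthant 3, TT g μ x ∈ intOrthant 3 := fun x hx => TT_pos hg hx
  have hTi : ∀ x ∈ intOrthant 3, DCS.map fam r μ x ∈ intOrthant 3 := fun x hx => by
    rw [hTS x hx]; exact hSi x hx
  have hG : ∀ i j, Gq fam r μ i j = Real.log (g j (μ j i / μ i i)) := by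
    intro i j
    have hs : 0 ≤ μ j i / μ i i := (div_pos (hμ j i) (hμ i i)).le
    simp only [Gq, hgdef, gg, max_eq_left hs]
  have hGii : ∀ i, Gq fam r μ i i = 0 := by
    intro i; rw [hG, div_self (hμ i i).ne', (hg i).one, Real.log_one]
  have hGpos : ∀ i j, μ j i < μ i i → 0 < Gq fam r μ i j := by
    intro i j h
    rw [hG]
    exact Real.log_pos ((hg j).gt_one (div_pos (hμ j i) (hμ i i)).le
      ((div_lt_one (hμ i i)).2 h))
  have hGneg : ∀ i j, μ i i < μ j i → Gq fam r μ i j < 0 := by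
    intro i j h
    rw [hG]
    exact Real.log_neg ((hg j).pos _) ((hg j).lt_one ((one_lt_div (hμ i i)).2 h))
  have hpsi : ∀ (p : Fin 3 → ℝ) i, psi g μ p (qq μ i) = ∑ j, p j * Gq fam r μ i j := by
    intro p i
    unfold psi
    refine Finset.sum_congr rfl fun j _ => ?_
    rw [hG]
    congr 3
    simp [qq, div_eq_mul_inv]
  have a0 := hGpos 0 1 (sub_pos.1 hγ12)
  have a1 := hGpos 1 2 (sub_pos.1 hγ23)
  have a2 := hGpos 2 0 (sub_pos.1 hγ31)
  have b1 := hGneg 1 0 (sub_neg.1 hγ21)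
  have b2 := hGneg 2 1 (sub_neg.1 hγ32)
  have b0 := hGneg 0 2 (sub_neg.1 hγ13)
  constructor
  · intro hrho
    obtain ⟨p0, p1, p2, hp0, hp1, hp2, e0, e1, e2⟩ := weights a0 a1
      (neg_pos.2 b0) (neg_pos.2 b1) (neg_pos.2 b2) (a2 := Gq fam r μ 2 0) (by linarith)
    refine permanent_congr hTS hSi (TT_permanent (p := ![p0, p1, p2]) hg hμ hd ?_ ?_)
    · intro i; fin_cases i
      · exact hp0
      · exact hp1
      · exact hp2
    · intro i
      rw [hpsi, Fin.sum_univ_three]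
      fin_cases i <;> simp [hGii] <;> linarith
  · intro hrho hperm
    obtain ⟨p1, p0, p2, hp1, hp0, hp2, e1, e0, e2⟩ := weights (neg_pos.2 b1) (neg_pos.2 b0)
      a1 a0 a2 (a2 := -Gq fam r μ 2 1) (by linarith)
    refine TT_impermanent (p := ![p0, p1, p2]) hg hμ hd ?_ ?_
      (permanent_congr (fun x hx => (hTS x hx).symm) hTi hperm)
    · intro i; fin_cases i
      · exact hp0
      · exact hp1
      · exact hp2
    · intro i
      rw [hpsi, Fin.sum_univ_three]
      fin_cases i <;> simp [hGii] <;> linarith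
end

section
/- Every T ∈ DCS(n,f) satisfies: (a) det DT(x) > 0 for all x ∈ ℝ₊ⁿ; (b) T is injective on ℝ₊ⁿ (hence a diffeomorphism from ℝ₊ⁿ onto its image); and (c) T is competitive on ℝ₊ⁿ, i.e., for all x, z ∈ ℝ₊ⁿ with T(x) ≤ T(z) componentwise and T(x) ≠ T(z), one has xᵢ < zᵢ for every index i with zᵢ > 0. -/
open Set Filter Metric Topology Polynomial

lemma exists_max_ratio {n : ℕ} (a x : Fin n → ℝ) (c : ℝ) (hx : ∀ i, 0 ≤ x i)
    (h0 : ∀ i, x i = 0 → a i = 0) (j : Fin n) (hj : c * x j < a j) :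
    ∃ l : ℝ, c < l ∧ ∃ i, 0 < x i ∧ a i = l * x i ∧ ∀ k, a k ≤ l * x k := by
  have pos_of : ∀ k, c * x k < a k → 0 < x k := by
    intro k hk
    rcases (hx k).lt_or_eq with h | h
    · exact h
    · rw [h0 k h.symm, ← h] at hk; simp at hk
  have hjp := pos_of j hj
  obtain ⟨i, hi, hmax⟩ := Finset.exists_max_image (Finset.univ.filter fun k => 0 < x k)
    (fun k => a k / x k) ⟨j, by simp [hjp]⟩
  have hip : 0 < x i := by simpa using hi
  refine ⟨a i / x i, ?_, i, hip, by field_simp, ?_⟩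
  · have h1 := hmax j (by simp [hjp])
    have h2 : c < a j / x j := by rwa [lt_div_iff₀ hjp]
    exact lt_of_lt_of_le h2 h1
  · intro k
    rcases (hx k).lt_or_eq with h | h
    · have h1 := hmax k (by simp [h])
      exact (div_le_iff₀ h).1 h1
    · rw [h0 k h.symm, ← h]; simp

lemma GrowthF.anti (g : GrowthF) (r : ℝ) (hr : 0 < r) :
    StrictAntiOn (fun w => g.f w r) (Set.Ici 0) := by
  apply strictAntiOn_of_hasDerivWithinAt_neg (f' := fun w => g.fz w r) (convex_Ici 0)
  · intro z hz
    exact (g.hasDeriv z r hz hr).continuousWithinAt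
  · intro z hz
    exact (g.hasDeriv z r (interior_subset hz) hr).mono interior_subset
  · intro z hz
    exact g.fz_neg z r (interior_subset hz) hr

lemma GrowthF.mono_mul (g : GrowthF) (r : ℝ) (hr : 0 < r) :
    StrictMonoOn (fun w => w * g.f w r) (Set.Ici 0) := by
  have hd : ∀ z : ℝ, 0 ≤ z →
      HasDerivWithinAt (fun w => w * g.f w r) (g.f z r + z * g.fz z r) (Set.Ici 0) z := by
    intro z hz
    have := (hasDerivWithinAt_id z (Set.Ici 0)).mul (g.hasDeriv z r hz hr)
    simp only [one_mul, id] at this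
    exact this
  apply strictMonoOn_of_hasDerivWithinAt_pos (f' := fun z => g.f z r + z * g.fz z r)
    (convex_Ici 0)
  · intro z hz
    exact (hd z hz).continuousWithinAt
  · intro z hz
    exact (hd z (interior_subset hz)).mono interior_subset
  · intro z hz
    exact g.contest z r (interior_subset hz) hr

lemma arg_nonneg {n : ℕ} (r : Fin n → ℝ)
    (μ : Fin n → Fin n → ℝ) (hr : ∀ i, 0 < r i) (hμ : ∀ i j, 0 < μ i j)
    (x : Fin n → ℝ) (hx : x ∈ orthant n) (i : Fin n) : 0 ≤ r i * ∑ j, μ i j * x j :=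
  mul_nonneg (hr i).le (Finset.sum_nonneg fun j _ => mul_nonneg (hμ i j).le (hx j))

lemma le_of_map_le {n : ℕ} (fam : Fin n → GrowthF) (r : Fin n → ℝ)
    (μ : Fin n → Fin n → ℝ) (hr : ∀ i, 0 < r i) (hμ : ∀ i j, 0 < μ i j)
    (x : Fin n → ℝ) (hx : x ∈ orthant n) (z : Fin n → ℝ) (hz : z ∈ orthant n)
    (h : ∀ i, DCS.map fam r μ x i ≤ DCS.map fam r μ z i) : ∀ i, x i ≤ z i := by
  by_contra! hc
  obtain ⟨j, hj⟩ := hc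
  have h0 : ∀ i, z i = 0 → x i = 0 := by
    intro i hi
    have h1 := h i
    simp only [DCS.map, DCS.F, hi, zero_mul] at h1
    have h2 := (fam i).pos _ _ (arg_nonneg r μ hr hμ x hx i) (hr i)
    have h3 := hx i
    by_contra h4
    have : 0 < x i := lt_of_le_of_ne h3 (Ne.symm h4)
    have := mul_pos this h2
    linarith
  obtain ⟨l, hl, i, hi, he, hk⟩ := exists_max_ratio x z 1 hz h0 j (by simpa using hj)
  have h1 := h i
  simp only [DCS.map, DCS.F] at h1
  have hAz := arg_nonneg r μ hr hμ z hz i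
  have hAx := arg_nonneg r μ hr hμ x hx i
  have hSz : 0 < r i * ∑ j, μ i j * z j :=
    mul_pos (hr i) (Finset.sum_pos' (fun j _ => mul_nonneg (hμ i j).le (hz j))
      ⟨i, Finset.mem_univ _, mul_pos (hμ i i) hi⟩)
  have hle : r i * ∑ j, μ i j * x j ≤ l * (r i * ∑ j, μ i j * z j) := by
    have : ∑ j, μ i j * x j ≤ l * ∑ j, μ i j * z j := by
      rw [Finset.mul_sum]
      apply Finset.sum_le_sum
      intro k _
      have := mul_le_mul_of_nonneg_left (hk k) (hμ i k).le
      linarith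
    have := mul_le_mul_of_nonneg_left this (hr i).le
    linarith
  generalize r i * ∑ j, μ i j * x j = a at *
  generalize r i * ∑ j, μ i j * z j = b at *
  have hlb : (0 : ℝ) ≤ l * b := by positivity
  have h2 : (fam i).f (l * b) (r i) ≤ (fam i).f a (r i) :=
    ((fam i).anti (r i) (hr i)).antitoneOn hAx hlb hle
  have h3 : b * (fam i).f b (r i) < l * b * (fam i).f (l * b) (r i) :=
    (fam i).mono_mul (r i) (hr i) hAz hlb (by nlinarith)
  have h4 : (fam i).f b (r i) < l * (fam i).f (l * b) (r i) := by
    by_contra! hc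
    have := mul_le_mul_of_nonneg_left hc hAz
    linarith
  rw [he] at h1
  have h5 : l * (fam i).f (l * b) (r i) ≤ l * (fam i).f a (r i) :=
    mul_le_mul_of_nonneg_left h2 (by linarith)
  have h6 := mul_lt_mul_of_pos_left (lt_of_lt_of_le h4 h5) hi
  linarith

lemma jac_det_pos {n : ℕ} (fam : Fin n → GrowthF) (r : Fin n → ℝ)
    (μ : Fin n → Fin n → ℝ) (hr : ∀ i, 0 < r i) (hμ : ∀ i j, 0 < μ i j)
    (x : Fin n → ℝ) (hx : x ∈ orthant n) : 0 < (DCS.jac fam r μ x).det := by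
  set F : Fin n → ℝ := fun i => DCS.F fam r μ i x with hF
  set g : Fin n → ℝ := fun i => (fam i).fz (r i * ∑ k, μ i k * x k) (r i) with hg
  have hFp : ∀ i, 0 < F i := fun i => (fam i).pos _ _ (arg_nonneg r μ hr hμ x hx i) (hr i)
  have hgn : ∀ i, g i < 0 := fun i => (fam i).fz_neg _ _ (arg_nonneg r μ hr hμ x hx i) (hr i)
  have hcon : ∀ i, 0 < F i + (r i * ∑ k, μ i k * x k) * g i :=
    fun i => (fam i).contest _ _ (arg_nonneg r μ hr hμ x hx i) (hr i)
  let M : ℝ → Matrix (Fin n) (Fin n) ℝ := fun t =>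
    Matrix.diagonal F + t • Matrix.of fun i j => x i * g i * (r i * μ i j)
  have hM1 : M 1 = DCS.jac fam r μ x := by
    ext i j
    simp [M, DCS.jac, Matrix.diagonal_apply, hF, hg]
  have hM0 : 0 < (M 0).det := by
    simp only [M, zero_smul, add_zero, Matrix.det_diagonal]
    exact Finset.prod_pos fun i _ => hFp i
  have hne : ∀ t ∈ Set.Icc (0 : ℝ) 1, (M t).det ≠ 0 := by
    intro t ht hdet
    obtain ⟨w, hw, hMw⟩ := Matrix.exists_mulVec_eq_zero_iff.2 hdet
    have hrow : ∀ i, F i * w i + t * (x i * g i * (r i * ∑ j, μ i j * w j)) = 0 := by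
      intro i
      have h1 := congrFun hMw i
      simp only [M, Matrix.add_mulVec, Matrix.smul_mulVec, Pi.add_apply, Pi.smul_apply,
        Matrix.mulVec_diagonal, smul_eq_mul, Pi.zero_apply] at h1
      rw [← h1]
      simp only [Matrix.mulVec, dotProduct, Matrix.of_apply, Finset.mul_sum]
      congr 1
      refine Finset.sum_congr rfl fun j _ => ?_
      ring
    obtain ⟨j, hj⟩ := Function.ne_iff.1 hw
    obtain ⟨l, hl, i, hi, he, hk⟩ := exists_max_ratio (fun i => |w i|) x 0 hx
      (by
        intro i hi
        have h1 := hrow i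
        rw [hi] at h1
        have h2 := (hFp i).ne'
        simp at h1
        simpa using h1.resolve_left h2) j (by simpa using hj)
    have hsum : |∑ j, μ i j * w j| ≤ l * ∑ j, μ i j * x j := by
      refine (Finset.abs_sum_le_sum_abs _ _).trans ?_
      rw [Finset.mul_sum]
      apply Finset.sum_le_sum
      intro k _
      rw [abs_mul, abs_of_pos (hμ i k)]
      have := mul_le_mul_of_nonneg_left (hk k) (hμ i k).le
      linarith
    have hxS : 0 ≤ ∑ j, μ i j * x j :=
      Finset.sum_nonneg fun j _ => mul_nonneg (hμ i j).le (hx j)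
    have h1 : F i * w i = t * (x i * (-g i) * r i) * ∑ j, μ i j * w j := by
      have := hrow i
      linarith
    have hcoef : 0 ≤ x i * (-g i) * r i :=
      mul_nonneg (mul_nonneg hi.le (by linarith [hgn i])) (hr i).le
    have h2 : F i * |w i| = t * (x i * (-g i) * r i) * |∑ j, μ i j * w j| := by
      have := congrArg abs h1
      rwa [abs_mul, abs_mul, abs_of_pos (hFp i),
        abs_of_nonneg (mul_nonneg ht.1 hcoef)] at this
    have h3 : t * (x i * (-g i) * r i) * |∑ j, μ i j * w j| ≤
        1 * (x i * (-g i) * r i) * (l * ∑ j, μ i j * x j) := by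
      have := ht.2
      gcongr
    have h4 := mul_pos (mul_pos hl hi) (hcon i)
    rw [he] at h2
    nlinarith
  have hcont : ContinuousOn (fun t => (M t).det) (Set.Icc 0 1) := by
    apply Continuous.continuousOn
    apply Continuous.matrix_det
    fun_prop
  rw [← hM1]
  by_contra! hc
  obtain ⟨t, ht, h0⟩ := intermediate_value_Icc' (zero_le_one) hcont ⟨hc, hM0.le⟩
  exact hne t ht h0

lemma map_hasFDeriv {n : ℕ} (fam : Fin n → GrowthF) (r : Fin n → ℝ)
    (μ : Fin n → Fin n → ℝ) (hr : ∀ i, 0 < r i) (hμ : ∀ i j, 0 < μ i j)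
    (x : Fin n → ℝ) (hx : x ∈ orthant n) :
    HasFDerivWithinAt (DCS.map fam r μ)
        (Matrix.mulVecLin (DCS.jac fam r μ x)).toContinuousLinearMap
        (orthant n) x := by
  rw [hasFDerivWithinAt_pi']
  intro i
  let L : (Fin n → ℝ) →L[ℝ] ℝ :=
    r i • ∑ j, μ i j • ContinuousLinearMap.proj (R := ℝ) (φ := fun _ : Fin n => ℝ) j
  have hL : ∀ y, L y = r i * ∑ j, μ i j * y j := by
    intro y
    simp [L]
  have h1 : HasFDerivWithinAt (fun y : Fin n → ℝ => r i * ∑ j, μ i j * y j) L (orthant n) x := by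
    have := L.hasFDerivWithinAt (s := orthant n) (x := x)
    exact this.congr (fun y _ => (hL y).symm) (hL x).symm
  have h2 := ((fam i).hasDeriv _ _ (arg_nonneg r μ hr hμ x hx i) (hr i)).comp_hasFDerivWithinAt
    x h1 (fun y hy => arg_nonneg r μ hr hμ y hy i)
  have h3 : HasFDerivWithinAt (fun y : Fin n → ℝ => y i)
      (ContinuousLinearMap.proj (R := ℝ) (φ := fun _ : Fin n => ℝ) i) (orthant n) x :=
    (ContinuousLinearMap.proj (R := ℝ) (φ := fun _ : Fin n => ℝ) i).hasFDerivWithinAt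
  have h4 := h3.mul h2
  refine HasFDerivWithinAt.congr_fderiv (f := fun y => DCS.map fam r μ y i) h4 ?_
  ext1 y
  simp only [_root_.add_apply, _root_.smul_apply, hL,
    ContinuousLinearMap.comp_apply, ContinuousLinearMap.proj_apply, smul_eq_mul,
    LinearMap.coe_toContinuousLinearMap', Matrix.mulVecLin_apply, Matrix.mulVec, dotProduct,
    DCS.jac, Matrix.of_apply, add_mul, Finset.sum_add_distrib, ite_mul, zero_mul,
    Finset.sum_ite_eq, Finset.mem_univ, if_true, Function.comp, DCS.F, Finset.mul_sum]
  rw [add_comm]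
  congr 1
  refine Finset.sum_congr rfl fun j _ => ?_
  ring

/-- Every T ∈ DCS(n,f) is differentiable on ℝ₊ⁿ with Jacobian
DT(x) of positive determinant, is injective on ℝ₊ⁿ, and is competitive. -/
theorem stmt7 (n : ℕ) (fam : Fin n → GrowthF) (r : Fin n → ℝ)
    (μ : Fin n → Fin n → ℝ) (hr : ∀ i, 0 < r i) (hμ : ∀ i j, 0 < μ i j) :
    (∀ x ∈ orthant n,
      HasFDerivWithinAt (DCS.map fam r μ)
        (Matrix.mulVecLin (DCS.jac fam r μ x)).toContinuousLinearMap
        (orthant n) x ∧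
      0 < (DCS.jac fam r μ x).det) ∧
    Set.InjOn (DCS.map fam r μ) (orthant n) ∧
    (∀ x ∈ orthant n, ∀ z ∈ orthant n,
      (∀ i, DCS.map fam r μ x i ≤ DCS.map fam r μ z i) →
      DCS.map fam r μ x ≠ DCS.map fam r μ z →
      ∀ i, 0 < z i → x i < z i) := by
  refine ⟨fun x hx => ⟨map_hasFDeriv fam r μ hr hμ x hx, jac_det_pos fam r μ hr hμ x hx⟩, ?_, ?_⟩
  · intro x hx z hz h
    ext i
    exact le_antisymm
      (le_of_map_le fam r μ hr hμ x hx z hz (fun i => (congrFun h i).le) i)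
      (le_of_map_le fam r μ hr hμ z hz x hx (fun i => (congrFun h i).ge) i)
  · intro x hx z hz h hne i hi
    have hle := le_of_map_le fam r μ hr hμ x hx z hz h
    refine lt_of_le_of_ne (hle i) fun he => ?_
    have hxz : ∃ j, x j < z j := by
      by_contra! hc
      exact hne (congrArg _ (funext fun j => le_antisymm (hle j) (hc j)))
    obtain ⟨j, hj⟩ := hxz
    have hlt : r i * ∑ j, μ i j * x j < r i * ∑ j, μ i j * z j := by
      refine mul_lt_mul_of_pos_left ?_ (hr i)
      exact Finset.sum_lt_sum (fun k _ => mul_le_mul_of_nonneg_left (hle k) (hμ i k).le)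
        ⟨j, Finset.mem_univ _, mul_lt_mul_of_pos_left hj (hμ i j)⟩
    have h1 : (fam i).f _ (r i) < (fam i).f _ (r i) := (fam i).anti (r i) (hr i)
      (arg_nonneg r μ hr hμ x hx i) (arg_nonneg r μ hr hμ z hz i) hlt
    have h2 := h i
    simp only [DCS.map, DCS.F, he] at h2
    have := mul_lt_mul_of_pos_left h1 hi
    linarith
end

section
/- Let T ∈ DCS(n,f) and suppose T has a unique fixed point p in int ℝ₊ⁿ. Then: (a) 1 is not an eigenvalue of DT(p); (b) DT(p) has a real eigenvalue λ* with 0 < λ* < 1 whose associated eigenvector can be chosen with all entries strictly positive; and (c) every eigenvalue of DT(p) has real part strictly greater than 0 and strictly less than 2. -/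
open Set Filter Metric Topology Polynomial

open Matrix in
theorem perron_aux {n : ℕ} [Nonempty (Fin n)] (A : Matrix (Fin n) (Fin n) ℝ)
    (hA : ∀ i j, 0 < A i j) :
    ∃ ρ : ℝ, 0 < ρ ∧ ∃ v : Fin n → ℝ, (∀ i, 0 < v i) ∧ A.mulVec v = ρ • v := by
  -- positivity of A on nonneg nonzero vectors
  have hpos : ∀ x : Fin n → ℝ, (∀ i, 0 ≤ x i) → x ≠ 0 → ∀ i, 0 < (A *ᵥ x) i := by
    intro x hx hx0 i
    obtain ⟨j, hj⟩ : ∃ j, x j ≠ 0 := by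
      by_contra! h
      exact hx0 (funext h)
    have hj' : 0 < x j := lt_of_le_of_ne (hx j) (Ne.symm hj)
    show 0 < ∑ k, A i k * x k
    exact Finset.sum_pos' (fun k _ => mul_nonneg (hA i k).le (hx k))
      ⟨j, Finset.mem_univ _, mul_pos (hA i j) hj'⟩
  set C : ℝ := ∑ i, ∑ j, A i j with hC
  have hbound : ∀ (ρ : ℝ) (x : Fin n → ℝ), x ∈ stdSimplex ℝ (Fin n) →
      (∀ i, ρ * x i ≤ (A *ᵥ x) i) → ρ ≤ C := by
    intro ρ x hx h
    calc ρ = ∑ i, ρ * x i := by rw [← Finset.mul_sum, hx.2, mul_one]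
      _ ≤ ∑ i, (A *ᵥ x) i := Finset.sum_le_sum fun i _ => h i
      _ ≤ C := by
        refine Finset.sum_le_sum fun i _ => ?_
        show ∑ j, A i j * x j ≤ _
        refine Finset.sum_le_sum fun j _ => ?_
        have : x j ≤ 1 := by
          rw [← hx.2]
          exact Finset.single_le_sum (f := x) (fun k _ => hx.1 k) (Finset.mem_univ j)
        have := mul_le_mul_of_nonneg_left this (hA i j).le
        linarith
  set K : Set (ℝ × (Fin n → ℝ)) :=
    (Set.Icc 0 C ×ˢ stdSimplex ℝ (Fin n)) ∩ {q | ∀ i, q.1 * q.2 i ≤ (A *ᵥ q.2) i} with hK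
  have hKc : IsCompact K := by
    refine (isCompact_Icc.prod (isCompact_stdSimplex ℝ (Fin n))).inter_right ?_
    simp only [Set.setOf_forall]
    refine isClosed_iInter fun i => ?_
    refine isClosed_le (by fun_prop) ?_
    have : (fun q : ℝ × (Fin n → ℝ) => (A *ᵥ q.2) i) = fun q => ∑ j, A i j * q.2 j := rfl
    rw [this]
    fun_prop
  have hCpos : 0 ≤ C := Finset.sum_nonneg fun i _ => Finset.sum_nonneg fun j _ => (hA i j).le
  have hKn : K.Nonempty := by
    obtain ⟨i0⟩ := ‹Nonempty (Fin n)›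
    have h1 := single_mem_stdSimplex ℝ i0
    refine ⟨(0, Pi.single i0 1), ⟨⟨⟨le_refl _, hCpos⟩, h1⟩, ?_⟩⟩
    intro i
    have : (Pi.single i0 1 : Fin n → ℝ) ≠ 0 := by
      intro h
      have := congrFun h i0
      simp at this
    have := (hpos _ h1.1 this i).le
    simpa using this
  obtain ⟨⟨ρ, x⟩, ⟨⟨hρ, hx⟩, hle⟩, hmax⟩ := hKc.exists_isMaxOn hKn continuous_fst.continuousOn
  simp only [Set.mem_setOf_eq] at hρ hx hle
  have hx0 : x ≠ 0 := by
    rintro rfl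
    have := hx.2
    simp at this
  have hy := hpos x hx.1 hx0
  have heq : A *ᵥ x = ρ • x := by
    by_contra hne
    set y := A *ᵥ x with hydef
    have hd : ∀ i, 0 < (A *ᵥ (y - ρ • x)) i := by
      refine hpos _ (fun i => ?_) (sub_ne_zero.mpr hne)
      have := hle i
      simp only [Pi.sub_apply, Pi.smul_apply, smul_eq_mul]
      linarith
    rw [Matrix.mulVec_sub, Matrix.mulVec_smul, ← hydef] at hd
    obtain ⟨i0, hi0⟩ := Finite.exists_min (fun i => (A *ᵥ y - ρ • y) i / y i)
    set ε := (A *ᵥ y - ρ • y) i0 / y i0 with hε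
    have hεpos : 0 < ε := div_pos (hd i0) (hy i0)
    have hstep : ∀ i, (ρ + ε) * y i ≤ (A *ᵥ y) i := by
      intro i
      have := (le_div_iff₀ (hy i)).mp (hi0 i)
      simp only [Pi.sub_apply, Pi.smul_apply, smul_eq_mul] at this
      linarith
    set s := ∑ i, y i with hs
    have hspos : 0 < s := Finset.sum_pos (fun i _ => hy i) Finset.univ_nonempty
    have hsx : s⁻¹ • y ∈ stdSimplex ℝ (Fin n) := by
      constructor
      · intro i
        exact mul_nonneg (inv_pos.mpr hspos).le (hy i).le
      · simp only [Pi.smul_apply, smul_eq_mul]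
        rw [← Finset.mul_sum, ← hs, inv_mul_cancel₀ hspos.ne']
    have hst : ∀ i, (ρ + ε) * (s⁻¹ • y) i ≤ (A *ᵥ (s⁻¹ • y)) i := by
      intro i
      rw [Matrix.mulVec_smul]
      simp only [Pi.smul_apply, smul_eq_mul]
      have := mul_le_mul_of_nonneg_left (hstep i) (inv_pos.mpr hspos).le
      linarith
    have hmem : (ρ + ε, s⁻¹ • y) ∈ K :=
      ⟨⟨⟨by have := hρ.1; linarith, hbound _ _ hsx hst⟩, hsx⟩, hst⟩
    have := hmax hmem
    simp only [Set.mem_setOf_eq] at this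
    linarith
  have hprod : ∀ i, 0 < ρ * x i := by
    intro i
    have := hy i
    rw [heq] at this
    simpa using this
  have hρpos : 0 < ρ := by
    obtain ⟨i0⟩ := ‹Nonempty (Fin n)›
    exact pos_of_mul_pos_left (hprod i0) (hx.1 i0)
  exact ⟨ρ, hρpos, x, fun i => pos_of_mul_pos_right (hprod i) hρ.1, heq⟩

theorem eig_bound {𝕜 : Type*} [RCLike 𝕜] {n : ℕ} (c p : Fin n → ℝ) (μ : Fin n → Fin n → ℝ)
    (hc : ∀ i, 0 < c i) (hc1 : ∀ i, c i < 1) (hp : ∀ i, 0 < p i) (hμ : ∀ i j, 0 < μ i j)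
    (hs : ∀ i, ∑ j, μ i j * p j = 1) (w : 𝕜) (v : Fin n → 𝕜) (hv : v ≠ 0)
    (h : ∀ i, ∑ j, ((c i * p i * μ i j : ℝ) : 𝕜) * v j = w * v i) : ‖w‖ < 1 := by
  obtain ⟨k, hk⟩ : ∃ k, v k ≠ 0 := by
    by_contra! h
    exact hv (funext h)
  have : Nonempty (Fin n) := ⟨k⟩
  obtain ⟨i, hi⟩ := Finite.exists_max (fun i => ‖v i‖ / p i)
  have hvi : 0 < ‖v i‖ / p i :=
    lt_of_lt_of_le (div_pos (norm_pos_iff.mpr hk) (hp k)) (hi k)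
  set u := ‖v i‖ / p i with hu
  have hvi' : ‖v i‖ = u * p i := by rw [hu, div_mul_cancel₀ _ (hp i).ne']
  have hj : ∀ j, ‖v j‖ ≤ u * p j := fun j => (div_le_iff₀ (hp j)).mp (hi j)
  have h1 : ‖w‖ * (u * p i) ≤ c i * (u * p i) := by
    calc ‖w‖ * (u * p i) = ‖w * v i‖ := by rw [norm_mul, hvi']
      _ = ‖∑ j, ((c i * p i * μ i j : ℝ) : 𝕜) * v j‖ := by rw [h i]
      _ ≤ ∑ j, ‖((c i * p i * μ i j : ℝ) : 𝕜) * v j‖ := norm_sum_le _ _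
      _ ≤ ∑ j, (c i * p i * u) * (μ i j * p j) := by
        refine Finset.sum_le_sum fun j _ => ?_
        have hpos : 0 < c i * p i * μ i j := mul_pos (mul_pos (hc i) (hp i)) (hμ i j)
        rw [norm_mul, RCLike.norm_ofReal, abs_of_pos hpos]
        have := mul_le_mul_of_nonneg_left (hj j) hpos.le
        linarith
      _ = c i * (u * p i) := by rw [← Finset.mul_sum, hs]; ring
  have := le_of_mul_le_mul_right h1 (mul_pos hvi (hp i))
  exact lt_of_le_of_lt this (hc1 i)

theorem GrowthF.eq_of_one (g : GrowthF) (z r : ℝ) (hz : 0 ≤ z) (hr : 0 < r)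
    (h : g.f z r = 1) : z = r := by
  have hanti : StrictAntiOn (fun w => g.f w r) (Set.Ici 0) := by
    refine strictAntiOn_of_deriv_neg (convex_Ici 0)
      (fun w hw => (g.hasDeriv w r hw hr).continuousWithinAt) ?_
    intro w hw
    rw [interior_Ici] at hw
    have hw' : (0:ℝ) < w := hw
    rw [((g.hasDeriv w r hw'.le hr).hasDerivAt (Ici_mem_nhds hw')).deriv]
    exact g.fz_neg w r hw'.le hr
  exact hanti.injOn hz hr.le (by simp only [h, g.unit r hr])

/-- If T ∈ DCS(n,f) has a unique fixed point p in int ℝ₊ⁿ, then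
(a) 1 is not an eigenvalue of DT(p); (b) DT(p) has a real eigenvalue λ* ∈ (0,1)
with a strictly positive eigenvector; (c) every (complex) eigenvalue of DT(p)
has real part in (0,2). -/
theorem stmt8 (n : ℕ) (fam : Fin n → GrowthF) (r : Fin n → ℝ)
    (μ : Fin n → Fin n → ℝ) (hr : ∀ i, 0 < r i) (hμ : ∀ i j, 0 < μ i j)
    (p : Fin n → ℝ) (hp : p ∈ intOrthant n) (hfix : DCS.map fam r μ p = p)
    (huniq : ∀ q ∈ intOrthant n, DCS.map fam r μ q = q → q = p) :
    (¬ Module.End.HasEigenvalue (Matrix.mulVecLin (DCS.jac fam r μ p)) (1 : ℝ)) ∧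
    (∃ lam : ℝ, 0 < lam ∧ lam < 1 ∧ ∃ v : Fin n → ℝ, (∀ i, 0 < v i) ∧
      (DCS.jac fam r μ p).mulVec v = lam • v) ∧
    (∀ z : ℂ,
      Module.End.HasEigenvalue
        (Matrix.mulVecLin ((DCS.jac fam r μ p).map (algebraMap ℝ ℂ))) z →
      0 < z.re ∧ z.re < 2) := by
  have hsum : ∀ i, ∑ j, μ i j * p j = 1 := by
    intro i
    have h1 : p i * DCS.F fam r μ i p = p i := congrFun hfix i
    have h2 : DCS.F fam r μ i p = 1 := by
      have := (hp i).ne'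
      field_simp at h1
      exact h1
    have h3 : 0 ≤ ∑ j, μ i j * p j :=
      Finset.sum_nonneg fun j _ => mul_nonneg (hμ i j).le (hp j).le
    have h4 := (fam i).eq_of_one _ (r i) (mul_nonneg (hr i).le h3) (hr i) h2
    exact mul_left_cancel₀ (hr i).ne' (by rw [h4, mul_one])
  set c : Fin n → ℝ := fun i => -(r i * (fam i).fz (r i) (r i)) with hcdef
  have hc : ∀ i, 0 < c i := fun i => by
    have := mul_neg_of_pos_of_neg (hr i) ((fam i).fz_neg (r i) (r i) (hr i).le (hr i))
    simp only [hcdef]; linarith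
  have hc1 : ∀ i, c i < 1 := fun i => by
    have := (fam i).contest (r i) (r i) (hr i).le (hr i)
    rw [(fam i).unit _ (hr i)] at this
    simp only [hcdef]; linarith
  set A : Matrix (Fin n) (Fin n) ℝ := Matrix.of fun i j => c i * p i * μ i j with hA
  have hjac : DCS.jac fam r μ p = 1 - A := by
    ext i j
    simp only [DCS.jac, DCS.F, hA, hcdef, Matrix.of_apply, Matrix.sub_apply, Matrix.one_apply,
      hsum, mul_one, (fam i).unit _ (hr i)]
    ring
  have hApos : ∀ i j, 0 < A i j := fun i j => mul_pos (mul_pos (hc i) (hp i)) (hμ i j)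
  rw [hjac]
  refine ⟨?_, ?_, ?_⟩
  · intro hev
    obtain ⟨v, hv⟩ := hev.exists_hasEigenvector
    have hv0 := hv.2
    have hAv : A.mulVec v = 0 := by
      have := hv.apply_eq_smul
      rw [Matrix.mulVecLin_apply, Matrix.sub_mulVec, Matrix.one_mulVec, one_smul] at this
      simpa using this
    have hmv : ∀ i, ∑ j, μ i j * v j = 0 := by
      intro i
      have h1 : ∑ j, c i * p i * μ i j * v j = 0 := congrFun hAv i
      simp only [mul_assoc] at h1
      rw [← Finset.mul_sum, ← Finset.mul_sum] at h1
      rcases mul_eq_zero.mp h1 with h | h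
      · exact absurd h (hc i).ne'
      · exact (mul_eq_zero.mp h).resolve_left (hp i).ne'
    -- perturb the fixed point
    have hev : ∀ᶠ t : ℝ in 𝓝[>] 0, ∀ i, 0 < p i + t * v i := by
      refine Filter.eventually_all.mpr fun i => ?_
      have hcont : Continuous fun t : ℝ => p i + t * v i := by fun_prop
      have : ∀ᶠ t : ℝ in 𝓝 0, 0 < p i + t * v i :=
        (hcont.tendsto 0).eventually (lt_mem_nhds (by simpa using hp i))
      exact this.filter_mono nhdsWithin_le_nhds
    obtain ⟨t, ht, htpos⟩ := (hev.and self_mem_nhdsWithin).exists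
    have htpos' : (0:ℝ) < t := htpos
    have hq := huniq (fun i => p i + t * v i) ht (by
      funext i
      have hs : ∑ j, μ i j * (p j + t * v j) = 1 := by
        have : ∀ j, μ i j * (p j + t * v j) = μ i j * p j + t * (μ i j * v j) := fun j => by ring
        simp only [this, Finset.sum_add_distrib, ← Finset.mul_sum, hsum, hmv]
        ring
      simp only [DCS.map, DCS.F, hs, mul_one, (fam i).unit _ (hr i)])
    apply hv0
    funext i
    have := congrFun hq i
    simp only [add_eq_left, mul_eq_zero] at this
    exact this.resolve_left htpos'.ne'
  · rcases isEmpty_or_nonempty (Fin n) with he | hne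
    · exact ⟨1/2, by norm_num, by norm_num, fun _ => 1, fun i => he.elim i,
        funext fun i => he.elim i⟩
    · obtain ⟨ρ, hρ, v, hv, hAv⟩ := perron_aux A hApos
      have hlt : ‖ρ‖ < 1 := by
        refine eig_bound (𝕜 := ℝ) c p μ hc hc1 hp hμ hsum ρ v ?_ ?_
        · rintro rfl
          obtain ⟨i0⟩ := hne
          exact lt_irrefl _ (hv i0)
        · intro i
          exact congrFun hAv i
      rw [Real.norm_eq_abs, abs_of_pos hρ] at hlt
      refine ⟨1 - ρ, by linarith, by linarith, v, hv, ?_⟩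
      rw [Matrix.sub_mulVec, Matrix.one_mulVec, hAv, sub_smul, one_smul]
  · intro z hz
    obtain ⟨v, hv⟩ := hz.exists_hasEigenvector
    have hlt : ‖1 - z‖ < 1 := by
      refine eig_bound (𝕜 := ℂ) c p μ hc hc1 hp hμ hsum (1 - z) v hv.2 ?_
      intro i
      have h1 := hv.apply_eq_smul
      have h2 : (1 - A).map (algebraMap ℝ ℂ) = 1 - A.map (algebraMap ℝ ℂ) := by
        rw [Matrix.map_sub _ (by simp), Matrix.map_one _ (by simp) (by simp)]
      rw [Matrix.mulVecLin_apply, h2, Matrix.sub_mulVec, Matrix.one_mulVec] at h1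
      have h3 : v i - ∑ j, ((c i * p i * μ i j : ℝ) : ℂ) * v j = z * v i := congrFun h1 i
      show ∑ j, ((c i * p i * μ i j : ℝ) : ℂ) * v j = _
      linear_combination -h3
    have h1 := lt_of_le_of_lt (Complex.abs_re_le_norm (1 - z)) hlt
    rw [abs_lt, Complex.sub_re, Complex.one_re] at h1
    constructor <;> linarith [h1.1, h1.2]
end
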